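/- Sobolev–Poincaré inequality, superquadratic case: Let p ≥ 2 and u be a weak solution of ∂_t(|u|^{p-2}u) − div A(x,t,u,Du) = div(|F|^{p-2}F) in Ω_T. Then on any cylinder Q_ρ^{(μ)}(z_o) ⊆ Ω_T with ρ, μ > 0 that is both μ-sub-intrinsic and μ-super-intrinsic with constant K, for any ε ∈ (0,1] one has, with q := max{np/(n+2), p−1} and c = c(n,p,L,K): ⨍⨍_{Q_ρ^{(μ)}(z_o)} |u − (u)_{z_o;ρ}^{(μ)}|^p/(μ^{2−p}ρ^p) dx dt ≤ ε sup_{t ∈ (t_o−ρ^p, t_o+ρ^p)} ⨍_{B_ρ^{(μ)}(x_o)} |u^⟨p/2⟩(·,t) − ((u)_{z_o;ρ}^{(μ)})^⟨p/2⟩|^2/ρ^p dx + (c/ε^{(p−q)/(2+q−p)}) [⨍⨍_{Q_ρ^{(μ)}(z_o)} (|Du|^q + |F|^q) dx dt]^{p/q}. -/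

import Mathlib

open MeasureTheory Set Filter
open scoped ENNReal Topology BigOperators

noncomputable section

abbrev Spc (n : ℕ) := EuclideanSpace ℝ (Fin n)
abbrev Vec (N : ℕ) := EuclideanSpace ℝ (Fin N)
abbrev Mat (N n : ℕ) := EuclideanSpace ℝ (Fin N × Fin n)

variable {n N : ℕ}

/-- Spatial partial derivative in direction `j` of a scalar function on space-time. -/
def pderivS (j : Fin n) (f : Spc n × ℝ → ℝ) (z : Spc n × ℝ) : ℝ :=
  fderiv ℝ (fun y => f (y, z.2)) z.1 (EuclideanSpace.single j 1)

/-- Time derivative of a vector-valued function on space-time. -/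
def tderiv (φ : Spc n × ℝ → Vec N) (z : Spc n × ℝ) : Vec N :=
  deriv (fun s => φ (z.1, s)) z.2

/-- Pairing `M · Dφ = ∑_{i,j} M_{ij} ∂_j φ_i` of a matrix field with the spatial gradient of a
test function. -/
def gradPair (M : Spc n × ℝ → Mat N n) (φ : Spc n × ℝ → Vec N) (z : Spc n × ℝ) : ℝ :=
  ∑ i : Fin N, ∑ j : Fin n, M z (i, j) * pderivS j (fun w => φ w i) z

/-- The power `w^⟨α⟩ := |w|^{α-1} w` of a vector. -/
def pw (α : ℝ) (w : Vec N) : Vec N := ‖w‖ ^ (α - 1) • w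

/-- Weak solution of the doubly nonlinear system
`∂_t(|u|^{p-2}u) − div A(x,t,u,Du) = div(|F|^{p-2}F)` in `Ω_T = Ω × (0,T)`. -/
structure WeakSolution (p ν L T : ℝ) (Ω : Set (Spc n))
    (A : Spc n × ℝ → Vec N → Mat N n → Mat N n)
    (F : Spc n × ℝ → Mat N n)
    (u : Spc n × ℝ → Vec N) (Du : Spc n × ℝ → Mat N n) : Prop where
  hn : 1 ≤ n
  hT : 0 < T
  openΩ : IsOpen Ω
  bddΩ : Bornology.IsBounded Ω
  connΩ : IsConnected Ω
  hν : 0 < ν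
  hνL : ν ≤ L
  measA : ∀ (v : Vec N) (ξ : Mat N n), Measurable fun z => A z v ξ
  contA : ∀ᵐ z ∂(volume.restrict (Ω ×ˢ Ioo 0 T)),
    Continuous fun q : Vec N × Mat N n => A z q.1 q.2
  coercivity : ∀ᵐ z ∂(volume.restrict (Ω ×ˢ Ioo 0 T)),
    ∀ (v : Vec N) (ξ : Mat N n), ν * ‖ξ‖ ^ p ≤ (inner ℝ (A z v ξ) ξ : ℝ)
  growth : ∀ᵐ z ∂(volume.restrict (Ω ×ˢ Ioo 0 T)),
    ∀ (v : Vec N) (ξ : Mat N n), ‖A z v ξ‖ ≤ L * ‖ξ‖ ^ (p - 1)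
  measu : Measurable u
  measDu : Measurable Du
  measF : Measurable F
  memLp_u : MemLp u (ENNReal.ofReal p) (volume.restrict (Ω ×ˢ Ioo 0 T))
  memLp_Du : MemLp Du (ENNReal.ofReal p) (volume.restrict (Ω ×ˢ Ioo 0 T))
  memLp_F : MemLp F (ENNReal.ofReal p) (volume.restrict (Ω ×ˢ Ioo 0 T))
  sliceLp : ∀ t ∈ Icc (0:ℝ) T,
    MemLp (fun x => u (x, t)) (ENNReal.ofReal p) (volume.restrict Ω)
  timeCont : ∀ t₀ ∈ Icc (0:ℝ) T,
    Tendsto (fun t => ∫ x in Ω, ‖u (x, t) - u (x, t₀)‖ ^ p) (𝓝[Icc (0:ℝ) T] t₀) (𝓝 0)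
  weakGrad : ∀ ψ : Spc n × ℝ → ℝ, ContDiff ℝ (⊤ : ℕ∞) ψ → HasCompactSupport ψ →
    tsupport ψ ⊆ Ω ×ˢ Ioo 0 T → ∀ (i : Fin N) (j : Fin n),
      ∫ z in Ω ×ˢ Ioo 0 T, u z i * pderivS j ψ z
        = - ∫ z in Ω ×ˢ Ioo 0 T, Du z (i, j) * ψ z
  weakForm : ∀ φ : Spc n × ℝ → Vec N, ContDiff ℝ (⊤ : ℕ∞) φ → HasCompactSupport φ →
    tsupport φ ⊆ Ω ×ˢ Ioo 0 T →
      ∫ z in Ω ×ˢ Ioo 0 T,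
        (‖u z‖ ^ (p - 2) * (inner ℝ (u z) (tderiv φ z) : ℝ)
          - gradPair (fun w => A w (u w) (Du w)) φ z)
        = ∫ z in Ω ×ˢ Ioo 0 T, ‖F z‖ ^ (p - 2) * gradPair F φ z

/-- The scaled parabolic cylinder `Q_ρ^{(μ)}(z₀)`:
`B_ρ(x₀) × (t₀ − μ^{p−2}ρ^p, t₀ + μ^{p−2}ρ^p)` if `p < 2`, and
`B_{μ^{(2−p)/p}ρ}(x₀) × (t₀ − ρ^p, t₀ + ρ^p)` if `p ≥ 2`. -/
def parCyl (p μ ρ : ℝ) (z₀ : Spc n × ℝ) : Set (Spc n × ℝ) :=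
  if p < 2 then
    Metric.ball z₀.1 ρ ×ˢ Ioo (z₀.2 - μ ^ (p - 2) * ρ ^ p) (z₀.2 + μ ^ (p - 2) * ρ ^ p)
  else
    Metric.ball z₀.1 (μ ^ ((2 - p) / p) * ρ) ×ˢ Ioo (z₀.2 - ρ ^ p) (z₀.2 + ρ ^ p)

/-- `Q_ρ^{(μ)}(z₀)` is `μ`-sub-intrinsic with constant `K`:
`⨍⨍ |u|^p/(μ^{2−𝔭}ρ^p) ≤ K μ^p ⨍⨍ (|Du|^p + |F|^p)`, where `𝔭 = max{p,2}`. -/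
def SubIntrinsic (p K μ ρ : ℝ) (z₀ : Spc n × ℝ) (u : Spc n × ℝ → Vec N)
    (Du F : Spc n × ℝ → Mat N n) : Prop :=
  ⨍ z in parCyl p μ ρ z₀, ‖u z‖ ^ p / (μ ^ (2 - max p 2) * ρ ^ p)
    ≤ K * μ ^ p * ⨍ z in parCyl p μ ρ z₀, (‖Du z‖ ^ p + ‖F z‖ ^ p)

/-- `Q_ρ^{(μ)}(z₀)` is `μ`-super-intrinsic with constant `K`:
either `μ^p ⨍⨍ (|Du|^p + |F|^p) ≤ K ⨍⨍ |u|^p/(μ^{2−𝔭}ρ^p)` or `μ^p ≤ K`. -/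
def SuperIntrinsic (p K μ ρ : ℝ) (z₀ : Spc n × ℝ) (u : Spc n × ℝ → Vec N)
    (Du F : Spc n × ℝ → Mat N n) : Prop :=
  (μ ^ p * ⨍ z in parCyl p μ ρ z₀, (‖Du z‖ ^ p + ‖F z‖ ^ p)
      ≤ K * ⨍ z in parCyl p μ ρ z₀, ‖u z‖ ^ p / (μ ^ (2 - max p 2) * ρ ^ p))
    ∨ μ ^ p ≤ K

/-- Monotonicity of the vectorial power: lower bound. -/
theorem pw_sub_lower {α : ℝ} (hα : 1 ≤ α) (a b : Vec N) :
    (‖a‖ + ‖b‖) ^ (α - 1) * ‖a - b‖ ≤ 2 ^ α * ‖pw α a - pw α b‖ := by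
  set s := ‖a‖ ^ (α - 1)
  set t := ‖b‖ ^ (α - 1)
  have hs : 0 ≤ s := by positivity
  have ht : 0 ≤ t := by positivity
  have hmono : 0 ≤ (s - t) * (‖a‖ ^ 2 - ‖b‖ ^ 2) := by
    rcases le_total ‖a‖ ‖b‖ with h | h
    · have h1 : s ≤ t := Real.rpow_le_rpow (norm_nonneg _) h (by linarith)
      have h2 : ‖a‖ ^ 2 ≤ ‖b‖ ^ 2 := by gcongr
      nlinarith
    · have h1 : t ≤ s := Real.rpow_le_rpow (norm_nonneg _) h (by linarith)
      have h2 : ‖b‖ ^ 2 ≤ ‖a‖ ^ 2 := by gcongr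
      nlinarith
  have hin : (inner ℝ (pw α a - pw α b) (a - b) : ℝ)
      = (s + t) / 2 * ‖a - b‖ ^ 2 + (s - t) * (‖a‖ ^ 2 - ‖b‖ ^ 2) / 2 := by
    rw [norm_sub_sq_real]
    simp only [pw, inner_sub_left, inner_sub_right, inner_smul_left, real_inner_self_eq_norm_sq,
      real_inner_comm a b, conj_trivial]
    ring
  have hcs : (s + t) / 2 * ‖a - b‖ ^ 2 ≤ ‖pw α a - pw α b‖ * ‖a - b‖ := by
    have := real_inner_le_norm (pw α a - pw α b) (a - b)
    linarith
  have hst : (‖a‖ + ‖b‖) ^ (α - 1) ≤ 2 ^ (α - 1) * (s + t) := by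
    calc (‖a‖ + ‖b‖) ^ (α - 1) ≤ (2 * max ‖a‖ ‖b‖) ^ (α - 1) := by
          apply Real.rpow_le_rpow (by positivity) _ (by linarith)
          linarith [le_max_left ‖a‖ ‖b‖, le_max_right ‖a‖ ‖b‖]
      _ = 2 ^ (α - 1) * (max ‖a‖ ‖b‖) ^ (α - 1) :=
          Real.mul_rpow (by norm_num) (le_max_of_le_left (norm_nonneg _))
      _ ≤ _ := by
          gcongr
          rcases max_choice ‖a‖ ‖b‖ with h | h <;> rw [h]
          · exact le_add_of_nonneg_right ht
          · exact le_add_of_nonneg_left hs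
  have h2 : (2 : ℝ) ^ α = 2 ^ (α - 1) * 2 := by
    rw [← Real.rpow_add_one (by norm_num)]; ring_nf
  rcases eq_or_lt_of_le (norm_nonneg (a - b)) with h0 | h0
  · rw [← h0]; simp only [mul_zero]; positivity
  have h3 : (s + t) / 2 * ‖a - b‖ ≤ ‖pw α a - pw α b‖ := by
    refine le_of_mul_le_mul_right ?_ h0
    linarith [hcs, sq ‖a - b‖]
  calc (‖a‖ + ‖b‖) ^ (α - 1) * ‖a - b‖ ≤ 2 ^ (α - 1) * (s + t) * ‖a - b‖ := by gcongr
    _ = 2 ^ α * ((s + t) / 2 * ‖a - b‖) := by rw [h2]; ring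
    _ ≤ _ := by gcongr

/-- Bernoulli-type inequality `(s - t) s^(α-1) ...` for powers of nonnegative reals. -/
theorem rpow_sub_rpow_le {α s t : ℝ} (hα : 1 ≤ α) (ht : 0 ≤ t) (hts : t ≤ s) :
    s ^ α - t ^ α ≤ α * s ^ (α - 1) * (s - t) := by
  rcases eq_or_lt_of_le (ht.trans hts) with h | hs
  · have : t = 0 := le_antisymm (h ▸ hts) ht
    subst this; rw [← h]; simp
  have hb := one_add_mul_self_le_rpow_one_add (s := t / s - 1) (by
    have : 0 ≤ t / s := by positivity
    linarith) hα
  have h1 : (t / s) ^ α = t ^ α / s ^ α := Real.div_rpow ht hs.le _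
  have h2 : s ^ α = s ^ (α - 1) * s := by rw [← Real.rpow_add_one hs.ne']; ring_nf
  have hsp : 0 < s ^ α := by positivity
  rw [show 1 + (t / s - 1) = t / s by ring, h1, le_div_iff₀ hsp] at hb
  have h3 : (1 + α * (t / s - 1)) * s ^ α = s ^ α + α * s ^ (α - 1) * (t - s) := by
    rw [h2]; field_simp
  nlinarith

/-- Local Lipschitz bound for the vectorial power. -/
theorem pw_sub_upper {α : ℝ} (hα : 1 ≤ α) (a b : Vec N) :
    ‖pw α a - pw α b‖ ≤ (1 + α) * (‖a‖ + ‖b‖) ^ (α - 1) * ‖a - b‖ := by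
  wlog h : ‖b‖ ≤ ‖a‖ generalizing a b
  · have := this b a (le_of_not_ge h)
    rwa [norm_sub_rev, norm_sub_rev b a, add_comm ‖b‖] at this
  set s := ‖a‖ ^ (α - 1)
  set t := ‖b‖ ^ (α - 1) with ht
  have hs : 0 ≤ s := by positivity
  have hts : t ≤ s := Real.rpow_le_rpow (norm_nonneg _) h (by linarith)
  have hdec : pw α a - pw α b = s • (a - b) + (s - t) • b := by
    simp only [pw, smul_sub, sub_smul]; abel
  have h1 : (s - t) * ‖b‖ ≤ α * s * ‖a - b‖ := by
    have hpow : ∀ x : ℝ, 0 ≤ x → x ^ α = x ^ (α - 1) * x := fun x hx => by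
      rcases eq_or_lt_of_le hx with h0 | h0
      · rw [← h0, Real.zero_rpow (by linarith)]; simp
      · rw [← Real.rpow_add_one h0.ne']; ring_nf
    have := rpow_sub_rpow_le hα (norm_nonneg b) h
    rw [hpow _ (norm_nonneg a), hpow _ (norm_nonneg b)] at this
    have h2 : ‖a‖ - ‖b‖ ≤ ‖a - b‖ := norm_sub_norm_le a b
    calc (s - t) * ‖b‖ ≤ s * ‖a‖ - t * ‖b‖ := by nlinarith
      _ ≤ α * s * (‖a‖ - ‖b‖) := this
      _ ≤ _ := by gcongr
  have h3 : s ≤ (‖a‖ + ‖b‖) ^ (α - 1) :=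
    Real.rpow_le_rpow (norm_nonneg _) (by linarith [norm_nonneg b]) (by linarith)
  calc ‖pw α a - pw α b‖ ≤ s * ‖a - b‖ + (s - t) * ‖b‖ := by
        rw [hdec]
        refine (norm_add_le _ _).trans ?_
        rw [norm_smul, norm_smul, Real.norm_of_nonneg hs, Real.norm_of_nonneg (sub_nonneg.2 hts)]
    _ ≤ (1 + α) * s * ‖a - b‖ := by linarith
    _ ≤ _ := by gcongr

theorem norm_pw {α : ℝ} (hα : 0 < α) (a : Vec N) : ‖pw α a‖ = ‖a‖ ^ α := by
  rw [pw, norm_smul, Real.norm_of_nonneg (by positivity)]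
  rcases eq_or_lt_of_le (norm_nonneg a) with h0 | h0
  · rw [← h0, Real.zero_rpow hα.ne']; simp
  · rw [← Real.rpow_add_one h0.ne']; ring_nf

theorem pw_pw_inv {α : ℝ} (hα : 0 < α) (a : Vec N) : pw α (pw α⁻¹ a) = a := by
  rcases eq_or_ne a 0 with rfl | h
  · simp [pw]
  have h0 : 0 < ‖a‖ := norm_pos_iff.2 h
  rw [pw, norm_pw (inv_pos.2 hα), pw, smul_smul, ← Real.rpow_mul h0.le, ← Real.rpow_add h0]
  rw [show α⁻¹ * (α - 1) + (α⁻¹ - 1) = 0 by field_simp; ring]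
  simp

theorem measurable_pw (α : ℝ) : Measurable (pw α : Vec N → Vec N) := by
  unfold pw; fun_prop

/-- Normalized Lebesgue measure on a ball. -/
def ballProb (x₀ : Spc n) (r : ℝ) : Measure (Spc n) :=
  (volume (Metric.ball x₀ r))⁻¹ • volume.restrict (Metric.ball x₀ r)

theorem isProbabilityMeasure_ballProb (x₀ : Spc n) {r : ℝ} (hr : 0 < r) :
    IsProbabilityMeasure (ballProb x₀ r) := by
  refine ⟨?_⟩
  rw [ballProb, Measure.smul_apply, Measure.restrict_apply_univ, smul_eq_mul]
  exact ENNReal.inv_mul_cancel (Metric.measure_ball_pos _ _ hr).ne' measure_ball_lt_top.ne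

theorem lintegral_comp_add_smul (H : Spc n → ℝ≥0∞) (hH : Measurable H) (w : Spc n) {s : ℝ}
    (hs : 0 < s) : ∫⁻ y, H (w + s • y) = ENNReal.ofReal (s ^ n)⁻¹ * ∫⁻ y, H y := by
  have h1 : ∫⁻ y, H (w + s • y) = ∫⁻ y, H (w + y) ∂(Measure.map (s • ·) volume) := by
    rw [lintegral_map (by fun_prop) (by fun_prop)]
  rw [h1, Measure.map_addHaar_smul _ hs.ne', lintegral_smul_measure, lintegral_add_left_eq_self H w]
  rw [finrank_euclideanSpace, Fintype.card_fin, abs_of_pos (by positivity)]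
  rfl

theorem enorm_sub_le_lintegral_segment {V : Type*} [NormedAddCommGroup V] [NormedSpace ℝ V]
    {f : Spc n → V} (hf : ContDiff ℝ 1 f) (x y : Spc n) :
    ‖f x - f y‖ₑ ≤ ∫⁻ s in Ioc (0 : ℝ) 1, ‖fderiv ℝ f ((1 - s) • x + s • y)‖ₑ * ‖y - x‖ₑ := by
  have hg : ContDiff ℝ 1 (fun s : ℝ => f ((1 - s) • x + s • y)) := hf.comp (by fun_prop)
  have h := enorm_sub_le_lintegral_deriv_of_contDiffOn_Icc (a := 0) (b := 1) hg.contDiffOn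
    zero_le_one
  simp only [sub_self, zero_smul, one_smul, zero_add, sub_zero, add_zero] at h
  rw [← edist_eq_enorm_sub, edist_comm, edist_eq_enorm_sub]
  refine h.trans ?_
  rw [← restrict_Ioc_eq_restrict_Icc]
  refine lintegral_mono fun s => ?_
  have hd : HasDerivAt (fun s : ℝ => (1 - s) • x + s • y) (y - x) s := by
    have h1 : HasDerivAt (fun s : ℝ => (1 - s)) (-1) s := by
      simpa using (hasDerivAt_id s).const_sub 1
    have h2 : HasDerivAt (fun s : ℝ => (1 - s) • x + s • y) ((-1 : ℝ) • x + (1 : ℝ) • y) s :=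
      (h1.smul_const x).add ((hasDerivAt_id s).smul_const y)
    rwa [neg_one_smul, one_smul, neg_add_eq_sub] at h2
  have hfd := (hf.differentiable one_ne_zero ((1 - s) • x + s • y)).hasFDerivAt
  have := (hfd.comp_hasDerivAt s hd).deriv
  simp only [Function.comp_def] at this
  simp only [this]
  exact ContinuousLinearMap.le_opENorm _ _

theorem lintegral_convexComb_le {H : Spc n → ℝ≥0∞} (hH : Measurable H) (E B : Set (Spc n))
    (hEB : E ⊆ B) {s : ℝ} (hs : s ∈ Ioc (0 : ℝ) 1) :
    ∫⁻ x in E, ∫⁻ y in B, H ((1 - s) • x + s • y)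
      ≤ min (volume E * ENNReal.ofReal (s ^ n)⁻¹) (ENNReal.ofReal (2 ^ n) * volume B)
        * ∫⁻ z, H z := by
  have hfirst : ∫⁻ x in E, ∫⁻ y in B, H ((1 - s) • x + s • y)
      ≤ volume E * ENNReal.ofReal (s ^ n)⁻¹ * ∫⁻ z, H z := by
    calc ∫⁻ x in E, ∫⁻ y in B, H ((1 - s) • x + s • y)
        ≤ ∫⁻ x in E, ∫⁻ y, H ((1 - s) • x + s • y) :=
          lintegral_mono fun x => setLIntegral_le_lintegral _ _
      _ = ∫⁻ x in E, ENNReal.ofReal (s ^ n)⁻¹ * ∫⁻ z, H z := by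
          simp_rw [lintegral_comp_add_smul H hH _ hs.1]
      _ = _ := by rw [setLIntegral_const]; ring
  rw [min_mul_of_nonneg _ _ (zero_le)]
  refine le_min hfirst ?_
  rcases le_or_gt s (1 / 2) with h | h
  · have hs' : 0 < 1 - s := by linarith
    calc ∫⁻ x in E, ∫⁻ y in B, H ((1 - s) • x + s • y)
        ≤ ∫⁻ x, ∫⁻ y in B, H (s • y + (1 - s) • x) := by
          simp_rw [add_comm ((1 - s) • _)]
          exact setLIntegral_le_lintegral _ _
      _ = ∫⁻ y in B, ∫⁻ x, H (s • y + (1 - s) • x) := by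
          rw [lintegral_lintegral_swap]
          fun_prop
      _ = ∫⁻ y in B, ENNReal.ofReal ((1 - s) ^ n)⁻¹ * ∫⁻ z, H z := by
          simp_rw [lintegral_comp_add_smul H hH _ hs']
      _ = ENNReal.ofReal ((1 - s) ^ n)⁻¹ * volume B * ∫⁻ z, H z := by
          rw [setLIntegral_const]; ring
      _ ≤ _ := by
          gcongr
          rw [← inv_pow]
          gcongr
          rw [inv_le_comm₀ hs' (by norm_num)]; linarith
  · refine hfirst.trans ?_
    rw [mul_comm (ENNReal.ofReal (2 ^ n))]
    gcongr
    rw [← inv_pow]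
    have := hs.1
    gcongr
    rw [inv_le_comm₀ hs.1 (by norm_num)]; linarith

theorem lintegral_min_rpow_le {m : ℕ} (hm : 2 ≤ m) {e : ℝ} (he : 0 < e) :
    ∫⁻ s in Ioc (0 : ℝ) 1, min (ENNReal.ofReal (e * (s ^ m)⁻¹)) (ENNReal.ofReal (2 ^ m))
      ≤ ENNReal.ofReal ((2 ^ m + 1) * e ^ (1 / (m : ℝ))) := by
  have hmR : (2 : ℝ) ≤ m := by exact_mod_cast hm
  set s₀ := e ^ (1 / (m : ℝ)) with hs₀
  have hs₀p : 0 < s₀ := by positivity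
  have hsub : Ioc (0 : ℝ) 1 ⊆ Ioc 0 s₀ ∪ Ioi s₀ := fun s hs => by
    rcases le_or_gt s s₀ with h | h
    · exact Or.inl ⟨hs.1, h⟩
    · exact Or.inr h
  have h1 : ∫⁻ s in Ioc 0 s₀, min (ENNReal.ofReal (e * (s ^ m)⁻¹)) (ENNReal.ofReal (2 ^ m))
      ≤ ENNReal.ofReal (2 ^ m * s₀) := by
    calc _ ≤ ∫⁻ s in Ioc 0 s₀, ENNReal.ofReal (2 ^ m) := lintegral_mono fun s => min_le_right _ _
      _ = _ := by
        rw [setLIntegral_const, Real.volume_Ioc, sub_zero, ← ENNReal.ofReal_mul (by positivity)]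
  have h2 : ∫⁻ s in Ioi s₀, min (ENNReal.ofReal (e * (s ^ m)⁻¹)) (ENNReal.ofReal (2 ^ m))
      ≤ ENNReal.ofReal s₀ := by
    have hint : IntegrableOn (fun s : ℝ => e * s ^ (-(m : ℝ))) (Ioi s₀) :=
      (integrableOn_Ioi_rpow_of_lt (by linarith) hs₀p).const_mul e
    calc _ ≤ ∫⁻ s in Ioi s₀, ENNReal.ofReal (e * s ^ (-(m : ℝ))) := by
          refine setLIntegral_mono (by fun_prop) fun s hs => (min_le_left _ _).trans ?_
          have : 0 < s := hs₀p.trans hs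
          rw [Real.rpow_neg this.le, Real.rpow_natCast]
      _ = ENNReal.ofReal (∫ s in Ioi s₀, e * s ^ (-(m : ℝ))) := by
          rw [ofReal_integral_eq_lintegral_ofReal hint]
          filter_upwards [ae_restrict_mem measurableSet_Ioi] with s hs
          have : 0 < s := hs₀p.trans hs
          show (0:ℝ) ≤ e * s ^ (-(m : ℝ))
          positivity
      _ ≤ _ := by
          gcongr
          rw [integral_const_mul, integral_Ioi_rpow_of_lt (by linarith) hs₀p]
          have hes : e = s₀ ^ (m : ℝ) := by
            rw [hs₀, ← Real.rpow_mul he.le]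
            rw [one_div_mul_cancel (by positivity), Real.rpow_one]
          have : e * (-s₀ ^ (-(m : ℝ) + 1) / (-(m : ℝ) + 1)) = s₀ / (m - 1) := by
            rw [hes, show (-(m : ℝ) + 1) = -((m : ℝ) - 1) by ring, neg_div_neg_eq, ← mul_div_assoc,
              ← Real.rpow_add hs₀p]
            congr 1
            rw [show (m : ℝ) + -((m : ℝ) - 1) = 1 by ring, Real.rpow_one]
          rw [this]
          exact div_le_self hs₀p.le (by linarith)
  calc _ ≤ ∫⁻ s in Ioc 0 s₀ ∪ Ioi s₀,
        min (ENNReal.ofReal (e * (s ^ m)⁻¹)) (ENNReal.ofReal (2 ^ m)) :=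
        lintegral_mono_set hsub
    _ ≤ _ := lintegral_union_le _ _ _
    _ ≤ ENNReal.ofReal (2 ^ m * s₀) + ENNReal.ofReal s₀ := add_le_add h1 h2
    _ = _ := by rw [← ENNReal.ofReal_add (by positivity) hs₀p.le]; ring_nf

/-- Weak-type form of the Poincaré inequality on balls, for `C¹` maps. -/
theorem lintegral_osc_le {m : ℕ} (hm : 2 ≤ m) (hnm : n ≤ m)
    {V : Type*} [NormedAddCommGroup V] [NormedSpace ℝ V]
    {f : Spc n → V} (hf : ContDiff ℝ 1 f) (x₀ : Spc n) {r : ℝ} (hr : 0 < r)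
    {E : Set (Spc n)} (hE : MeasurableSet E) :
    ∫⁻ x in E, ∫⁻ y, ‖f x - f y‖ₑ ∂(ballProb x₀ r) ∂(ballProb x₀ r)
      ≤ ENNReal.ofReal (2 * r * (2 ^ m + 1)) * (ballProb x₀ r E) ^ (1 / (m : ℝ))
        * ∫⁻ z, ‖fderiv ℝ f z‖ₑ ∂(ballProb x₀ r) := by
  have := isProbabilityMeasure_ballProb x₀ hr
  set B := Metric.ball x₀ r with hB
  set P := ballProb x₀ r with hP
  rcases eq_or_ne (P E) 0 with h0 | h0
  · rw [Measure.restrict_eq_zero.2 h0]; simp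
  have hvB0 : volume B ≠ 0 := (Metric.measure_ball_pos _ _ hr).ne'
  have hvBt : volume B ≠ ⊤ := measure_ball_lt_top.ne
  set H : Spc n → ℝ≥0∞ := B.indicator fun z => ‖fderiv ℝ f z‖ₑ with hH
  have hHm : Measurable H :=
    ((hf.continuous_fderiv one_ne_zero).enorm.measurable).indicator Metric.isOpen_ball.measurableSet
  have hPE : P E = (volume B)⁻¹ * volume (E ∩ B) := by
    rw [hP, ballProb, Measure.smul_apply, Measure.restrict_apply hE, smul_eq_mul]
  have hHint : ∫⁻ z, H z = volume B * ∫⁻ z, ‖fderiv ℝ f z‖ₑ ∂P := by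
    rw [hH, lintegral_indicator Metric.isOpen_ball.measurableSet, hP, ballProb,
      lintegral_smul_measure, smul_eq_mul, ← mul_assoc, ENNReal.mul_inv_cancel hvB0 hvBt, one_mul]
  have hlhs : ∫⁻ x in E, ∫⁻ y, ‖f x - f y‖ₑ ∂P ∂P
      = (volume B)⁻¹ * ((volume B)⁻¹ * ∫⁻ x in E ∩ B, ∫⁻ y in B, ‖f x - f y‖ₑ) := by
    rw [hP, ballProb, Measure.restrict_smul, lintegral_smul_measure, Measure.restrict_restrict hE]
    simp_rw [lintegral_smul_measure, smul_eq_mul]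
    rw [lintegral_const_mul' _ _ (ENNReal.inv_ne_top.2 hvB0)]
  have hmain : ∫⁻ x in E ∩ B, ∫⁻ y in B, ‖f x - f y‖ₑ
      ≤ ENNReal.ofReal (2 * r) * ∫⁻ s in Ioc (0 : ℝ) 1, ∫⁻ x in E ∩ B, ∫⁻ y in B,
          H ((1 - s) • x + s • y) := by
    have hstep : ∀ x ∈ E ∩ B, ∀ y ∈ B, ‖f x - f y‖ₑ
        ≤ ENNReal.ofReal (2 * r) * ∫⁻ s in Ioc (0 : ℝ) 1, H ((1 - s) • x + s • y) := by
      intro x hx y hy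
      refine (enorm_sub_le_lintegral_segment hf x y).trans ?_
      rw [← lintegral_const_mul' _ _ ENNReal.ofReal_ne_top]
      refine setLIntegral_mono (measurable_const.mul (hHm.comp (by fun_prop))) fun s hs => ?_
      have hmem : (1 - s) • x + s • y ∈ B :=
        (convex_ball x₀ r) hx.2 hy (by linarith [hs.2]) hs.1.le (by ring)
      rw [hH, indicator_of_mem hmem, mul_comm]
      gcongr
      rw [← edist_eq_enorm_sub, edist_dist]
      gcongr
      have h1 := Metric.mem_ball.1 hx.2
      have h2 := Metric.mem_ball.1 hy
      have := dist_triangle_right y x x₀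
      linarith
    calc ∫⁻ x in E ∩ B, ∫⁻ y in B, ‖f x - f y‖ₑ
        ≤ ∫⁻ x in E ∩ B, ∫⁻ y in B, ENNReal.ofReal (2 * r) *
            ∫⁻ s in Ioc (0 : ℝ) 1, H ((1 - s) • x + s • y) := by
          refine setLIntegral_mono' (hE.inter Metric.isOpen_ball.measurableSet) fun x hx => ?_
          exact setLIntegral_mono' Metric.isOpen_ball.measurableSet fun y hy => hstep x hx y hy
      _ = ENNReal.ofReal (2 * r) * ∫⁻ x in E ∩ B, ∫⁻ y in B,
            ∫⁻ s in Ioc (0 : ℝ) 1, H ((1 - s) • x + s • y) := by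
          simp_rw [lintegral_const_mul' _ _ (ENNReal.ofReal_ne_top (r := 2 * r))]
      _ = ENNReal.ofReal (2 * r) * ∫⁻ x in E ∩ B, ∫⁻ s in Ioc (0 : ℝ) 1,
            ∫⁻ y in B, H ((1 - s) • x + s • y) := by
          congr 1
          refine lintegral_congr fun x => ?_
          rw [lintegral_lintegral_swap]
          exact (hHm.comp (g := H) (f := fun q : Spc n × ℝ => (1 - q.2) • x + q.2 • q.1)
            (by fun_prop)).aemeasurable
      _ = _ := by
          congr 1
          rw [lintegral_lintegral_swap]
          refine Measurable.aemeasurable ?_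
          refine Measurable.lintegral_prod_right' (f := fun q : (Spc n × ℝ) × Spc n =>
            H ((1 - q.1.2) • q.1.1 + q.1.2 • q.2)) (hHm.comp (by fun_prop))
  set e := (P E).toReal with he
  have hePE : P E = ENNReal.ofReal e := (ENNReal.ofReal_toReal (measure_ne_top _ _)).symm
  have he0 : 0 < e := ENNReal.toReal_pos h0 (measure_ne_top _ _)
  have hvol : volume (E ∩ B) = volume B * ENNReal.ofReal e := by
    rw [← hePE, hPE, ← mul_assoc, ENNReal.mul_inv_cancel hvB0 hvBt, one_mul]
  have hs : ∫⁻ s in Ioc (0 : ℝ) 1, ∫⁻ x in E ∩ B, ∫⁻ y in B, H ((1 - s) • x + s • y)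
      ≤ ENNReal.ofReal ((2 ^ m + 1) * e ^ (1 / (m : ℝ))) * (volume B * ∫⁻ z, H z) := by
    calc _ ≤ ∫⁻ s in Ioc (0 : ℝ) 1, min (ENNReal.ofReal (e * (s ^ m)⁻¹)) (ENNReal.ofReal (2 ^ m))
            * (volume B * ∫⁻ z, H z) := by
          refine setLIntegral_mono' measurableSet_Ioc fun s hs => ?_
          refine (lintegral_convexComb_le hHm (E ∩ B) B inter_subset_right hs).trans ?_
          rw [← mul_assoc]
          refine mul_le_mul_left ?_ _
          rw [min_mul_of_nonneg _ _ zero_le]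
          refine min_le_min ?_ (mul_le_mul_left
            (ENNReal.ofReal_le_ofReal (pow_le_pow_right₀ one_le_two hnm)) _)
          rw [hvol, mul_assoc, mul_comm]
          refine mul_le_mul_left ?_ _
          rw [← ENNReal.ofReal_mul he0.le]
          have hs0 := hs.1
          refine ENNReal.ofReal_le_ofReal (mul_le_mul_of_nonneg_left ?_ he0.le)
          exact inv_anti₀ (by positivity) (pow_le_pow_of_le_one hs.1.le hs.2 hnm)
      _ = (∫⁻ s in Ioc (0 : ℝ) 1, min (ENNReal.ofReal (e * (s ^ m)⁻¹)) (ENNReal.ofReal (2 ^ m)))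
            * (volume B * ∫⁻ z, H z) := by
          rw [lintegral_mul_const]
          fun_prop
      _ ≤ _ := by gcongr; exact lintegral_min_rpow_le hm he0
  rw [hlhs]
  calc (volume B)⁻¹ * ((volume B)⁻¹ * ∫⁻ x in E ∩ B, ∫⁻ y in B, ‖f x - f y‖ₑ)
      ≤ (volume B)⁻¹ * ((volume B)⁻¹ * (ENNReal.ofReal (2 * r) *
        (ENNReal.ofReal ((2 ^ m + 1) * e ^ (1 / (m : ℝ))) * (volume B * ∫⁻ z, H z)))) := by
        gcongr
        exact hmain.trans (by gcongr)
    _ = (volume B)⁻¹ * volume B * ((volume B)⁻¹ * volume B) * (ENNReal.ofReal (2 * r) *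
        ENNReal.ofReal ((2 ^ m + 1) * e ^ (1 / (m : ℝ)))) * ∫⁻ z, ‖fderiv ℝ f z‖ₑ ∂P := by
        rw [hHint]; ring
    _ = _ := by
        rw [ENNReal.inv_mul_cancel hvB0 hvBt, one_mul, one_mul,
          ENNReal.ofReal_mul (p := 2 ^ m + 1) (by positivity),
          ← ENNReal.ofReal_rpow_of_pos he0, ← hePE, ENNReal.ofReal_mul (p := 2 * r) (by positivity)]
        ring

theorem Continuous.integrable_ballProb {V : Type*} [NormedAddCommGroup V] {g : Spc n → V}
    (hg : Continuous g) (x₀ : Spc n) {r : ℝ} (hr : 0 < r) : Integrable g (ballProb x₀ r) := by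
  refine Integrable.smul_measure ?_ (ENNReal.inv_ne_top.2 (Metric.measure_ball_pos _ _ hr).ne')
  exact (hg.continuousOn.integrableOn_compact (isCompact_closedBall x₀ r)).mono_set
    Metric.ball_subset_closedBall

/-- Jensen's inequality for powers, on a subset of finite measure. -/
theorem rpow_setIntegral_le {X : Type*} [MeasurableSpace X] {P : Measure X} [IsFiniteMeasure P]
    {g : X → ℝ} (hg0 : ∀ x, 0 ≤ g x) {q : ℝ} (hq : 1 ≤ q) (A : Set X)
    (hg : IntegrableOn g A P) (hgq : IntegrableOn (fun x => g x ^ q) A P) :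
    (∫ x in A, g x ∂P) ^ q ≤ P.real A ^ (q - 1) * ∫ x in A, g x ^ q ∂P := by
  rcases eq_or_ne (P A) 0 with h | h
  · rw [Measure.restrict_eq_zero.2 h]
    simp [Real.zero_rpow (by linarith : q ≠ 0)]
  have hA : 0 < P.real A := ENNReal.toReal_pos h (measure_ne_top _ _)
  have hj := (convexOn_rpow hq).map_set_average_le (μ := P) (t := A) (f := g)
    (Real.continuous_rpow_const (by linarith)).continuousOn isClosed_Ici h
    (measure_ne_top _ _) (Eventually.of_forall hg0) hg hgq
  rw [setAverage_eq, setAverage_eq, smul_eq_mul, smul_eq_mul,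
    Real.mul_rpow (by positivity) (integral_nonneg hg0), Real.inv_rpow hA.le] at hj
  have h1 : P.real A ^ q = P.real A ^ (q - 1) * P.real A := by
    rw [← Real.rpow_add_one hA.ne']; ring_nf
  have h2 : 0 < P.real A ^ q := by positivity
  rw [inv_mul_le_iff₀ h2] at hj
  refine hj.trans_eq ?_
  rw [h1]; field_simp

/-- Jensen's inequality for powers. -/
theorem rpow_integral_le {X : Type*} [MeasurableSpace X] {P : Measure X} [IsProbabilityMeasure P]
    {g : X → ℝ} (hg0 : ∀ x, 0 ≤ g x) {q : ℝ} (hq : 1 ≤ q)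
    (hg : Integrable g P) (hgq : Integrable (fun x => g x ^ q) P) :
    (∫ x, g x ∂P) ^ q ≤ ∫ x, g x ^ q ∂P := by
  have := rpow_setIntegral_le hg0 hq univ hg.integrableOn hgq.integrableOn
  simpa using this

theorem exists_smoothTransition_deriv_bound :
    ∃ C : ℝ, 0 < C ∧ ∀ t, |deriv Real.smoothTransition t| ≤ C ∧
      (t ∉ Ioo (0 : ℝ) 1 → deriv Real.smoothTransition t = 0) := by
  have hz : ∀ t, t ∉ Ioo (0 : ℝ) 1 → deriv Real.smoothTransition t = 0 := by
    intro t ht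
    rw [mem_Ioo, not_and_or, not_lt, not_lt] at ht
    rcases ht with ht | ht
    · refine IsLocalMin.deriv_eq_zero (Eventually.of_forall fun s => ?_)
      rw [Real.smoothTransition.zero_of_nonpos ht]
      exact Real.smoothTransition.nonneg s
    · refine IsLocalMax.deriv_eq_zero (Eventually.of_forall fun s => ?_)
      rw [Real.smoothTransition.one_of_one_le ht]
      exact Real.smoothTransition.le_one s
  have hc : Continuous (deriv Real.smoothTransition) :=
    (Real.smoothTransition.contDiff (n := 1)).continuous_deriv le_rfl
  obtain ⟨C, hC⟩ := isCompact_Icc (a := (0 : ℝ)) (b := 1) |>.exists_bound_of_continuousOn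
    hc.continuousOn
  refine ⟨max C 1, by positivity, fun t => ⟨?_, hz t⟩⟩
  by_cases ht : t ∈ Ioo (0 : ℝ) 1
  · exact (hC t (Ioo_subset_Icc_self ht)).trans (le_max_left _ _)
  · rw [hz t ht, abs_zero]; positivity

theorem exists_truncation_bound (m : ℕ) (hm : 2 ≤ m) :
    ∃ C : ℝ, 0 < C ∧ ∀ {n N : ℕ}, n ≤ m → ∀ {w : Spc n → Vec N}, ContDiff ℝ 1 w →
      ∀ (x₀ : Spc n) {r l : ℝ}, 0 < r → 0 < l → (ballProb x₀ r).real {x | l ≤ ‖w x‖} ≤ 1 / 2 →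
        l * (ballProb x₀ r).real {x | 2 * l ≤ ‖w x‖}
          ≤ C * r * (ballProb x₀ r).real {x | 2 * l ≤ ‖w x‖} ^ (1 / (m : ℝ))
            * ∫ x in {x | l ≤ ‖w x‖} \ {x | 2 * l ≤ ‖w x‖}, ‖fderiv ℝ w x‖ ∂(ballProb x₀ r) := by
  obtain ⟨Cs, hCs0, hCs⟩ := exists_smoothTransition_deriv_bound
  refine ⟨2 * (2 * (2 ^ m + 1)) * (2 * Cs), by positivity, ?_⟩
  intro n N hnm w hw x₀ r l hr hl hhalf
  have := isProbabilityMeasure_ballProb x₀ hr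
  set P := ballProb x₀ r with hP
  set E := {x | l ≤ ‖w x‖} with hE
  set E' := {x | 2 * l ≤ ‖w x‖} with hE'
  have hEm : MeasurableSet E := (isClosed_le continuous_const hw.continuous.norm).measurableSet
  have hE'm : MeasurableSet E' := (isClosed_le continuous_const hw.continuous.norm).measurableSet
  set φ : Spc n → ℝ := fun x => (‖w x‖ ^ 2 - l ^ 2) / (3 * l ^ 2) with hφ
  set h : Spc n → ℝ := fun x => Real.smoothTransition (φ x) with hh
  have hφc : ContDiff ℝ 1 φ := ((hw.norm_sq ℝ).sub contDiff_const).div_const _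
  have hhc : ContDiff ℝ 1 h := Real.smoothTransition.contDiff.comp hφc
  have hone : ∀ x ∈ E', h x = 1 := by
    intro x hx
    refine Real.smoothTransition.one_of_one_le ?_
    rw [hφ, one_le_div (by positivity)]
    have : (2 * l) ^ 2 ≤ ‖w x‖ ^ 2 := by gcongr; exact hx
    linarith
  have hzero : ∀ x ∈ Eᶜ, h x = 0 := by
    intro x hx
    refine Real.smoothTransition.zero_of_nonpos ?_
    refine div_nonpos_of_nonpos_of_nonneg ?_ (by positivity)
    have : ‖w x‖ < l := not_le.1 hx
    have : ‖w x‖ ^ 2 ≤ l ^ 2 := by gcongr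
    linarith
  have hder : ∀ x, ‖fderiv ℝ h x‖ ≤
      (E \ E').indicator (fun x => 2 * Cs / l * ‖fderiv ℝ w x‖) x := by
    intro x
    have h1 : HasFDerivAt (fun x => ‖w x‖ ^ 2) (2 • (innerSL ℝ (w x)).comp (fderiv ℝ w x)) x :=
      (hw.differentiable one_ne_zero x).hasFDerivAt.norm_sq
    have h2 : HasFDerivAt φ ((3 * l ^ 2)⁻¹ • (2 • (innerSL ℝ (w x)).comp (fderiv ℝ w x))) x := by
      have := (h1.sub_const (l ^ 2)).const_mul (3 * l ^ 2)⁻¹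
      simpa only [hφ, div_eq_inv_mul] using this
    have hd : DifferentiableAt ℝ Real.smoothTransition (φ x) :=
      (Real.smoothTransition.contDiff (n := 1)).differentiable one_ne_zero _
    have h3 : HasFDerivAt h (deriv Real.smoothTransition (φ x) •
        ((3 * l ^ 2)⁻¹ • (2 • (innerSL ℝ (w x)).comp (fderiv ℝ w x)))) x :=
      hd.hasDerivAt.comp_hasFDerivAt x h2
    rw [h3.fderiv]
    by_cases hx : x ∈ E \ E'
    · rw [indicator_of_mem hx]
      have hw2 : ‖w x‖ ≤ 2 * l := (not_le.1 hx.2).le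
      have hc : ‖(innerSL ℝ (w x)).comp (fderiv ℝ w x)‖ ≤ 2 * l * ‖fderiv ℝ w x‖ := by
        refine (ContinuousLinearMap.opNorm_comp_le _ _).trans ?_
        rw [innerSL_apply_norm]
        gcongr
      rw [norm_smul, norm_smul, Real.norm_eq_abs, Real.norm_of_nonneg (by positivity)]
      have h2n : ‖(2 : ℕ) • (innerSL ℝ (w x)).comp (fderiv ℝ w x)‖
          ≤ 2 * (2 * l * ‖fderiv ℝ w x‖) := by
        refine (norm_nsmul_le).trans ?_
        push_cast
        gcongr
      calc |deriv Real.smoothTransition (φ x)| * ((3 * l ^ 2)⁻¹ *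
            ‖(2 : ℕ) • (innerSL ℝ (w x)).comp (fderiv ℝ w x)‖)
          ≤ Cs * ((3 * l ^ 2)⁻¹ * (2 * (2 * l * ‖fderiv ℝ w x‖))) := by
            gcongr
            exact (hCs _).1
        _ = (4 / 3) * (Cs / l * ‖fderiv ℝ w x‖) := by field_simp; ring
        _ ≤ 2 * (Cs / l * ‖fderiv ℝ w x‖) := by gcongr; norm_num
        _ = _ := by ring
    · rw [indicator_of_notMem hx, (hCs _).2, zero_smul, norm_zero]
      intro hmem
      apply hx
      refine ⟨?_, ?_⟩
      · by_contra hc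
        have := hzero x hc
        rw [hh] at this
        exact absurd (Real.smoothTransition.zero_iff_nonpos.1 this) (not_le.2 hmem.1)
      · intro hc
        have := hone x hc
        rw [hh] at this
        exact absurd (Real.smoothTransition.eq_one_iff_one_le.1 this) (not_le.2 hmem.2)
  have hosc := lintegral_osc_le hm hnm hhc x₀ hr hE'm
  rw [← hP] at hosc
  have hlow : ENNReal.ofReal (1 / 2) * P E' ≤ ∫⁻ x in E', ∫⁻ y, ‖h x - h y‖ₑ ∂P ∂P := by
    calc ENNReal.ofReal (1 / 2) * P E' = ∫⁻ x in E', ENNReal.ofReal (1 / 2) ∂P := by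
          rw [setLIntegral_const]
      _ ≤ _ := by
        refine setLIntegral_mono' hE'm fun x hx => ?_
        calc ENNReal.ofReal (1 / 2) ≤ P Eᶜ := by
              rw [← ofReal_measureReal, probReal_compl_eq_one_sub hEm]
              gcongr; linarith
          _ = ∫⁻ y in Eᶜ, 1 ∂P := by rw [setLIntegral_one]
          _ ≤ ∫⁻ y in Eᶜ, ‖h x - h y‖ₑ ∂P := by
              refine setLIntegral_mono' hEm.compl fun y hy => ?_
              rw [hone x hx, hzero y hy]; simp
          _ ≤ _ := setLIntegral_le_lintegral _ _
  have hint : Integrable (fun x => ‖fderiv ℝ w x‖) P :=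
    (hw.continuous_fderiv one_ne_zero).norm.integrable_ballProb x₀ hr
  have hup : ∫⁻ z, ‖fderiv ℝ h z‖ₑ ∂P
      ≤ ENNReal.ofReal (2 * Cs / l * ∫ x in E \ E', ‖fderiv ℝ w x‖ ∂P) := by
    rw [← integral_const_mul, ofReal_integral_eq_lintegral_ofReal (hint.integrableOn.const_mul _)
      (Eventually.of_forall fun x => by positivity), ← lintegral_indicator (hEm.diff hE'm)]
    refine lintegral_mono fun x => ?_
    rw [← ofReal_norm]
    refine (ENNReal.ofReal_le_ofReal (hder x)).trans ?_
    by_cases hx : x ∈ E \ E'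
    · rw [indicator_of_mem hx, indicator_of_mem hx]
    · rw [indicator_of_notMem hx, indicator_of_notMem hx]; simp
  have hI0 : 0 ≤ ∫ x in E \ E', ‖fderiv ℝ w x‖ ∂P := integral_nonneg fun x => norm_nonneg _
  have hfin := (hlow.trans hosc).trans (mul_le_mul_right hup _)
  have hreal : 1 / 2 * P.real E' ≤ (2 * r * (2 ^ m + 1)) * P.real E' ^ (1 / (m : ℝ))
      * (2 * Cs / l * ∫ x in E \ E', ‖fderiv ℝ w x‖ ∂P) := by
    rw [← ofReal_measureReal (μ := P) (s := E'),
      ENNReal.ofReal_rpow_of_nonneg measureReal_nonneg (by positivity),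
      ← ENNReal.ofReal_mul (by positivity), ← ENNReal.ofReal_mul (by positivity),
      ← ENNReal.ofReal_mul (by positivity)] at hfin
    exact (ENNReal.ofReal_le_ofReal_iff (by positivity)).1 hfin
  calc l * P.real E' = 2 * l * (1 / 2 * P.real E') := by ring
    _ ≤ 2 * l * ((2 * r * (2 ^ m + 1)) * P.real E' ^ (1 / (m : ℝ))
      * (2 * Cs / l * ∫ x in E \ E', ‖fderiv ℝ w x‖ ∂P)) := by gcongr
    _ = _ := by field_simp

/-- Passing from one dyadic level to the next in the truncation argument. -/
theorem dyadic_level_step {p q β C r l a a' d Y : ℝ} (hq : 1 ≤ q) (hqp : q ≤ p)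
    (hβ : (p - q) / 2 ≤ β * q) (hC : 0 ≤ C) (hr : 0 < r) (hl : 0 < l) (ha' : 0 ≤ a')
    (haa : a' ≤ a) (ha1 : a ≤ 1) (hd : 0 ≤ d) (hY : l ^ 2 * a ≤ Y)
    (h : (l * a') ^ q ≤ (C * r * a' ^ β) ^ q * (a ^ (q - 1) * d)) :
    (2 * l) ^ p * a' ≤ 1 / 2 * (l ^ p * a)
      + 2 ^ p * (2 ^ (p + 1)) ^ q * C ^ q * r ^ q * Y ^ ((p - q) / 2) * d := by
  have hβ0 : 0 ≤ β * q := le_trans (by linarith) hβ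
  have hβ1 : 0 ≤ β := nonneg_of_mul_nonneg_left hβ0 (by linarith)
  have ha : 0 ≤ a := ha'.trans haa
  have hY0 : 0 ≤ Y := le_trans (by positivity) hY
  have h2 : (0 : ℝ) < 2 ^ (p + 1) := by positivity
  rw [Real.mul_rpow (by norm_num) hl.le]
  by_cases hc : 2 ^ (p + 1) * a' ≤ a
  · have h3 : (2 : ℝ) ^ (p + 1) = 2 * 2 ^ p := by
      rw [Real.rpow_add_one (by norm_num)]; ring
    rw [h3] at hc
    have : 0 ≤ 2 ^ p * (2 ^ (p + 1)) ^ q * C ^ q * r ^ q * Y ^ ((p - q) / 2) * d := by positivity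
    have h4 : l ^ p * (2 * 2 ^ p * a') ≤ l ^ p * a := by gcongr
    nlinarith
  · push Not at hc
    have ha0 : 0 < a := by
      rcases ha.eq_or_lt with h0 | h0
      · rw [← h0] at haa hc; have : a' = 0 := le_antisymm haa ha'
        rw [this] at hc; simp at hc
      · exact h0
    have h5 : l ^ q * a ^ q ≤ (2 ^ (p + 1)) ^ q * (l * a') ^ q := by
      rw [← Real.mul_rpow (by positivity) (by positivity),
        ← Real.mul_rpow (by positivity) (by positivity)]
      refine Real.rpow_le_rpow (by positivity) ?_ (by linarith)
      nlinarith
    have h6 : (C * r * a' ^ β) ^ q ≤ C ^ q * r ^ q * a ^ ((p - q) / 2) := by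
      rw [Real.mul_rpow (by positivity) (by positivity), Real.mul_rpow hC hr.le]
      gcongr
      calc (a' ^ β) ^ q ≤ (a ^ β) ^ q := by gcongr
        _ = a ^ (β * q) := by rw [Real.rpow_mul ha]
        _ ≤ _ := Real.rpow_le_rpow_of_exponent_ge ha0 ha1 hβ
    have haq : a ^ q = a ^ (q - 1) * a := by
      rw [← Real.rpow_add_one ha0.ne']; ring_nf
    have h7 : l ^ q * a ≤ (2 ^ (p + 1)) ^ q * (C ^ q * r ^ q * a ^ ((p - q) / 2) * d) := by
      have h8 : 0 < a ^ (q - 1) := by positivity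
      refine le_of_mul_le_mul_left ?_ h8
      calc a ^ (q - 1) * (l ^ q * a) = l ^ q * a ^ q := by rw [haq]; ring
        _ ≤ (2 ^ (p + 1)) ^ q * ((C ^ q * r ^ q * a ^ ((p - q) / 2)) * (a ^ (q - 1) * d)) := by
            refine h5.trans ?_
            gcongr
            refine h.trans ?_
            gcongr
        _ = _ := by ring
    have h9 : l ^ p = l ^ (p - q) * l ^ q := by
      rw [← Real.rpow_add hl]; ring_nf
    have h10 : l ^ (p - q) = (l ^ 2) ^ ((p - q) / 2) := by
      rw [← Real.rpow_natCast, ← Real.rpow_mul hl.le]; congr 1; push_cast; ring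
    have h11 : l ^ p * a ≤ (2 ^ (p + 1)) ^ q * C ^ q * r ^ q * Y ^ ((p - q) / 2) * d := by
      calc l ^ p * a = l ^ (p - q) * (l ^ q * a) := by rw [h9]; ring
        _ ≤ l ^ (p - q) * ((2 ^ (p + 1)) ^ q * (C ^ q * r ^ q * a ^ ((p - q) / 2) * d)) := by
            gcongr
        _ = (2 ^ (p + 1)) ^ q * C ^ q * r ^ q * (l ^ 2 * a) ^ ((p - q) / 2) * d := by
            rw [Real.mul_rpow (by positivity) ha, h10]; ring
        _ ≤ _ := by gcongr
    calc 2 ^ p * l ^ p * a' ≤ 2 ^ p * (l ^ p * a) := by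
          rw [mul_assoc]; gcongr
      _ ≤ 2 ^ p * ((2 ^ (p + 1)) ^ q * C ^ q * r ^ q * Y ^ ((p - q) / 2) * d) := by gcongr
      _ = 2 ^ p * (2 ^ (p + 1)) ^ q * C ^ q * r ^ q * Y ^ ((p - q) / 2) * d := by ring
      _ ≤ _ := by
        have : 0 ≤ 1 / 2 * (l ^ p * a) := by positivity
        linarith

theorem sum_range_le_of_halving {b d : ℕ → ℝ} {D : ℝ}
    (h : ∀ k, b (k + 1) ≤ 1 / 2 * b k + D * d k) (K : ℕ) :
    ∑ k ∈ Finset.range (K + 1), b k + b K ≤ 2 * b 0 + 2 * D * ∑ k ∈ Finset.range K, d k := by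
  induction K with
  | zero => simp; linarith
  | succ K ih =>
    rw [Finset.sum_range_succ, Finset.sum_range_succ d K]
    have := h K
    linarith

theorem rpow_le_dyadic_sum {p s l : ℝ} (hp : 0 ≤ p) (hs : 0 ≤ s) (hl : 0 ≤ l) (K : ℕ)
    (h : s ≤ 2 ^ K * l) :
    s ^ p ≤ l ^ p + ∑ k ∈ Finset.range K, if 2 ^ k * l ≤ s then (2 * (2 ^ k * l)) ^ p else 0 := by
  induction K with
  | zero => simpa using Real.rpow_le_rpow hs (by simpa using h) hp
  | succ K ih =>
    rw [Finset.sum_range_succ]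
    have h0 : 0 ≤ ∑ k ∈ Finset.range K, if 2 ^ k * l ≤ s then (2 * (2 ^ k * l)) ^ p else 0 :=
      Finset.sum_nonneg fun k _ => by split_ifs <;> positivity
    by_cases hc : 2 ^ K * l ≤ s
    · rw [if_pos hc]
      have h1 : s ^ p ≤ (2 * (2 ^ K * l)) ^ p :=
        Real.rpow_le_rpow hs (by rw [pow_succ] at h; linarith) hp
      have : 0 ≤ l ^ p := by positivity
      linarith
    · rw [if_neg hc, add_zero]
      exact ih (not_le.1 hc).le

theorem integral_norm_sub_average_le (m : ℕ) (hm : 2 ≤ m) {n N : ℕ} (hnm : n ≤ m)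
    {f : Spc n → Vec N} (hf : ContDiff ℝ 1 f) (x₀ : Spc n) {r : ℝ} (hr : 0 < r) :
    ∫ x, ‖f x - ∫ y, f y ∂(ballProb x₀ r)‖ ∂(ballProb x₀ r)
      ≤ 2 * (2 ^ m + 1) * r * ∫ x, ‖fderiv ℝ f x‖ ∂(ballProb x₀ r) := by
  have := isProbabilityMeasure_ballProb x₀ hr
  set P := ballProb x₀ r with hP
  have hfi : Integrable f P := hf.continuous.integrable_ballProb x₀ hr
  have hosc := lintegral_osc_le hm hnm hf x₀ hr MeasurableSet.univ
  rw [← hP, measure_univ, ENNReal.one_rpow, mul_one, Measure.restrict_univ] at hosc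
  have h1 : ENNReal.ofReal (∫ x, ‖f x - ∫ y, f y ∂P‖ ∂P)
      ≤ ENNReal.ofReal (2 * (2 ^ m + 1) * r * ∫ x, ‖fderiv ℝ f x‖ ∂P) := by
    have h2 : Integrable (fun x => f x - ∫ y, f y ∂P) P := hfi.sub (integrable_const _)
    rw [ofReal_integral_norm_eq_lintegral_enorm h2, ENNReal.ofReal_mul (by positivity),
      ofReal_integral_norm_eq_lintegral_enorm
        ((hf.continuous_fderiv one_ne_zero).integrable_ballProb x₀ hr)]
    refine (lintegral_mono fun x => ?_).trans (hosc.trans_eq ?_)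
    · have h3 : f x - ∫ y, f y ∂P = ∫ y, (f x - f y) ∂P := by
        rw [integral_sub (integrable_const _) hfi]; simp
      rw [h3]
      exact enorm_integral_le_lintegral_enorm _
    · congr 2; ring
  exact (ENNReal.ofReal_le_ofReal_iff (by positivity)).1 h1

theorem integral_norm_rpow_le_of_dyadic {n N : ℕ} {p q β C r l Y : ℝ} (hq : 1 ≤ q) (hqp : q ≤ p)
    (hβ : (p - q) / 2 ≤ β * q) (hC : 0 ≤ C) (hr : 0 < r) (hl : 0 < l)
    {w : Spc n → Vec N} (hw : ContDiff ℝ 1 w) (x₀ : Spc n)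
    (hN : 4 * ∫ x, ‖w x‖ ∂(ballProb x₀ r) ≤ l) (hY : ∫ x, ‖w x‖ ^ 2 ∂(ballProb x₀ r) ≤ Y)
    (htr : ∀ s, 0 < s → (ballProb x₀ r).real {x | s ≤ ‖w x‖} ≤ 1 / 2 →
        s * (ballProb x₀ r).real {x | 2 * s ≤ ‖w x‖}
          ≤ C * r * (ballProb x₀ r).real {x | 2 * s ≤ ‖w x‖} ^ β
            * ∫ x in {x | s ≤ ‖w x‖} \ {x | 2 * s ≤ ‖w x‖}, ‖fderiv ℝ w x‖ ∂(ballProb x₀ r)) :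
    ∫ x, ‖w x‖ ^ p ∂(ballProb x₀ r) ≤ (1 + 2 * 2 ^ p) * l ^ p
      + 2 * 2 ^ p * (2 ^ p * (2 ^ (p + 1)) ^ q * C ^ q * r ^ q * Y ^ ((p - q) / 2))
        * ∫ x, ‖fderiv ℝ w x‖ ^ q ∂(ballProb x₀ r) := by
  have := isProbabilityMeasure_ballProb x₀ hr
  set P := ballProb x₀ r with hP
  set D := 2 ^ p * (2 ^ (p + 1)) ^ q * C ^ q * r ^ q * Y ^ ((p - q) / 2) with hD
  have hDi : Integrable (fun x => ‖fderiv ℝ w x‖) P :=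
    (hw.continuous_fderiv one_ne_zero).norm.integrable_ballProb x₀ hr
  have hDqi : Integrable (fun x => ‖fderiv ℝ w x‖ ^ q) P :=
    ((hw.continuous_fderiv one_ne_zero).norm.rpow_const
      (fun _ => Or.inr (by linarith))).integrable_ballProb x₀ hr
  have hwi : Integrable (fun x => ‖w x‖) P := hw.continuous.norm.integrable_ballProb x₀ hr
  have hw2i : Integrable (fun x => ‖w x‖ ^ 2) P :=
    (hw.continuous.norm.pow 2).integrable_ballProb x₀ hr
  have hwpi : Integrable (fun x => ‖w x‖ ^ p) P :=
    (hw.continuous.norm.rpow_const (fun _ => Or.inr (by linarith))).integrable_ballProb x₀ hr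
  set E : ℕ → Set (Spc n) := fun k => {x | 2 ^ k * l ≤ ‖w x‖} with hE
  have hEm : ∀ k, MeasurableSet (E k) := fun k =>
    (isClosed_le continuous_const hw.continuous.norm).measurableSet
  have hEE : ∀ k, E (k + 1) ⊆ E k := fun k x hx => by
    have h1 : 2 ^ (k + 1) * l ≤ ‖w x‖ := hx
    have h2 : (0:ℝ) < 2 ^ k * l := by positivity
    rw [pow_succ] at h1
    show 2 ^ k * l ≤ ‖w x‖
    linarith
  have hlk : ∀ k : ℕ, l ≤ 2 ^ k * l := fun k => le_mul_of_one_le_left hl.le (one_le_pow₀ one_le_two)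
  have hE2 : ∀ k, {x | 2 * (2 ^ k * l) ≤ ‖w x‖} = E (k + 1) := fun k => by
    simp only [hE]; ext x; simp only [mem_ofPred_eq, pow_succ]; ring_nf
  set a : ℕ → ℝ := fun k => P.real (E k) with ha
  set g : ℕ → ℝ := fun k => ∫ x in E k, ‖fderiv ℝ w x‖ ^ q ∂P with hg
  have ha4 : ∀ k, a k ≤ 1 / 2 := fun k => by
    have h1 := mul_meas_ge_le_integral_of_nonneg (Eventually.of_forall fun x => norm_nonneg (w x))
      hwi (2 ^ k * l)
    have h2 : l * a k ≤ 2 ^ k * l * a k := by gcongr; exact hlk k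
    have h3 : 4 * (l * a k) ≤ l := by
      have : 2 ^ k * l * a k ≤ ∫ x, ‖w x‖ ∂P := h1
      linarith
    by_contra hc
    push Not at hc
    nlinarith
  have haY : ∀ k, (2 ^ k * l) ^ 2 * a k ≤ Y := fun k => by
    have h1 := mul_meas_ge_le_integral_of_nonneg
      (Eventually.of_forall fun x => sq_nonneg ‖w x‖) hw2i ((2 ^ k * l) ^ 2)
    refine le_trans (le_of_eq ?_) (h1.trans hY)
    congr 1
    refine congrArg P.real (Set.ext fun x => ?_)
    simp only [hE, mem_ofPred_eq]
    rw [sq_le_sq₀ (by positivity) (norm_nonneg _)]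
  have hstep : ∀ k, (2 ^ (k + 1) * l) ^ p * a (k + 1)
      ≤ 1 / 2 * ((2 ^ k * l) ^ p * a k) + D * (g k - g (k + 1)) := fun k => by
    have hd : g k - g (k + 1) = ∫ x in E k \ E (k + 1), ‖fderiv ℝ w x‖ ^ q ∂P := by
      rw [setIntegral_sdiff (hEm _) hDqi.integrableOn (hEE k)]
    have h1 := htr (2 ^ k * l) (by positivity) (ha4 k)
    rw [hE2] at h1
    have h0 : 0 ≤ ∫ x in E k \ E (k + 1), ‖fderiv ℝ w x‖ ∂P := integral_nonneg fun x => norm_nonneg _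
    have h2 := Real.rpow_le_rpow (by positivity) h1 (by linarith : 0 ≤ q)
    rw [Real.mul_rpow (by positivity) h0] at h2
    have h3 : (∫ x in E k \ E (k + 1), ‖fderiv ℝ w x‖ ∂P) ^ q
        ≤ a k ^ (q - 1) * (g k - g (k + 1)) := by
      refine (rpow_setIntegral_le (fun x => norm_nonneg _) hq _ hDi.integrableOn
        hDqi.integrableOn).trans ?_
      rw [hd]
      gcongr
      exact measureReal_mono sdiff_subset
    have h4 := dyadic_level_step (p := p) (q := q) (β := β) (C := C) (r := r) (l := 2 ^ k * l)
      (a := a k) (a' := a (k + 1)) (d := g k - g (k + 1)) (Y := Y) hq hqp hβ hC hr (by positivity)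
      measureReal_nonneg (measureReal_mono (hEE k)) ((ha4 k).trans (by norm_num))
      (hd ▸ integral_nonneg fun x => by positivity) (haY k)
      (h2.trans (by gcongr))
    refine le_trans (le_of_eq ?_) h4
    congr 2
    rw [pow_succ]; ring
  obtain ⟨M, hM⟩ := (isCompact_closedBall x₀ r).exists_bound_of_continuousOn
    hw.continuous.continuousOn
  obtain ⟨K, hK⟩ := pow_unbounded_of_one_lt (M / l) (one_lt_two)
  have hbd : ∀ x ∈ Metric.ball x₀ r, ‖w x‖ ≤ 2 ^ K * l := fun x hx => by
    refine (hM x (Metric.ball_subset_closedBall hx)).trans ?_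
    rw [div_lt_iff₀ hl] at hK
    exact hK.le
  have hPae : ∀ᵐ x ∂P, x ∈ Metric.ball x₀ r :=
    Measure.ae_smul_measure (ae_restrict_mem measurableSet_ball) _
  have hpt : ∀ᵐ x ∂P, ‖w x‖ ^ p ≤ l ^ p
      + ∑ k ∈ Finset.range K, (E k).indicator (fun _ => (2 * (2 ^ k * l)) ^ p) x := by
    filter_upwards [hPae] with x hx
    exact rpow_le_dyadic_sum (by linarith) (norm_nonneg _) hl.le K (hbd x hx)
  have hii : ∀ k, Integrable ((E k).indicator (fun _ => (2 * (2 ^ k * l)) ^ p)) P := fun k =>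
    (integrable_const _).indicator (hEm k)
  have hint : ∫ x, ‖w x‖ ^ p ∂P ≤ l ^ p
      + ∑ k ∈ Finset.range K, 2 ^ p * ((2 ^ k * l) ^ p * a k) := by
    refine (integral_mono_ae hwpi ((integrable_const _).add
      (integrable_finsetSum _ fun k _ => hii k)) hpt).trans (le_of_eq ?_)
    rw [integral_add' (integrable_const _) (integrable_finsetSum _ fun k _ => hii k),
      integral_finsetSum _ fun k _ => hii k]
    congr 1
    · simp
    · refine Finset.sum_congr rfl fun k _ => ?_
      rw [integral_indicator (hEm k), setIntegral_const, smul_eq_mul,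
        Real.mul_rpow (by norm_num) (by positivity)]
      ring
  have hsum := sum_range_le_of_halving (b := fun k => (2 ^ k * l) ^ p * a k)
    (d := fun k => g k - g (k + 1)) hstep K
  rw [Finset.sum_range_sub', Finset.sum_range_succ] at hsum
  have hg0 : g 0 ≤ ∫ x, ‖fderiv ℝ w x‖ ^ q ∂P :=
    setIntegral_le_integral hDqi (Eventually.of_forall fun x => by positivity)
  have hgK : 0 ≤ g K := integral_nonneg fun x => by positivity
  have hb0 : (2 ^ 0 * l) ^ p * a 0 ≤ l ^ p := by
    rw [pow_zero, one_mul]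
    exact mul_le_of_le_one_right (by positivity) ((ha4 0).trans (by norm_num))
  have hbK : 0 ≤ (2 ^ K * l) ^ p * a K := mul_nonneg (by positivity) measureReal_nonneg
  have hY0 : 0 ≤ Y := (integral_nonneg fun x => by positivity).trans hY
  have hD0 : 0 ≤ D := by positivity
  rw [← Finset.mul_sum] at hint
  have h5 : ∑ k ∈ Finset.range K, (2 ^ k * l) ^ p * a k
      ≤ 2 * l ^ p + 2 * D * ∫ x, ‖fderiv ℝ w x‖ ^ q ∂P := by
    have : 2 * D * (g 0 - g K) ≤ 2 * D * ∫ x, ‖fderiv ℝ w x‖ ^ q ∂P := by gcongr; linarith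
    linarith
  calc _ ≤ l ^ p + 2 ^ p * (2 * l ^ p + 2 * D * ∫ x, ‖fderiv ℝ w x‖ ^ q ∂P) := by
        refine hint.trans ?_
        gcongr
    _ = _ := by ring

theorem lintegral_enorm_rpow_eq_ofReal {X V : Type*} [MeasurableSpace X] [NormedAddCommGroup V]
    {P : Measure X} {g : X → V} {p : ℝ} (hp : 0 ≤ p) (hg : Integrable (fun x => ‖g x‖ ^ p) P) :
    ∫⁻ x, ‖g x‖ₑ ^ p ∂P = ENNReal.ofReal (∫ x, ‖g x‖ ^ p ∂P) := by
  rw [ofReal_integral_eq_lintegral_ofReal hg (Eventually.of_forall fun x => by positivity)]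
  refine lintegral_congr fun x => ?_
  rw [← ofReal_norm, ENNReal.ofReal_rpow_of_nonneg (norm_nonneg _) hp]

theorem integral_norm_sub_average_sq_le {X V : Type*} [MeasurableSpace X] [NormedAddCommGroup V]
    [NormedSpace ℝ V] [CompleteSpace V] {P : Measure X} [IsProbabilityMeasure P] {g : X → V}
    (hg : Integrable g P) (a : V) (hg2 : Integrable (fun x => ‖g x - a‖ ^ 2) P)
    (hgs : AEStronglyMeasurable g P) :
    ∫ x, ‖g x - ∫ y, g y ∂P‖ ^ 2 ∂P ≤ 4 * ∫ x, ‖g x - a‖ ^ 2 ∂P := by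
  set A := ∫ y, g y ∂P with hA
  have h1 : ‖A - a‖ ^ 2 ≤ ∫ x, ‖g x - a‖ ^ 2 ∂P := by
    have h2 : A - a = ∫ x, (g x - a) ∂P := by rw [integral_sub hg (integrable_const _)]; simp [hA]
    have h3 : ‖A - a‖ ≤ ∫ x, ‖g x - a‖ ∂P := h2 ▸ norm_integral_le_integral_norm _
    have h4 := rpow_integral_le (P := P) (g := fun x => ‖g x - a‖) (fun x => norm_nonneg _)
      one_le_two (hg.sub (integrable_const _)).norm (by simpa using hg2)
    simp only [Real.rpow_two] at h4
    exact (pow_le_pow_left₀ (norm_nonneg _) h3 2).trans h4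
  have hpt : ∀ x, ‖g x - A‖ ^ 2 ≤ 2 * ‖g x - a‖ ^ 2 + 2 * ‖A - a‖ ^ 2 := fun x => by
    have h5 : ‖g x - A‖ ≤ ‖g x - a‖ + ‖A - a‖ := by
      rw [norm_sub_rev A a, ← sub_add_sub_cancel (g x) a A]
      exact norm_add_le _ _
    have h6 := pow_le_pow_left₀ (norm_nonneg _) h5 2
    nlinarith [sq_nonneg (‖g x - a‖ - ‖A - a‖)]
  have hi : Integrable (fun x => 2 * ‖g x - a‖ ^ 2 + 2 * ‖A - a‖ ^ 2) P :=
    (hg2.const_mul 2).add (integrable_const _)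
  have hi' : Integrable (fun x => ‖g x - A‖ ^ 2) P := by
    refine hi.mono' ((hgs.sub aestronglyMeasurable_const).norm.pow 2) ?_
    exact Eventually.of_forall fun x => by
      rw [Real.norm_of_nonneg (by positivity)]; exact hpt x
  calc ∫ x, ‖g x - A‖ ^ 2 ∂P ≤ ∫ x, (2 * ‖g x - a‖ ^ 2 + 2 * ‖A - a‖ ^ 2) ∂P :=
        integral_mono hi' hi hpt
    _ = 2 * ∫ x, ‖g x - a‖ ^ 2 ∂P + 2 * ‖A - a‖ ^ 2 := by
        rw [integral_add (hg2.const_mul 2) (integrable_const _), integral_const_mul]; simp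
    _ ≤ _ := by linarith

theorem lintegral_lintegral_enorm_sub_rpow_le {X V : Type*} [MeasurableSpace X]
    [NormedAddCommGroup V] {P : Measure X} [IsProbabilityMeasure P] {f : X → V}
    (hf : AEStronglyMeasurable f P) {p : ℝ} (hp : 1 ≤ p) (a : V) :
    ∫⁻ x, ∫⁻ y, ‖f x - f y‖ₑ ^ p ∂P ∂P ≤ 2 ^ p * ∫⁻ x, ‖f x - a‖ₑ ^ p ∂P := by
  have hm : AEMeasurable (fun x => ‖f x - a‖ₑ ^ p) P :=
    ((hf.sub aestronglyMeasurable_const).enorm).pow_const p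
  have h1 : ∀ x y, ‖f x - f y‖ₑ ^ p
      ≤ 2 ^ (p - 1) * ‖f x - a‖ₑ ^ p + 2 ^ (p - 1) * ‖f y - a‖ₑ ^ p := fun x y => by
    rw [← mul_add]
    refine le_trans ?_ (ENNReal.rpow_add_le_mul_rpow_add_rpow _ _ hp)
    gcongr
    rw [← sub_sub_sub_cancel_right (f x) (f y) a]
    exact enorm_sub_le
  calc ∫⁻ x, ∫⁻ y, ‖f x - f y‖ₑ ^ p ∂P ∂P
      ≤ ∫⁻ x, (2 ^ (p - 1) * ‖f x - a‖ₑ ^ p + 2 ^ (p - 1) * ∫⁻ y, ‖f y - a‖ₑ ^ p ∂P) ∂P := by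
        refine lintegral_mono fun x => (lintegral_mono fun y => h1 x y).trans (le_of_eq ?_)
        rw [lintegral_add_left measurable_const, lintegral_const_mul'' _ hm]; simp
    _ = 2 ^ (p - 1) * (∫⁻ x, ‖f x - a‖ₑ ^ p ∂P) * 2 := by
        rw [lintegral_add_right _ measurable_const, lintegral_const_mul'' _ hm]; simp; ring
    _ = _ := by
        rw [mul_right_comm]
        congr 1
        nth_rw 2 [← ENNReal.rpow_one 2]
        rw [← ENNReal.rpow_add _ _ (by simp) (by simp)]
        congr 1; ring

/-- Gagliardo–Nirenberg inequality on balls for continuously differentiable maps. -/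
theorem exists_gagliardo_nirenberg_contDiff (m : ℕ) (hm : 2 ≤ m) {p q : ℝ} (hq : 1 ≤ q)
    (hqp : q ≤ p) (hβ : (p - q) / 2 ≤ 1 / (m : ℝ) * q) :
    ∃ C : ℝ, 0 < C ∧ ∀ {n N : ℕ}, n ≤ m → ∀ {f : Spc n → Vec N}, ContDiff ℝ 1 f →
      ∀ (x₀ : Spc n) {r Y : ℝ} (a : Vec N), 0 < r → ∫ x, ‖f x - a‖ ^ 2 ∂(ballProb x₀ r) ≤ Y →
        ∫⁻ x, ∫⁻ y, ‖f x - f y‖ₑ ^ p ∂(ballProb x₀ r) ∂(ballProb x₀ r)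
          ≤ ENNReal.ofReal (C * r ^ q * Y ^ ((p - q) / 2))
            * ∫⁻ x, ‖fderiv ℝ f x‖ₑ ^ q ∂(ballProb x₀ r) := by
  obtain ⟨C, hC, htr⟩ := exists_truncation_bound m hm
  set c : ℝ := 2 * (2 ^ m + 1) with hc
  have hc0 : 0 < c := by positivity
  set C₁ : ℝ := (1 + 2 * 2 ^ p) * (4 ^ p * c ^ q) with hC₁
  set C₂ : ℝ := 2 * 2 ^ p * (2 ^ p * (2 ^ (p + 1)) ^ q * C ^ q) with hC₂
  refine ⟨2 ^ p * (C₁ + C₂) * 4 ^ ((p - q) / 2), by positivity, ?_⟩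
  intro n N hnm f hf x₀ r Y a hr hY
  have := isProbabilityMeasure_ballProb x₀ hr
  set P := ballProb x₀ r with hP
  set A := ∫ y, f y ∂P with hA
  set w : Spc n → Vec N := fun x => f x - A with hw
  have hwc : ContDiff ℝ 1 w := hf.sub contDiff_const
  have hwD : ∀ x, fderiv ℝ w x = fderiv ℝ f x := fun x => fderiv_sub_const _
  have hY0 : 0 ≤ Y := (integral_nonneg fun x => by positivity).trans hY
  have hw2 : ∫ x, ‖w x‖ ^ 2 ∂P ≤ 4 * Y :=
    (integral_norm_sub_average_sq_le (hf.continuous.integrable_ballProb x₀ hr) a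
      (((hf.continuous.sub continuous_const).norm.pow 2).integrable_ballProb x₀ hr)
      hf.continuous.aestronglyMeasurable).trans (by linarith)
  have hwi : Integrable (fun x => ‖w x‖) P := hwc.continuous.norm.integrable_ballProb x₀ hr
  have hw2i : Integrable (fun x => ‖w x‖ ^ 2) P :=
    (hwc.continuous.norm.pow 2).integrable_ballProb x₀ hr
  have hwpi : Integrable (fun x => ‖w x‖ ^ p) P :=
    (hwc.continuous.norm.rpow_const (fun _ => Or.inr (by linarith))).integrable_ballProb x₀ hr
  have hDi : Integrable (fun x => ‖fderiv ℝ f x‖) P :=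
    (hf.continuous_fderiv one_ne_zero).norm.integrable_ballProb x₀ hr
  have hDqi : Integrable (fun x => ‖fderiv ℝ f x‖ ^ q) P :=
    ((hf.continuous_fderiv one_ne_zero).norm.rpow_const
      (fun _ => Or.inr (by linarith))).integrable_ballProb x₀ hr
  have hI0 : 0 ≤ ∫ x, ‖fderiv ℝ f x‖ ^ q ∂P := integral_nonneg fun x => by positivity
  set N₁ := ∫ x, ‖w x‖ ∂P with hN₁
  have hN0 : 0 ≤ N₁ := integral_nonneg fun x => norm_nonneg _
  have hmain : ∫ x, ‖w x‖ ^ p ∂P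
      ≤ (C₁ + C₂) * r ^ q * (4 * Y) ^ ((p - q) / 2) * ∫ x, ‖fderiv ℝ f x‖ ^ q ∂P := by
    rcases hN0.eq_or_lt with h0 | h0
    · have h1 : (fun x => ‖w x‖) =ᵐ[P] 0 :=
        (integral_eq_zero_iff_of_nonneg (fun x => norm_nonneg _) hwi).1 h0.symm
      have h2 : ∫ x, ‖w x‖ ^ p ∂P = 0 := by
        rw [← integral_zero (Spc n) ℝ (μ := P)]
        refine integral_congr_ae ?_
        filter_upwards [h1] with x hx
        simp only [Pi.zero_apply] at hx
        rw [hx, Real.zero_rpow (by linarith)]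
      rw [h2]; positivity
    · have h1 := integral_norm_rpow_le_of_dyadic hq hqp hβ hC.le hr (l := 4 * N₁) (by positivity)
        hwc x₀ le_rfl hw2 (fun s hs h => htr hnm hwc x₀ hr hs h)
      simp only [hwD] at h1
      rw [← hP] at h1
      have h2 : N₁ ≤ c * r * ∫ x, ‖fderiv ℝ f x‖ ∂P :=
        integral_norm_sub_average_le m hm hnm hf x₀ hr
      have h3 : N₁ ^ q ≤ c ^ q * r ^ q * ∫ x, ‖fderiv ℝ f x‖ ^ q ∂P := by
        refine (Real.rpow_le_rpow hN0 h2 (by linarith)).trans ?_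
        rw [Real.mul_rpow (by positivity) (by positivity), Real.mul_rpow hc0.le hr.le]
        gcongr
        exact rpow_integral_le (fun x => norm_nonneg _) hq hDi hDqi
      have h4 : N₁ ^ 2 ≤ 4 * Y := by
        have := rpow_integral_le (P := P) (g := fun x => ‖w x‖) (fun x => norm_nonneg _)
          one_le_two hwi (by simpa using hw2i)
        simp only [Real.rpow_two] at this
        exact this.trans hw2
      have h5 : N₁ ^ (p - q) ≤ (4 * Y) ^ ((p - q) / 2) := by
        have : N₁ ^ (p - q) = (N₁ ^ 2) ^ ((p - q) / 2) := by
          rw [← Real.rpow_natCast, ← Real.rpow_mul hN0]; congr 1; push_cast; ring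
        rw [this]
        exact Real.rpow_le_rpow (by positivity) h4 (by linarith)
      have h6 : (4 * N₁) ^ p ≤ 4 ^ p * (c ^ q * r ^ q * (∫ x, ‖fderiv ℝ f x‖ ^ q ∂P)
          * (4 * Y) ^ ((p - q) / 2)) := by
        rw [Real.mul_rpow (by norm_num) hN0]
        have : N₁ ^ p = N₁ ^ q * N₁ ^ (p - q) := by rw [← Real.rpow_add h0]; ring_nf
        rw [this]
        gcongr
      refine h1.trans ?_
      calc _ ≤ (1 + 2 * 2 ^ p) * (4 ^ p * (c ^ q * r ^ q * (∫ x, ‖fderiv ℝ f x‖ ^ q ∂P)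
          * (4 * Y) ^ ((p - q) / 2))) + 2 * 2 ^ p * (2 ^ p * (2 ^ (p + 1)) ^ q * C ^ q * r ^ q
            * (4 * Y) ^ ((p - q) / 2)) * ∫ x, ‖fderiv ℝ f x‖ ^ q ∂P := by gcongr
        _ = _ := by rw [hC₁, hC₂]; ring
  refine (lintegral_lintegral_enorm_sub_rpow_le hf.continuous.aestronglyMeasurable
    (hq.trans hqp) A).trans ?_
  rw [lintegral_enorm_rpow_eq_ofReal (by linarith) hwpi,
    lintegral_enorm_rpow_eq_ofReal (by linarith) hDqi, ← ENNReal.ofReal_mul (by positivity)]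
  have h2p : (2 : ℝ≥0∞) ^ p = ENNReal.ofReal (2 ^ p) := by
    rw [← ENNReal.ofReal_rpow_of_pos (by norm_num)]; simp
  rw [h2p, ← ENNReal.ofReal_mul (by positivity)]
  refine ENNReal.ofReal_le_ofReal ?_
  calc _ ≤ 2 ^ p * ((C₁ + C₂) * r ^ q * (4 * Y) ^ ((p - q) / 2)
        * ∫ x, ‖fderiv ℝ f x‖ ^ q ∂P) := by gcongr
    _ = _ := by rw [Real.mul_rpow (by norm_num) hY0]; ring

instance isAddHaarMeasure_volume_spaceTime :
    (volume : Measure (Spc n × ℝ)).IsAddHaarMeasure :=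
  inferInstanceAs (((volume : Measure (Spc n)).prod (volume : Measure ℝ)).IsAddHaarMeasure)

/-- The probability measure whose density is a normalised bump function on space-time. -/
def bumpProb (φ : ContDiffBump (0 : Spc n × ℝ)) : Measure (Spc n × ℝ) :=
  volume.withDensity fun s => ENNReal.ofReal (φ.normed volume s)

theorem isProbabilityMeasure_bumpProb (φ : ContDiffBump (0 : Spc n × ℝ)) :
    IsProbabilityMeasure (bumpProb φ) := by
  refine ⟨?_⟩
  rw [bumpProb, withDensity_apply _ MeasurableSet.univ, Measure.restrict_univ,
    ← ofReal_integral_eq_lintegral_ofReal φ.integrable_normed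
      (Eventually.of_forall φ.nonneg_normed), φ.integral_normed]
  simp

theorem ae_bumpProb_mem_ball (φ : ContDiffBump (0 : Spc n × ℝ)) :
    ∀ᵐ s ∂(bumpProb φ), s ∈ Metric.ball (0 : Spc n × ℝ) φ.rOut := by
  rw [bumpProb, ae_withDensity_iff φ.continuous_normed.measurable.ennreal_ofReal]
  refine Eventually.of_forall fun s hs => ?_
  rw [← φ.support_normed_eq (μ := volume), Function.mem_support]
  intro h
  simp [h] at hs

/-- Mollification by a bump function on space-time. -/
def moll {V : Type*} [NormedAddCommGroup V] [NormedSpace ℝ V] (φ : ContDiffBump (0 : Spc n × ℝ))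
    (g : Spc n × ℝ → V) (z : Spc n × ℝ) : V :=
  ∫ s, g (z - s) ∂(bumpProb φ)

section Mollification

variable {V : Type*} [NormedAddCommGroup V] [NormedSpace ℝ V]

theorem moll_eq_integral (φ : ContDiffBump (0 : Spc n × ℝ)) (g : Spc n × ℝ → V)
    (z : Spc n × ℝ) : moll φ g z = ∫ s, φ.normed volume s • g (z - s) := by
  rw [moll, bumpProb, integral_withDensity_eq_integral_toReal_smul
    φ.continuous_normed.measurable.ennreal_ofReal (by simp)]
  refine integral_congr_ae (Eventually.of_forall fun s => ?_)
  simp only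
  rw [ENNReal.toReal_ofReal (φ.nonneg_normed s)]

theorem moll_eq_convolution (φ : ContDiffBump (0 : Spc n × ℝ)) (g : Spc n × ℝ → V) :
    moll φ g = MeasureTheory.convolution (φ.normed volume) g (ContinuousLinearMap.lsmul ℝ ℝ)
      volume := by
  ext z
  rw [moll_eq_integral, convolution_def]
  rfl

theorem moll_eq_integral_swap (φ : ContDiffBump (0 : Spc n × ℝ)) (g : Spc n × ℝ → V)
    (z : Spc n × ℝ) : moll φ g z = ∫ s, φ.normed volume (z - s) • g s := by
  rw [moll_eq_convolution, convolution_eq_swap]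
  rfl

theorem integrable_bumpProb_comp_sub (φ : ContDiffBump (0 : Spc n × ℝ)) {g : Spc n × ℝ → V}
    (hg : LocallyIntegrable g) (z : Spc n × ℝ) :
    Integrable (fun s => g (z - s)) (bumpProb φ) := by
  rw [bumpProb, integrable_withDensity_iff_integrable_smul'
    φ.continuous_normed.measurable.ennreal_ofReal (by simp)]
  have h := φ.hasCompactSupport_normed (μ := volume).convolutionExists_left
    (ContinuousLinearMap.lsmul ℝ ℝ) φ.continuous_normed hg z
  refine h.congr (Eventually.of_forall fun s => ?_)
  simp only
  rw [ENNReal.toReal_ofReal (φ.nonneg_normed s)]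
  rfl

theorem rpow_lintegral_le_lintegral_rpow {X : Type*} [MeasurableSpace X] {P : Measure X}
    [IsProbabilityMeasure P] {g : X → ℝ≥0∞} (hg : AEMeasurable g P) {q : ℝ} (hq : 1 ≤ q) :
    (∫⁻ x, g x ∂P) ^ q ≤ ∫⁻ x, g x ^ q ∂P := by
  have h := eLpNorm'_le_eLpNorm'_of_exponent_le (μ := P) (f := g) zero_lt_one hq
    hg.aestronglyMeasurable
  simp only [eLpNorm', enorm_eq_self, ENNReal.rpow_one, div_one] at h
  rw [one_div, ENNReal.le_rpow_inv_iff (by linarith)] at h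
  exact h

theorem enorm_moll_sub_rpow_le [CompleteSpace V] (φ : ContDiffBump (0 : Spc n × ℝ))
    {g : Spc n × ℝ → V} (hg : LocallyIntegrable g) (z : Spc n × ℝ) (a : V) {q : ℝ} (hq : 1 ≤ q) :
    ‖moll φ g z - a‖ₑ ^ q ≤ ∫⁻ s, ‖g (z - s) - a‖ₑ ^ q ∂(bumpProb φ) := by
  have := isProbabilityMeasure_bumpProb φ
  have hi := integrable_bumpProb_comp_sub φ hg z
  have h1 : moll φ g z - a = ∫ s, (g (z - s) - a) ∂(bumpProb φ) := by
    rw [integral_sub hi (integrable_const _), moll]; simp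
  rw [h1]
  refine le_trans ?_ (rpow_lintegral_le_lintegral_rpow
    (hi.sub (integrable_const a)).aestronglyMeasurable.enorm hq)
  gcongr
  exact enorm_integral_le_lintegral_enorm _

theorem lintegral_enorm_moll_rpow_le [CompleteSpace V] [MeasurableSpace V]
    [OpensMeasurableSpace V]
    (φ : ContDiffBump (0 : Spc n × ℝ)) {g : Spc n × ℝ → V} (hg : LocallyIntegrable g)
    (hgm : Measurable g) {q : ℝ} (hq : 1 ≤ q) :
    ∫⁻ z, ‖moll φ g z‖ₑ ^ q ≤ ∫⁻ z, ‖g z‖ₑ ^ q := by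
  have := isProbabilityMeasure_bumpProb φ
  calc ∫⁻ z, ‖moll φ g z‖ₑ ^ q ≤ ∫⁻ z, ∫⁻ s, ‖g (z - s)‖ₑ ^ q ∂(bumpProb φ) := by
        refine lintegral_mono fun z => ?_
        simpa using enorm_moll_sub_rpow_le φ hg z 0 hq
    _ = ∫⁻ s, (∫⁻ z, ‖g (z - s)‖ₑ ^ q) ∂(bumpProb φ) := by
        refine lintegral_lintegral_swap ?_
        exact (((hgm.comp (measurable_fst.sub measurable_snd)).enorm).pow_const q).aemeasurable
    _ = ∫⁻ s, (∫⁻ z, ‖g z‖ₑ ^ q) ∂(bumpProb φ) := by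
        refine lintegral_congr fun s => ?_
        exact lintegral_sub_right_eq_self (fun z => ‖g z‖ₑ ^ q) s
    _ = _ := by simp

theorem lintegral_enorm_moll_sub_sq_le [CompleteSpace V] [MeasurableSpace V]
    [BorelSpace V] [SecondCountableTopology V]
    (φ : ContDiffBump (0 : Spc n × ℝ)) {g : Spc n × ℝ → V} (hg : LocallyIntegrable g)
    (hgm : Measurable g) (a : V) {q : ℝ} (hq : 1 ≤ q) {x₀ : Spc n} {r t₁ t₂ t : ℝ}
    (ht : t ∈ Ioo (t₁ + φ.rOut) (t₂ - φ.rOut)) {Y : ℝ≥0∞}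
    (hY : ∀ s ∈ Ioo t₁ t₂, ∫⁻ x in Metric.ball x₀ r, ‖g (x, s) - a‖ₑ ^ q ≤ Y) :
    ∫⁻ x in Metric.ball x₀ (r - φ.rOut), ‖moll φ g (x, t) - a‖ₑ ^ q ≤ Y := by
  have := isProbabilityMeasure_bumpProb φ
  calc _ ≤ ∫⁻ x in Metric.ball x₀ (r - φ.rOut), ∫⁻ s, ‖g ((x, t) - s) - a‖ₑ ^ q ∂(bumpProb φ) :=
        lintegral_mono fun x => enorm_moll_sub_rpow_le φ hg (x, t) a hq
    _ = ∫⁻ s, (∫⁻ x in Metric.ball x₀ (r - φ.rOut), ‖g ((x, t) - s) - a‖ₑ ^ q) ∂(bumpProb φ) := by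
        refine lintegral_lintegral_swap ?_
        refine ((((hgm.comp ?_).sub_const a).enorm).pow_const q).aemeasurable
        fun_prop
    _ ≤ ∫⁻ s, Y ∂(bumpProb φ) := by
        refine lintegral_mono_ae ?_
        filter_upwards [ae_bumpProb_mem_ball φ] with s hs
        rw [mem_ball_zero_iff, Prod.norm_def, max_lt_iff, Real.norm_eq_abs, abs_lt] at hs
        refine le_trans ?_ (hY (t - s.2) ⟨by linarith [ht.1], by linarith [ht.2]⟩)
        rw [← lintegral_indicator measurableSet_ball, ← lintegral_indicator measurableSet_ball,
          ← lintegral_sub_right_eq_self ((Metric.ball x₀ r).indicator _) s.1]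
        refine lintegral_mono fun x => ?_
        by_cases hx : x ∈ Metric.ball x₀ (r - φ.rOut)
        · have hx' : x - s.1 ∈ Metric.ball x₀ r := by
            rw [mem_ball_iff_norm] at hx ⊢
            calc ‖x - s.1 - x₀‖ = ‖(x - x₀) - s.1‖ := by congr 1; abel
              _ ≤ ‖x - x₀‖ + ‖s.1‖ := norm_sub_le _ _
              _ < r := by linarith
          rw [indicator_of_mem hx, indicator_of_mem hx']
          rfl
        · rw [indicator_of_notMem hx]; exact zero_le
    _ = Y := by simp

end Mollification

theorem opNorm_le_of_matrix {T : Spc n →L[ℝ] Vec N} {M : Mat N n}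
    (h : ∀ i j, T (EuclideanSpace.single j 1) i = M (i, j)) : ‖T‖ ≤ ‖M‖ := by
  refine ContinuousLinearMap.opNorm_le_bound _ (norm_nonneg _) fun v => ?_
  have hv : ∀ i, T v i = ∑ j, v j * M (i, j) := fun i => by
    have h1 : v = ∑ j, v j • EuclideanSpace.single j (1 : ℝ) := by
      ext k; simp [Finset.sum_apply, Pi.single_apply]
    conv_lhs => rw [h1]
    simp [map_sum, h]
  refine abs_le_of_sq_le_sq' ?_ (by positivity) |>.2
  rw [mul_pow, EuclideanSpace.real_norm_sq_eq, EuclideanSpace.real_norm_sq_eq M,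
    EuclideanSpace.real_norm_sq_eq v, Fintype.sum_prod_type, Finset.sum_mul]
  refine Finset.sum_le_sum fun i _ => ?_
  rw [hv, mul_comm]
  exact Finset.sum_mul_sq_le_sq_mul_sq _ _ _

theorem moll_apply {ι : Type*} [Fintype ι] (φ : ContDiffBump (0 : Spc n × ℝ))
    {g : Spc n × ℝ → EuclideanSpace ℝ ι} (hg : LocallyIntegrable g) (z : Spc n × ℝ) (i : ι) :
    moll φ g z i = ∫ s, g s i * φ.normed volume (z - s) := by
  rw [moll_eq_integral_swap]
  have hi : Integrable (fun s => φ.normed volume (z - s) • g s) :=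
    (φ.hasCompactSupport_normed (μ := volume).convolutionExists_left
      (ContinuousLinearMap.lsmul ℝ ℝ) φ.continuous_normed hg z).integrable_swap
  have := (EuclideanSpace.proj i : EuclideanSpace ℝ ι →L[ℝ] ℝ).integral_comp_comm hi
  refine this.symm.trans ?_
  refine integral_congr_ae (Eventually.of_forall fun s => ?_)
  simp [mul_comm]

theorem contDiff_moll {V : Type*} [NormedAddCommGroup V] [NormedSpace ℝ V] [CompleteSpace V]
    (φ : ContDiffBump (0 : Spc n × ℝ)) {g : Spc n × ℝ → V} (hg : LocallyIntegrable g) :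
    ContDiff ℝ 1 (moll φ g) := by
  rw [moll_eq_convolution]
  exact φ.hasCompactSupport_normed.contDiff_convolution_left _ φ.contDiff_normed hg

/-- The weak spatial gradient of `g` is `G`. -/
def HasWeakSpatialGrad (Q : Set (Spc n × ℝ)) (g : Spc n × ℝ → Vec N)
    (G : Spc n × ℝ → Mat N n) : Prop :=
  ∀ ψ : Spc n × ℝ → ℝ, ContDiff ℝ (⊤ : ℕ∞) ψ → HasCompactSupport ψ → tsupport ψ ⊆ Q →
    ∀ (i : Fin N) (j : Fin n), ∫ z, g z i * pderivS j ψ z = - ∫ z, G z (i, j) * ψ z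

theorem norm_fderiv_moll_le (φ : ContDiffBump (0 : Spc n × ℝ)) {Q : Set (Spc n × ℝ)}
    {g : Spc n × ℝ → Vec N} {G : Spc n × ℝ → Mat N n} (hg : LocallyIntegrable g)
    (hG : LocallyIntegrable G) (h : HasWeakSpatialGrad Q g G) (z : Spc n × ℝ)
    (hz : Metric.closedBall z φ.rOut ⊆ Q) :
    ‖fderiv ℝ (fun x => moll φ g (x, z.2)) z.1‖ ≤ ‖moll φ G z‖ := by
  set η : Spc n × ℝ → ℝ := φ.normed volume with hη
  have hηc : HasCompactSupport η := φ.hasCompactSupport_normed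
  have hηd : ContDiff ℝ (⊤ : ℕ∞) η := φ.contDiff_normed
  have hη1 : ContDiff ℝ 1 η := φ.contDiff_normed
  have hder := hηc.hasFDerivAt_convolution_left (ContinuousLinearMap.lsmul ℝ ℝ) hη1 hg z
  set T := (MeasureTheory.convolution (fderiv ℝ η) g
    ((ContinuousLinearMap.lsmul ℝ ℝ : ℝ →L[ℝ] Vec N →L[ℝ] Vec N).precompL (Spc n × ℝ)) volume) z
    with hT
  rw [← moll_eq_convolution] at hder
  have hint : Integrable (fun s => (((ContinuousLinearMap.lsmul ℝ ℝ :
      ℝ →L[ℝ] Vec N →L[ℝ] Vec N).precompL (Spc n × ℝ)) (fderiv ℝ η (z - s))) (g s)) :=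
    ((hηc.fderiv ℝ).convolutionExists_left _ (hη1.continuous_fderiv one_ne_zero) hg z).integrable_swap
  have hTv : ∀ v i, T v i = ∫ s, g s i * fderiv ℝ η (z - s) v := fun v i => by
    rw [hT, convolution_eq_swap, ContinuousLinearMap.integral_apply hint]
    have h2 := (EuclideanSpace.proj i : Vec N →L[ℝ] ℝ).integral_comp_comm
      (hint.apply_continuousLinearMap v)
    refine h2.symm.trans ?_
    refine integral_congr_ae (Eventually.of_forall fun s => ?_)
    simp [ContinuousLinearMap.precompL_apply, mul_comm]
  have hfd : HasFDerivAt (fun x => moll φ g (x, z.2)) (T.comp (ContinuousLinearMap.inl ℝ _ _)) z.1 :=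
    HasFDerivAt.comp z.1 (f := fun x => (x, z.2)) hder (hasFDerivAt_prodMk_left z.1 z.2)
  rw [hfd.fderiv]
  refine opNorm_le_of_matrix fun i j => ?_
  rw [moll_apply φ hG, ContinuousLinearMap.comp_apply, hTv]
  have hsub : tsupport (fun s => η (z - s)) ⊆ Q := by
    refine (closure_minimal ?_ Metric.isClosed_closedBall).trans hz
    intro s hs
    have : z - s ∈ Function.support η := hs
    rw [hη, φ.support_normed_eq, mem_ball_zero_iff] at this
    rw [mem_closedBall_iff_norm, norm_sub_rev]
    exact this.le
  have hw := h (fun s => η (z - s)) (hηd.comp (contDiff_const.sub contDiff_id))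
    (hηc.comp_homeomorph (Homeomorph.subLeft z)) hsub i j
  rw [← neg_eq_iff_eq_neg.2 hw, ← integral_neg]
  refine integral_congr_ae (Eventually.of_forall fun s => ?_)
  have hps : pderivS j (fun s => η (z - s)) s
      = -(fderiv ℝ η (z - s) (EuclideanSpace.single j 1, 0)) := by
    have h3 : HasFDerivAt (fun y : Spc n => z - (y, s.2)) (-(ContinuousLinearMap.inl ℝ _ _)) s.1 :=
      (hasFDerivAt_prodMk_left s.1 s.2).const_sub z
    have h4 : HasFDerivAt η (fderiv ℝ η (z - s)) (z - (s.1, s.2)) :=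
      (hη1.differentiable one_ne_zero _).hasFDerivAt
    have h5 := HasFDerivAt.comp s.1 h4 h3
    have h6 := h5.fderiv
    simp only [Function.comp_def] at h6
    rw [pderivS, h6]
    simp
  simp only [hps]
  simp

theorem lintegral_ballProb (x₀ : Spc n) (r : ℝ) (h : Spc n → ℝ≥0∞) :
    ∫⁻ x, h x ∂(ballProb x₀ r)
      = (volume (Metric.ball x₀ r))⁻¹ * ∫⁻ x in Metric.ball x₀ r, h x := by
  rw [ballProb, lintegral_smul_measure, smul_eq_mul]

theorem volume_ball_le_two_pow_mul (x₀ : Spc n) {r r' : ℝ} (hr : 0 < r) (h : r ≤ 2 * r') :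
    volume (Metric.ball x₀ r) ≤ 2 ^ n * volume (Metric.ball x₀ r') := by
  rw [Measure.addHaar_ball_of_pos volume x₀ hr,
    Measure.addHaar_ball_of_pos volume x₀ (by linarith : 0 < r'),
    ← mul_assoc]
  gcongr
  have : (2 : ℝ≥0∞) ^ n = ENNReal.ofReal (2 ^ n) := by
    rw [ENNReal.ofReal_pow (by norm_num)]; simp
  rw [this, ← ENNReal.ofReal_mul (by positivity), finrank_euclideanSpace_fin, ← mul_pow]
  gcongr

theorem exists_slice_moll_bound (m : ℕ) (hm : 2 ≤ m) {p q : ℝ} (hq : 1 ≤ q)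
    (hqp : q ≤ p) (hβ : (p - q) / 2 ≤ 1 / (m : ℝ) * q) :
    ∃ C : ℝ, 0 < C ∧ ∀ {n N : ℕ}, n ≤ m → ∀ {g : Spc n × ℝ → Vec N} {G : Spc n × ℝ → Mat N n}
      (x₀ : Spc n) {r t₁ t₂ Y : ℝ} (a : Vec N) (φ : ContDiffBump (0 : Spc n × ℝ)),
      0 < r → φ.rOut ≤ r / 2 → 0 ≤ Y → Measurable g → Measurable G →
      LocallyIntegrable g → LocallyIntegrable G →
      HasWeakSpatialGrad (Metric.ball x₀ r ×ˢ Ioo t₁ t₂) g G →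
      (∀ s ∈ Ioo t₁ t₂, ∫⁻ x in Metric.ball x₀ r, ‖g (x, s) - a‖ₑ ^ (2 : ℝ)
        ≤ volume (Metric.ball x₀ r) * ENNReal.ofReal Y) →
      ∫⁻ t in Ioo (t₁ + φ.rOut) (t₂ - φ.rOut), ∫⁻ x in Metric.ball x₀ (r - φ.rOut),
          ∫⁻ y in Metric.ball x₀ (r - φ.rOut), ‖moll φ g (x, t) - moll φ g (y, t)‖ₑ ^ p
        ≤ ENNReal.ofReal (C * r ^ q * Y ^ ((p - q) / 2)) * volume (Metric.ball x₀ r)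
          * ∫⁻ z, ‖G z‖ₑ ^ q := by
  obtain ⟨C, hC, hGN⟩ := exists_gagliardo_nirenberg_contDiff m hm hq hqp hβ
  refine ⟨C * (2 ^ m) ^ ((p - q) / 2), by positivity, ?_⟩
  intro n N hnm g G x₀ r t₁ t₂ Y a φ hr hφ hY hgm hGm hg hG hw hYb
  set δ := φ.rOut with hδ
  have hδ0 : 0 < δ := φ.rOut_pos
  have hr' : 0 < r - δ := by linarith
  set B := Metric.ball x₀ r with hB
  set B' := Metric.ball x₀ (r - δ) with hB'
  have hB'0 : volume B' ≠ 0 := (Metric.measure_ball_pos _ _ hr').ne'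
  have hB't : volume B' ≠ ∞ := measure_ball_lt_top.ne
  have hBB : volume B ≤ 2 ^ m * volume B' :=
    (volume_ball_le_two_pow_mul x₀ hr (by linarith : r ≤ 2 * (r - δ))).trans
      (by gcongr; exact one_le_two)
  have hB'B : volume B' ≤ volume B := measure_mono (Metric.ball_subset_ball (by linarith))
  set c : ℝ≥0∞ := ENNReal.ofReal (C * (2 ^ m) ^ ((p - q) / 2) * r ^ q * Y ^ ((p - q) / 2)) with hc
  have hslice : ∀ t ∈ Ioo (t₁ + δ) (t₂ - δ), ∫⁻ x in B', ∫⁻ y in B',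
      ‖moll φ g (x, t) - moll φ g (y, t)‖ₑ ^ p
        ≤ c * volume B * ∫⁻ x in B', ‖moll φ G (x, t)‖ₑ ^ q := by
    intro t ht
    have hf : ContDiff ℝ 1 fun x => moll φ g (x, t) :=
      (contDiff_moll φ hg).comp (contDiff_id.prodMk contDiff_const)
    have hprob := isProbabilityMeasure_ballProb x₀ hr'
    have hY2 : ∫ x, ‖moll φ g (x, t) - a‖ ^ 2 ∂(ballProb x₀ (r - δ)) ≤ 2 ^ m * Y := by
      have h1 := lintegral_enorm_moll_sub_sq_le φ hg hgm a one_le_two ht hYb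
      have h2 : Integrable (fun x => ‖moll φ g (x, t) - a‖ ^ (2 : ℝ)) (ballProb x₀ (r - δ)) :=
        ((hf.continuous.sub continuous_const).norm.rpow_const
          (fun _ => Or.inr (by norm_num))).integrable_ballProb x₀ hr'
      have h3 := lintegral_enorm_rpow_eq_ofReal (by norm_num) h2
      simp only [Real.rpow_two] at h3
      rw [← ENNReal.ofReal_le_ofReal_iff (by positivity), ← h3, lintegral_ballProb,
        ← ENNReal.div_eq_inv_mul]
      refine ENNReal.div_le_of_le_mul (h1.trans ?_)
      rw [ENNReal.ofReal_mul (by positivity), ENNReal.ofReal_pow (by norm_num)]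
      calc volume B * ENNReal.ofReal Y ≤ 2 ^ m * volume B' * ENNReal.ofReal Y := by gcongr
        _ = _ := by rw [ENNReal.ofReal_ofNat]; ring
    have h4 := hGN hnm hf x₀ a hr' hY2
    have hD : ∫⁻ x in B', ‖fderiv ℝ (fun x => moll φ g (x, t)) x‖ₑ ^ q
        ≤ ∫⁻ x in B', ‖moll φ G (x, t)‖ₑ ^ q := by
      refine setLIntegral_mono' measurableSet_ball fun x hx => ?_
      gcongr
      rw [enorm_le_iff_norm_le]
      refine norm_fderiv_moll_le φ hg hG hw (x, t) ?_
      intro w hw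
      rw [mem_closedBall_iff_norm, Prod.norm_def, max_le_iff, Real.norm_eq_abs, abs_le] at hw
      simp only [Prod.fst_sub, Prod.snd_sub] at hw
      refine ⟨?_, ?_, ?_⟩
      · rw [hB', mem_ball_iff_norm] at hx
        rw [mem_ball_iff_norm]
        calc ‖w.1 - x₀‖ = ‖(w.1 - x) + (x - x₀)‖ := by congr 1; abel
          _ ≤ ‖w.1 - x‖ + ‖x - x₀‖ := norm_add_le _ _
          _ < r := by linarith [hw.1]
      · linarith [hw.2.1, ht.1]
      · linarith [hw.2.2, ht.2]
    simp only [lintegral_ballProb] at h4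
    rw [lintegral_const_mul' _ _ (ENNReal.inv_ne_top.2 hB'0)] at h4
    have hcc : ENNReal.ofReal (C * (r - δ) ^ q * (2 ^ m * Y) ^ ((p - q) / 2)) ≤ c := by
      rw [Real.mul_rpow (by positivity) hY]
      refine ENNReal.ofReal_le_ofReal ?_
      calc _ ≤ C * r ^ q * ((2 ^ m) ^ ((p - q) / 2) * Y ^ ((p - q) / 2)) := by
            gcongr; linarith
        _ = _ := by ring
    calc _ = volume B' * volume B' * ((volume B')⁻¹ * ((volume B')⁻¹ * ∫⁻ x in B', ∫⁻ y in B',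
          ‖moll φ g (x, t) - moll φ g (y, t)‖ₑ ^ p)) := by
          rw [mul_assoc, ← mul_assoc (volume B') (volume B')⁻¹, ENNReal.mul_inv_cancel hB'0 hB't,
            one_mul, ← mul_assoc, ENNReal.mul_inv_cancel hB'0 hB't, one_mul]
      _ ≤ volume B' * volume B' * (c * ((volume B')⁻¹
            * ∫⁻ x in B', ‖moll φ G (x, t)‖ₑ ^ q)) := by
          refine mul_le_mul' le_rfl (h4.trans (mul_le_mul' hcc ?_))
          gcongr
      _ = c * volume B' * ∫⁻ x in B', ‖moll φ G (x, t)‖ₑ ^ q := by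
          rw [show volume B' * volume B' * (c * ((volume B')⁻¹
            * ∫⁻ x in B', ‖moll φ G (x, t)‖ₑ ^ q)) = (volume B' * (volume B')⁻¹) * (c * volume B'
            * ∫⁻ x in B', ‖moll φ G (x, t)‖ₑ ^ q) by ring, ENNReal.mul_inv_cancel hB'0 hB't, one_mul]
      _ ≤ _ := by gcongr
  have hmG : Measurable fun z => ‖moll φ G z‖ₑ ^ q :=
    ((contDiff_moll φ hG).continuous.measurable.enorm).pow_const q
  calc _ ≤ ∫⁻ t in Ioo (t₁ + δ) (t₂ - δ), c * volume B * ∫⁻ x in B', ‖moll φ G (x, t)‖ₑ ^ q :=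
        setLIntegral_mono' measurableSet_Ioo hslice
    _ ≤ ∫⁻ t, c * volume B * ∫⁻ x, ‖moll φ G (x, t)‖ₑ ^ q := by
        refine (setLIntegral_le_lintegral _ _).trans (lintegral_mono fun t => ?_)
        exact mul_le_mul' le_rfl (setLIntegral_le_lintegral _ _)
    _ = c * volume B * ∫⁻ z, ‖moll φ G z‖ₑ ^ q := by
        rw [lintegral_const_mul _ hmG.lintegral_prod_left', Measure.volume_eq_prod,
          lintegral_prod_symm _ hmG.aemeasurable]
    _ ≤ _ := mul_le_mul' le_rfl (lintegral_enorm_moll_rpow_le φ hG hGm hq)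

theorem setLIntegral_prod_prod (I : Set ℝ) (B : Set (Spc n)) {H : ℝ × Spc n × Spc n → ℝ≥0∞}
    (hH : Measurable H) :
    ∫⁻ w in I ×ˢ B ×ˢ B, H w = ∫⁻ t in I, ∫⁻ x in B, ∫⁻ y in B, H (t, x, y) := by
  rw [Measure.volume_eq_prod, ← Measure.prod_restrict, lintegral_prod _ hH.aemeasurable]
  refine lintegral_congr fun t => ?_
  rw [Measure.volume_eq_prod, ← Measure.prod_restrict]
  exact lintegral_prod _ (hH.comp measurable_prodMk_left).aemeasurable

theorem ae_triple_of_ae {Z : Spc n × ℝ → Prop} (h : ∀ᵐ z, Z z) :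
    ∀ᵐ w : ℝ × Spc n × Spc n, Z (w.2.1, w.1) ∧ Z (w.2.2, w.1) := by
  have h0 : ∀ᵐ z ∂((volume : Measure ℝ).prod (volume : Measure (Spc n))), Z z.swap :=
    Measure.measurePreserving_swap.quasiMeasurePreserving.ae h
  have h1 : ∀ᵐ w ∂((volume : Measure ℝ).prod ((volume : Measure (Spc n)).prod volume)),
      Z (w.2.1, w.1) :=
    (Measure.quasiMeasurePreserving_fst.comp
      (measurePreserving_prodAssoc (volume : Measure ℝ) (volume : Measure (Spc n))
        (volume : Measure (Spc n))).symm.quasiMeasurePreserving).ae h0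
  have h2 : ∀ᵐ w ∂((volume : Measure ℝ).prod ((volume : Measure (Spc n)).prod volume)),
      Z (w.2.2, w.1) :=
    ((MeasurePreserving.id (volume : Measure ℝ)).prod
      (Measure.measurePreserving_swap (μ := (volume : Measure (Spc n)))
        (ν := (volume : Measure (Spc n))))).quasiMeasurePreserving.ae h1
  exact h1.and h2

theorem exists_slice_sobolev (m : ℕ) (hm : 2 ≤ m) {p q : ℝ} (hq : 1 ≤ q)
    (hqp : q ≤ p) (hβ : (p - q) / 2 ≤ 1 / (m : ℝ) * q) :
    ∃ C : ℝ, 0 < C ∧ ∀ {n N : ℕ}, n ≤ m → ∀ {g : Spc n × ℝ → Vec N} {G : Spc n × ℝ → Mat N n}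
      (x₀ : Spc n) {r t₁ t₂ Y : ℝ} (a : Vec N),
      0 < r → 0 ≤ Y → Measurable g → Measurable G →
      LocallyIntegrable g → LocallyIntegrable G →
      HasWeakSpatialGrad (Metric.ball x₀ r ×ˢ Ioo t₁ t₂) g G →
      (∀ s ∈ Ioo t₁ t₂, ∫⁻ x in Metric.ball x₀ r, ‖g (x, s) - a‖ₑ ^ (2 : ℝ)
        ≤ volume (Metric.ball x₀ r) * ENNReal.ofReal Y) →
      ∫⁻ t in Ioo t₁ t₂, ∫⁻ x in Metric.ball x₀ r, ∫⁻ y in Metric.ball x₀ r,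
          ‖g (x, t) - g (y, t)‖ₑ ^ p
        ≤ ENNReal.ofReal (C * r ^ q * Y ^ ((p - q) / 2)) * volume (Metric.ball x₀ r)
          * ∫⁻ z, ‖G z‖ₑ ^ q := by
  obtain ⟨C, hC, hb⟩ := exists_slice_moll_bound m hm hq hqp hβ
  refine ⟨C, hC, ?_⟩
  intro n N hnm g G x₀ r t₁ t₂ Y a hr hY hgm hGm hg hG hw hYb
  set R := ENNReal.ofReal (C * r ^ q * Y ^ ((p - q) / 2)) * volume (Metric.ball x₀ r)
          * ∫⁻ z, ‖G z‖ₑ ^ q with hR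
  have hδ0 : ∀ k : ℕ, 0 < r / 2 / ((k : ℝ) + 1) := fun k => by positivity
  set φ : ℕ → ContDiffBump (0 : Spc n × ℝ) := fun k =>
    ⟨r / 2 / ((k : ℝ) + 1) / 2, r / 2 / ((k : ℝ) + 1), half_pos (hδ0 k), half_lt_self (hδ0 k)⟩
    with hφ
  have hδ : Tendsto (fun k => (φ k).rOut) atTop (𝓝 0) := (tendsto_const_div_atTop_nhds_zero_nat (r / 2))
    |>.comp (tendsto_add_atTop_nat 1) |>.congr fun k => by simp [hφ]
  have hae : ∀ᵐ z, Tendsto (fun k => moll (φ k) g z) atTop (𝓝 (g z)) := by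
    have := ContDiffBump.ae_convolution_tendsto_right_of_locallyIntegrable (μ := volume) (g := g)
      (φ := φ) (K := 2) hδ (Eventually.of_forall fun k => by simp [hφ]; linarith) hg
    simpa only [← moll_eq_convolution] using this
  set S : Set (ℝ × Spc n × Spc n) := Ioo t₁ t₂ ×ˢ Metric.ball x₀ r ×ˢ Metric.ball x₀ r with hS
  set Sk : ℕ → Set (ℝ × Spc n × Spc n) := fun k => Ioo (t₁ + (φ k).rOut) (t₂ - (φ k).rOut)
    ×ˢ Metric.ball x₀ (r - (φ k).rOut) ×ˢ Metric.ball x₀ (r - (φ k).rOut) with hSk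
  have hSm : MeasurableSet S :=
    measurableSet_Ioo.prod (measurableSet_ball.prod measurableSet_ball)
  have hSkm : ∀ k, MeasurableSet (Sk k) := fun k =>
    measurableSet_Ioo.prod (measurableSet_ball.prod measurableSet_ball)
  have hosc : ∀ v : Spc n × ℝ → Vec N, Measurable v → Measurable
      fun w : ℝ × Spc n × Spc n => ‖v (w.2.1, w.1) - v (w.2.2, w.1)‖ₑ ^ p := fun v hv => by
    refine (Measurable.enorm (Measurable.sub (hv.comp ?_) (hv.comp ?_))).pow_const p <;> fun_prop
  have hmk : ∀ k, Measurable (moll (φ k) g) := fun k =>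
    (contDiff_moll (φ k) hg).continuous.measurable
  have hbk : ∀ k, ∫⁻ w, (Sk k).indicator
      (fun w => ‖moll (φ k) g (w.2.1, w.1) - moll (φ k) g (w.2.2, w.1)‖ₑ ^ p) w ≤ R := fun k => by
    rw [lintegral_indicator (hSkm k), setLIntegral_prod_prod _ _ (hosc _ (hmk k))]
    refine hb hnm x₀ a (φ k) hr ?_ hY hgm hGm hg hG hw hYb
    exact div_le_self (by positivity) (by linarith [k.cast_nonneg (α := ℝ)])
  rw [← setLIntegral_prod_prod (H := fun w => ‖g (w.2.1, w.1) - g (w.2.2, w.1)‖ₑ ^ p) _ _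
    (hosc g hgm), ← lintegral_indicator hSm]
  calc _ ≤ ∫⁻ w, liminf (fun k => (Sk k).indicator
      (fun w => ‖moll (φ k) g (w.2.1, w.1) - moll (φ k) g (w.2.2, w.1)‖ₑ ^ p) w) atTop := by
        refine lintegral_mono_ae ?_
        filter_upwards [ae_triple_of_ae hae] with w hw
        by_cases hwS : w ∈ S
        · rw [indicator_of_mem hwS]
          refine le_of_eq (Tendsto.liminf_eq ?_).symm
          have hlim : Tendsto (fun k => ‖moll (φ k) g (w.2.1, w.1)
              - moll (φ k) g (w.2.2, w.1)‖ₑ ^ p) atTop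
              (𝓝 (‖g (w.2.1, w.1) - g (w.2.2, w.1)‖ₑ ^ p)) :=
            (ENNReal.continuous_rpow_const.tendsto _).comp ((hw.1.sub hw.2).enorm)
          refine hlim.congr' ?_
          obtain ⟨⟨h1, h2⟩, h3, h4⟩ := hwS
          rw [Metric.mem_ball] at h3 h4
          filter_upwards [hδ.eventually_lt_const (sub_pos.2 h1),
            hδ.eventually_lt_const (sub_pos.2 h2), hδ.eventually_lt_const (sub_pos.2 h3),
            hδ.eventually_lt_const (sub_pos.2 h4)] with k k1 k2 k3 k4
          rw [indicator_of_mem]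
          refine ⟨⟨by linarith, by linarith⟩, ?_, ?_⟩ <;> rw [Metric.mem_ball] <;> linarith
        · rw [indicator_of_notMem hwS]; exact zero_le
    _ ≤ liminf (fun k => ∫⁻ w, (Sk k).indicator
      (fun w => ‖moll (φ k) g (w.2.1, w.1) - moll (φ k) g (w.2.2, w.1)‖ₑ ^ p) w) atTop :=
        lintegral_liminf_le fun k => (hosc _ (hmk k)).indicator (hSkm k)
    _ ≤ liminf (fun _ : ℕ => R) atTop := liminf_le_liminf (Eventually.of_forall hbk)
    _ = R := by simp

theorem setIntegral_eq_integral_indicator_mul {Q O : Set (Spc n × ℝ)} (hQ : Q ⊆ O)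
    (hO : MeasurableSet O) {g h : Spc n × ℝ → ℝ} (hh : ∀ z, z ∉ Q → h z = 0) :
    ∫ z in O, g z * h z = ∫ z, Q.indicator g z * h z := by
  rw [← integral_indicator hO]
  congr 1
  ext z
  by_cases hz : z ∈ Q
  · rw [indicator_of_mem (hQ hz), indicator_of_mem hz]
  · by_cases hzO : z ∈ O
    · rw [indicator_of_mem hzO, hh z hz, mul_zero, mul_zero]
    · rw [indicator_of_notMem hzO, hh z hz, mul_zero]

theorem pderivS_eq_zero_of_notMem_tsupport {ψ : Spc n × ℝ → ℝ} {z : Spc n × ℝ}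
    (hz : z ∉ tsupport ψ) (j : Fin n) : pderivS j ψ z = 0 := by
  have h : (fun y => ψ (y, z.2)) =ᶠ[𝓝 z.1] fun _ => (0 : ℝ) := by
    have h1 : ψ =ᶠ[𝓝 z] 0 := notMem_tsupport_iff_eventuallyEq.1 hz
    have hc : Tendsto (fun y : Spc n => (y, z.2)) (𝓝 z.1) (𝓝 z) :=
      (Continuous.prodMk continuous_id continuous_const).tendsto' _ _ rfl
    exact hc.eventually h1
  rw [pderivS, h.fderiv_eq]
  simp

theorem WeakSolution.hasWeakSpatialGrad {p ν L T : ℝ} {Ω : Set (Spc n)}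
    {A : Spc n × ℝ → Vec N → Mat N n → Mat N n} {F : Spc n × ℝ → Mat N n}
    {u : Spc n × ℝ → Vec N} {Du : Spc n × ℝ → Mat N n} (hu : WeakSolution p ν L T Ω A F u Du)
    {Q : Set (Spc n × ℝ)} (hQ : Q ⊆ Ω ×ˢ Ioo 0 T) :
    HasWeakSpatialGrad Q (Q.indicator u) (Q.indicator Du) := by
  intro ψ hψ hψc hψs i j
  have hO : MeasurableSet (Ω ×ˢ Ioo (0 : ℝ) T) := hu.openΩ.measurableSet.prod measurableSet_Ioo
  have h := hu.weakGrad ψ hψ hψc (hψs.trans hQ) i j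
  rw [setIntegral_eq_integral_indicator_mul hQ hO (g := fun z => u z i) (h := pderivS j ψ)
      fun z hz => pderivS_eq_zero_of_notMem_tsupport (fun hz' => hz (hψs hz')) j,
    setIntegral_eq_integral_indicator_mul hQ hO (g := fun z => Du z (i, j)) (h := ψ)
      fun z hz => image_eq_zero_of_notMem_tsupport fun hz' => hz (hψs hz')] at h
  have hi : ∀ z, Q.indicator u z i = Q.indicator (fun z => u z i) z := fun z => by
    by_cases hz : z ∈ Q <;> simp [hz]
  have hj : ∀ z, Q.indicator Du z (i, j) = Q.indicator (fun z => Du z (i, j)) z := fun z => by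
    by_cases hz : z ∈ Q <;> simp [hz]
  simpa only [hi, hj] using h

theorem volume_spaceTime_ne_top {p ν L T : ℝ} {Ω : Set (Spc n)}
    {A : Spc n × ℝ → Vec N → Mat N n → Mat N n} {F : Spc n × ℝ → Mat N n}
    {u : Spc n × ℝ → Vec N} {Du : Spc n × ℝ → Mat N n} (hu : WeakSolution p ν L T Ω A F u Du) :
    volume (Ω ×ˢ Ioo (0 : ℝ) T) ≠ ∞ := by
  rw [Measure.volume_eq_prod, Measure.prod_prod]
  exact ENNReal.mul_ne_top hu.bddΩ.measure_lt_top.ne (by simp)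

theorem WeakSolution.exists_lintegral_osc_le (m : ℕ) (hm : 2 ≤ m) {p q : ℝ} (hq : 1 ≤ q)
    (hqp : q ≤ p) (hβ : (p - q) / 2 ≤ 1 / (m : ℝ) * q) :
    ∃ C : ℝ, 0 < C ∧ ∀ {n N : ℕ}, n ≤ m → ∀ {ν L T : ℝ} {Ω : Set (Spc n)}
      {A : Spc n × ℝ → Vec N → Mat N n → Mat N n} {F : Spc n × ℝ → Mat N n}
      {u : Spc n × ℝ → Vec N} {Du : Spc n × ℝ → Mat N n}, WeakSolution p ν L T Ω A F u Du →
      ∀ (x₀ : Spc n) {r t₁ t₂ Y : ℝ} (a : Vec N), 0 < r → 0 ≤ Y →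
      Metric.ball x₀ r ×ˢ Ioo t₁ t₂ ⊆ Ω ×ˢ Ioo 0 T →
      (∀ s ∈ Ioo t₁ t₂, ∫⁻ x in Metric.ball x₀ r, ‖u (x, s) - a‖ₑ ^ (2 : ℝ)
        ≤ volume (Metric.ball x₀ r) * ENNReal.ofReal Y) →
      ∫⁻ t in Ioo t₁ t₂, ∫⁻ x in Metric.ball x₀ r, ∫⁻ y in Metric.ball x₀ r,
          ‖u (x, t) - u (y, t)‖ₑ ^ p
        ≤ ENNReal.ofReal (C * r ^ q * Y ^ ((p - q) / 2)) * volume (Metric.ball x₀ r)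
          * ∫⁻ z in Metric.ball x₀ r ×ˢ Ioo t₁ t₂, ‖Du z‖ₑ ^ q := by
  obtain ⟨C, hC, hb⟩ := exists_slice_sobolev m hm hq hqp hβ
  refine ⟨C, hC, ?_⟩
  intro n N hnm ν L T Ω A F u Du hu x₀ r t₁ t₂ Y a hr hY hQ hYb
  set Q := Metric.ball x₀ r ×ˢ Ioo t₁ t₂ with hQd
  have hQm : MeasurableSet Q := measurableSet_ball.prod measurableSet_Ioo
  have hp : 1 ≤ ENNReal.ofReal p := by
    rw [← ENNReal.ofReal_one]; exact ENNReal.ofReal_le_ofReal (hq.trans hqp)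
  have hfin : volume (Ω ×ˢ Ioo (0 : ℝ) T) ≠ ∞ := volume_spaceTime_ne_top hu
  have : IsFiniteMeasure (volume.restrict (Ω ×ˢ Ioo (0 : ℝ) T)) :=
    isFiniteMeasure_restrict.2 hfin
  have hui : Integrable (Q.indicator u) :=
    (integrable_indicator_iff hQm).2 (IntegrableOn.mono_set (hu.memLp_u.integrable hp) hQ)
  have hDi : Integrable (Q.indicator Du) :=
    (integrable_indicator_iff hQm).2 (IntegrableOn.mono_set (hu.memLp_Du.integrable hp) hQ)
  have hin : ∀ x ∈ Metric.ball x₀ r, ∀ t ∈ Ioo t₁ t₂, Q.indicator u (x, t) = u (x, t) :=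
    fun x hx t ht => indicator_of_mem (mk_mem_prod hx ht) u
  have key := hb hnm x₀ (g := Q.indicator u) (G := Q.indicator Du) a hr hY
    (hu.measu.indicator hQm) (hu.measDu.indicator hQm) hui.locallyIntegrable
    hDi.locallyIntegrable (hu.hasWeakSpatialGrad hQ) (fun s hs => by
      rw [setLIntegral_congr_fun measurableSet_ball fun x hx => by rw [hin x hx s hs]]
      exact hYb s hs)
  have h1 : ∫⁻ t in Ioo t₁ t₂, ∫⁻ x in Metric.ball x₀ r, ∫⁻ y in Metric.ball x₀ r,
      ‖Q.indicator u (x, t) - Q.indicator u (y, t)‖ₑ ^ p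
      = ∫⁻ t in Ioo t₁ t₂, ∫⁻ x in Metric.ball x₀ r, ∫⁻ y in Metric.ball x₀ r,
          ‖u (x, t) - u (y, t)‖ₑ ^ p :=
    setLIntegral_congr_fun measurableSet_Ioo fun t ht =>
      setLIntegral_congr_fun measurableSet_ball fun x hx =>
        setLIntegral_congr_fun measurableSet_ball fun y hy => by
          simp only [hin x hx t ht, hin y hy t ht]
  have h2 : ∫⁻ z, ‖Q.indicator Du z‖ₑ ^ q = ∫⁻ z in Q, ‖Du z‖ₑ ^ q := by
    rw [← lintegral_indicator hQm]
    congr 1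
    ext z
    by_cases hz : z ∈ Q
    · simp [hz]
    · simp [hz, (zero_lt_one.trans_le hq)]
  rwa [h1, h2] at key

theorem exists_smooth_primitive_difference (φ : ContDiffBump (0 : ℝ)) {a b : ℝ} (hab : a ≤ b) :
    ∃ ζ : ℝ → ℝ, ContDiff ℝ (⊤ : ℕ∞) ζ ∧ tsupport ζ ⊆ Icc (a - φ.rOut) (b + φ.rOut) ∧
      (∀ s, ζ s ∈ Icc (0 : ℝ) 1) ∧
      ∀ s, deriv ζ s = φ.normed volume (a - s) - φ.normed volume (b - s) := by
  set η : ℝ → ℝ := φ.normed volume with hη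
  have hηc : Continuous η := φ.continuous_normed
  have hηi : Integrable η := φ.integrable_normed
  have hη0 : ∀ x, 0 ≤ η x := fun x => φ.nonneg_normed x
  set H : ℝ → ℝ := fun x => ∫ y in (0 : ℝ)..x, η y with hH
  have hHd : ∀ x, HasDerivAt H (η x) x := fun x =>
    intervalIntegral.integral_hasDerivAt_right (hηc.intervalIntegrable _ _)
      (hηc.stronglyMeasurableAtFilter _ _) hηc.continuousAt
  have hHs : ContDiff ℝ (⊤ : ℕ∞) H := by
    refine contDiff_infty_iff_deriv.2 ⟨fun x => (hHd x).differentiableAt, ?_⟩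
    rw [show deriv H = η from funext fun x => (hHd x).deriv]
    exact φ.contDiff_normed
  have hsub : ∀ s, H (b - s) - H (a - s) = ∫ y in (a - s)..(b - s), η y := fun s =>
    intervalIntegral.integral_interval_sub_left (hηc.intervalIntegrable _ _)
      (hηc.intervalIntegrable _ _)
  refine ⟨fun s => H (b - s) - H (a - s), ?_, ?_, fun s => ?_, fun s => ?_⟩
  · exact (hHs.comp (contDiff_const.sub contDiff_id)).sub
      (hHs.comp (contDiff_const.sub contDiff_id))
  · refine closure_minimal (fun s hs => ?_) isClosed_Icc
    by_contra hns
    refine hs ?_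
    change H (b - s) - H (a - s) = 0
    rw [hsub, intervalIntegral.integral_of_le (by linarith)]
    refine setIntegral_eq_zero_of_forall_eq_zero fun y hy => ?_
    by_contra hy0
    have hy1 : y ∈ Metric.ball (0 : ℝ) φ.rOut := by
      rw [← φ.support_normed_eq (μ := volume)]; exact hy0
    rw [Real.ball_eq_Ioo] at hy1
    exact hns ⟨by linarith [hy.1, hy1.2], by linarith [hy.2, hy1.1]⟩
  · change H (b - s) - H (a - s) ∈ _
    rw [hsub, intervalIntegral.integral_of_le (by linarith)]
    refine ⟨integral_nonneg fun y => hη0 y, ?_⟩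
    calc _ ≤ ∫ y, η y := setIntegral_le_integral hηi (Eventually.of_forall hη0)
      _ = 1 := φ.integral_normed
  · have h1 : HasDerivAt (fun s => H (b - s)) (η (b - s) * (-1)) s :=
      (hHd (b - s)).comp s ((hasDerivAt_id s).const_sub b)
    have h2 : HasDerivAt (fun s => H (a - s)) (η (a - s) * (-1)) s :=
      (hHd (a - s)).comp s ((hasDerivAt_id s).const_sub a)
    exact (h1.sub h2).deriv.trans (by ring)

theorem ae_ae_norm_sub_le_of_weak_deriv {U : ℝ → Vec N} (hU : LocallyIntegrable U) {t₁ t₂ Λ : ℝ}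
    (hΛ : 0 ≤ Λ)
    (h : ∀ ζ : ℝ → ℝ, ContDiff ℝ (⊤ : ℕ∞) ζ → HasCompactSupport ζ → tsupport ζ ⊆ Ioo t₁ t₂ →
      (∀ s, ζ s ∈ Icc (0 : ℝ) 1) → ∀ e : Vec N,
        |∫ s, deriv ζ s * inner ℝ (U s) e| ≤ Λ * ‖e‖) :
    ∀ᵐ s, ∀ᵐ t, s ∈ Ioo t₁ t₂ → t ∈ Ioo t₁ t₂ → ‖U t - U s‖ ≤ Λ := by
  have hδ0 : ∀ k : ℕ, (0 : ℝ) < 1 / ((k : ℝ) + 1) := fun k => by positivity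
  set φ : ℕ → ContDiffBump (0 : ℝ) := fun k =>
    ⟨1 / ((k : ℝ) + 1) / 2, 1 / ((k : ℝ) + 1), half_pos (hδ0 k), half_lt_self (hδ0 k)⟩ with hφ
  have hδ : Tendsto (fun k => (φ k).rOut) atTop (𝓝 0) := tendsto_one_div_add_atTop_nhds_zero_nat
  have hae := ContDiffBump.ae_convolution_tendsto_right_of_locallyIntegrable (μ := volume) (g := U)
      (φ := φ) (K := 2) hδ (Eventually.of_forall fun k => by simp [hφ]; linarith) hU
  set V : ℕ → ℝ → Vec N := fun k x => ∫ s, (φ k).normed volume (x - s) • U s with hV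
  have hVc : ∀ k x, (MeasureTheory.convolution ((φ k).normed volume) U
      (ContinuousLinearMap.lsmul ℝ ℝ) volume) x = V k x := fun k x => convolution_lsmul_swap
  simp only [hVc] at hae
  have hint : ∀ k x, Integrable fun s => (φ k).normed volume (x - s) • U s := fun k x => by
    refine hU.integrable_smul_left_of_hasCompactSupport
      ((φ k).continuous_normed.comp (continuous_const.sub continuous_id)) ?_
    exact (φ k).hasCompactSupport_normed.comp_homeomorph (Homeomorph.subLeft x)
  have key : ∀ a b, a ≤ b → a ∈ Ioo t₁ t₂ → b ∈ Ioo t₁ t₂ →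
      Tendsto (fun k => V k a) atTop (𝓝 (U a)) → Tendsto (fun k => V k b) atTop (𝓝 (U b)) →
      ‖U a - U b‖ ≤ Λ := by
    intro a b hab ha hb hla hlb
    refine le_of_tendsto (hla.sub hlb).norm ?_
    filter_upwards [hδ.eventually_lt_const (sub_pos.2 ha.1),
      hδ.eventually_lt_const (sub_pos.2 hb.2)] with k hk1 hk2
    obtain ⟨ζ, hζ, hζs, hζ1, hζd⟩ := exists_smooth_primitive_difference (φ k) hab
    have hsub : tsupport ζ ⊆ Ioo t₁ t₂ := hζs.trans fun s hs =>
      ⟨by linarith [hs.1], by linarith [hs.2]⟩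
    have hcs : HasCompactSupport ζ := isCompact_Icc.of_isClosed_subset (isClosed_tsupport ζ) hζs
    have hb1 := h ζ hζ hcs hsub hζ1 (V k a - V k b)
    have heq : ∫ s, deriv ζ s * inner ℝ (U s) (V k a - V k b)
        = inner ℝ (V k a - V k b) (V k a - V k b) := by
      have h1 : V k a - V k b = ∫ s, (deriv ζ s) • U s := by
        rw [hV]
        change (∫ s, _) - (∫ s, _) = _
        rw [← integral_sub (hint k a) (hint k b)]
        refine integral_congr_ae (Eventually.of_forall fun s => ?_)
        simp only [hζd, sub_smul]
      have h2 : Integrable fun s => (deriv ζ s) • U s := by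
        refine ((hint k a).sub (hint k b)).congr (Eventually.of_forall fun s => ?_)
        simp only [hζd, sub_smul, Pi.sub_apply]
      have h3 := integral_inner (𝕜 := ℝ) h2 (V k a - V k b)
      rw [← h1] at h3
      rw [← h3]
      refine integral_congr_ae (Eventually.of_forall fun s => ?_)
      simp only [inner_smul_right, real_inner_comm]
    rw [heq, real_inner_self_eq_norm_sq, abs_of_nonneg (sq_nonneg _), sq] at hb1
    by_cases h0 : ‖V k a - V k b‖ = 0
    · rwa [h0]
    · exact le_of_mul_le_mul_right hb1 (lt_of_le_of_ne (norm_nonneg _) (Ne.symm h0))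
  filter_upwards [hae] with s hs
  filter_upwards [hae] with t ht hsI htI
  rcases le_total t s with hts | hts
  · exact key t s hts htI hsI ht hs
  · rw [norm_sub_rev]; exact key s t hts hsI htI hs ht

theorem exists_ball_cutoff (n : ℕ) : ∃ C : ℝ, 0 < C ∧ ∀ (x₀ : Spc n) {r : ℝ}, 0 < r →
    ∃ ψ : Spc n → ℝ, ContDiff ℝ (⊤ : ℕ∞) ψ ∧ tsupport ψ ⊆ Metric.ball x₀ r ∧
      (∀ x, 0 ≤ ψ x) ∧ (∀ x, ψ x ≤ C) ∧ ∫ x, ψ x ∂(ballProb x₀ r) = 1 ∧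
      ∀ x, ‖fderiv ℝ ψ x‖ ≤ C / r := by
  let φ : ContDiffBump (0 : Spc n) := ⟨1 / 4, 1 / 2, by norm_num, by norm_num⟩
  obtain ⟨D, hD⟩ := φ.hasCompactSupport.fderiv (𝕜 := ℝ) |>.exists_bound_of_continuous
    (φ.contDiff.continuous_fderiv (n := 1) one_ne_zero)
  have hD0 : 0 ≤ D := (norm_nonneg _).trans (hD 0)
  refine ⟨4 ^ n * (D + 1), by positivity, fun x₀ r hr => ?_⟩
  have := isProbabilityMeasure_ballProb x₀ hr
  set f : Spc n → ℝ := fun x => φ (r⁻¹ • (x - x₀)) with hf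
  have hfs : ContDiff ℝ (⊤ : ℕ∞) f := φ.contDiff.comp (by fun_prop)
  set c : ℝ := ∫ x, f x ∂(ballProb x₀ r) with hc
  have hfin : Integrable f (ballProb x₀ r) := hfs.continuous.integrable_ballProb x₀ hr
  have hnr : ∀ x, ‖r⁻¹ • (x - x₀)‖ = dist x x₀ / r := fun x => by
    rw [norm_smul, norm_inv, Real.norm_of_nonneg hr.le, dist_eq_norm]; ring
  have hc4 : ((4 : ℝ) ^ n)⁻¹ ≤ c := by
    have h1 : ∫ x in Metric.ball x₀ (r / 4), f x ∂(ballProb x₀ r) ≤ c :=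
      setIntegral_le_integral hfin (Eventually.of_forall fun x => φ.nonneg)
    have h2 : ∫ x in Metric.ball x₀ (r / 4), f x ∂(ballProb x₀ r)
        = (ballProb x₀ r).real (Metric.ball x₀ (r / 4)) := by
      rw [setIntegral_congr_fun (g := fun _ => (1 : ℝ)) measurableSet_ball fun x hx => ?_]
      · simp
      · refine φ.one_of_mem_closedBall ?_
        rw [mem_closedBall_zero_iff, hnr, div_le_iff₀ hr]
        rw [Metric.mem_ball] at hx
        change dist x x₀ ≤ 1 / 4 * r
        linarith
    have h3 : (ballProb x₀ r) (Metric.ball x₀ (r / 4))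
        = (volume (Metric.ball x₀ r))⁻¹ * volume (Metric.ball x₀ (r / 4)) := by
      rw [ballProb, Measure.smul_apply, Measure.restrict_apply measurableSet_ball,
        inter_eq_left.2 (Metric.ball_subset_ball (by linarith)), smul_eq_mul]
    have h4 : volume (Metric.ball x₀ r) ≤ 4 ^ n * volume (Metric.ball x₀ (r / 4)) := by
      calc _ ≤ 2 ^ n * volume (Metric.ball x₀ (r / 2)) :=
            volume_ball_le_two_pow_mul x₀ hr (by linarith)
        _ ≤ 2 ^ n * (2 ^ n * volume (Metric.ball x₀ (r / 4))) := by
            gcongr; exact volume_ball_le_two_pow_mul x₀ (by linarith) (by linarith)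
        _ = _ := by rw [← mul_assoc, ← mul_pow]; norm_num
    have h5 : (1 : ℝ≥0∞) ≤ 4 ^ n * (ballProb x₀ r) (Metric.ball x₀ (r / 4)) := by
      rw [h3, mul_left_comm, ← ENNReal.inv_mul_cancel (Metric.measure_ball_pos volume x₀ hr).ne'
        measure_ball_lt_top.ne]
      gcongr
    have h6 : (1 : ℝ) ≤ 4 ^ n * (ballProb x₀ r).real (Metric.ball x₀ (r / 4)) := by
      have := ENNReal.toReal_mono (ENNReal.mul_ne_top (by finiteness) (measure_ne_top _ _)) h5
      simpa [ENNReal.toReal_mul, Measure.real] using this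
    rw [inv_le_iff_one_le_mul₀' (by positivity)]
    calc (1 : ℝ) ≤ 4 ^ n * (ballProb x₀ r).real (Metric.ball x₀ (r / 4)) := h6
      _ ≤ 4 ^ n * c := by rw [← h2]; gcongr
  have hc0 : 0 < c := lt_of_lt_of_le (by positivity) hc4
  have hcinv : c⁻¹ ≤ 4 ^ n := inv_le_of_inv_le₀ (by positivity) hc4
  refine ⟨fun x => c⁻¹ * f x, contDiff_const.mul hfs, ?_, fun x => ?_, fun x => ?_, ?_,
    fun x => ?_⟩
  · refine (closure_minimal (fun x hx => ?_) Metric.isClosed_closedBall).trans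
      (Metric.closedBall_subset_ball (by linarith : r / 2 < r))
    have hx' : φ (r⁻¹ • (x - x₀)) ≠ 0 := right_ne_zero_of_mul hx
    have : r⁻¹ • (x - x₀) ∈ Metric.ball (0 : Spc n) φ.rOut := by
      rw [← φ.support_eq]; exact hx'
    rw [mem_ball_zero_iff, hnr, div_lt_iff₀ hr] at this
    rw [Metric.mem_closedBall]
    change dist x x₀ < 1 / 2 * r at this
    linarith
  · exact mul_nonneg (by positivity) φ.nonneg
  · calc c⁻¹ * f x ≤ 4 ^ n * 1 := mul_le_mul hcinv φ.le_one φ.nonneg (by positivity)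
      _ ≤ 4 ^ n * (D + 1) := by gcongr; linarith
  · rw [integral_const_mul, inv_mul_cancel₀ hc0.ne']
  · have hd : HasFDerivAt f ((fderiv ℝ φ (r⁻¹ • (x - x₀))).comp
        (r⁻¹ • ContinuousLinearMap.id ℝ (Spc n))) x := by
      have h1 : HasFDerivAt (fun x : Spc n => r⁻¹ • (x - x₀))
          (r⁻¹ • ContinuousLinearMap.id ℝ (Spc n)) x :=
        ((hasFDerivAt_id x).sub_const x₀).const_smul r⁻¹
      exact ((φ.contDiff (n := 1)).differentiable one_ne_zero _).hasFDerivAt.comp x h1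
    rw [(hd.const_mul c⁻¹).fderiv, norm_smul, norm_inv, Real.norm_of_nonneg hc0.le,
      mul_div_assoc]
    refine mul_le_mul hcinv ?_ (norm_nonneg _) (by positivity)
    refine (ContinuousLinearMap.opNorm_comp_le _ _).trans ?_
    rw [norm_smul, norm_inv, Real.norm_of_nonneg hr.le, div_eq_mul_inv]
    refine mul_le_mul ((hD _).trans (by linarith)) ?_ (by positivity) (by positivity)
    exact mul_le_of_le_one_right (by positivity) ContinuousLinearMap.norm_id_le

theorem aestronglyMeasurable_caratheodory {O : Set (Spc n × ℝ)}
    {A : Spc n × ℝ → Vec N → Mat N n → Mat N n} {u : Spc n × ℝ → Vec N}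
    {Du : Spc n × ℝ → Mat N n} (hA : ∀ v ξ, Measurable fun z => A z v ξ)
    (hc : ∀ᵐ z ∂(volume.restrict O), Continuous fun q : Vec N × Mat N n => A z q.1 q.2)
    (hu : Measurable u) (hDu : Measurable Du) :
    AEStronglyMeasurable (fun z => A z (u z) (Du z)) (volume.restrict O) := by
  set S := toMeasurable (volume.restrict O)
    {z | ¬ Continuous fun q : Vec N × Mat N n => A z q.1 q.2} with hS
  have hS0 : volume.restrict O S = 0 := by rw [hS, measure_toMeasurable]; exact hc
  have hSm : MeasurableSet S := measurableSet_toMeasurable _ _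
  have hcS : ∀ z, z ∉ S → Continuous fun q : Vec N × Mat N n => A z q.1 q.2 := fun z hz => by
    by_contra h
    exact hz (subset_toMeasurable _ _ h)
  set B : Vec N × Mat N n → Spc n × ℝ → Mat N n := fun q => Sᶜ.indicator fun z => A z q.1 q.2
    with hB
  have hBm : Measurable (Function.uncurry B) := by
    refine measurable_uncurry_of_continuous_of_measurable (fun z => ?_) fun q =>
      (hA q.1 q.2).indicator hSm.compl
    by_cases hz : z ∈ S
    · simpa [hB, hz] using continuous_const
    · simpa [hB, hz] using hcS z hz
  refine ⟨fun z => B (u z, Du z) z,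
    (hBm.comp ((hu.prodMk hDu).prodMk measurable_id)).stronglyMeasurable, ?_⟩
  have : ∀ᵐ z ∂(volume.restrict O), z ∉ S := by
    rw [ae_iff]; simpa using hS0
  filter_upwards [this] with z hz
  simp [hB, hz]

theorem MemLp.integrable_norm_rpow_of_le {α V : Type*} [MeasurableSpace α] [NormedAddCommGroup V]
    {κ : Measure α} [IsFiniteMeasure κ] {f : α → V} {p s : ℝ} (hp : 0 < p)
    (hf : MemLp f (ENNReal.ofReal p) κ) (hs : 0 ≤ s) (hsp : s ≤ p) :
    Integrable (fun x => ‖f x‖ ^ s) κ := by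
  have h := hf.integrable_norm_rpow (by simpa using hp) ENNReal.ofReal_ne_top
  rw [ENNReal.toReal_ofReal hp.le] at h
  refine ((integrable_const (1 : ℝ)).add h).mono'
    (hf.1.norm.aemeasurable.pow_const s).aestronglyMeasurable (Eventually.of_forall fun x => ?_)
  rw [Real.norm_of_nonneg (by positivity)]
  rcases le_total ‖f x‖ 1 with h1 | h1
  · exact (Real.rpow_le_one (norm_nonneg _) h1 hs).trans
      (le_add_of_nonneg_right (by positivity))
  · exact (Real.rpow_le_rpow_of_exponent_le h1 hsp).trans
      (le_add_of_nonneg_left zero_le_one)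

theorem abs_sum_mul_le (M : Mat N n) (e : Vec N) (d : Fin n → ℝ) {D : ℝ} (hd : ∀ j, |d j| ≤ D) :
    |∑ i : Fin N, ∑ j : Fin n, M (i, j) * (e i * d j)| ≤ ‖M‖ * (‖e‖ * (n * D)) := by
  set T : Mat N n := WithLp.toLp 2 fun ij => e ij.1 * d ij.2 with hT
  have h1 : ∑ i : Fin N, ∑ j : Fin n, M (i, j) * (e i * d j) = inner ℝ T M := by
    rw [PiLp.inner_apply, Fintype.sum_prod_type]
    rfl
  have hD : ∑ j, d j ^ 2 ≤ (n * D) ^ 2 := by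
    rcases Nat.eq_zero_or_pos n with rfl | hn
    · simp
    · have hn1 : (1 : ℝ) ≤ n := by exact_mod_cast hn
      calc ∑ j, d j ^ 2 ≤ ∑ _j : Fin n, D ^ 2 :=
            Finset.sum_le_sum fun j _ => sq_le_sq' (by linarith [neg_abs_le (d j), hd j])
              ((le_abs_self _).trans (hd j))
        _ = n * D ^ 2 := by simp
        _ ≤ (n * D) ^ 2 := by nlinarith [sq_nonneg D, mul_nonneg (sub_nonneg.2 hn1) (sq_nonneg D)]
  have hT2 : ‖T‖ ≤ ‖e‖ * |n * D| := by
    refine le_of_sq_le_sq ?_ (by positivity)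
    rw [mul_pow, sq_abs, EuclideanSpace.norm_sq_eq, EuclideanSpace.norm_sq_eq,
      Fintype.sum_prod_type, Finset.sum_mul]
    refine Finset.sum_le_sum fun i _ => ?_
    calc ∑ j, ‖T (i, j)‖ ^ 2 = ‖e i‖ ^ 2 * ∑ j, d j ^ 2 := by
          rw [Finset.mul_sum]
          refine Finset.sum_congr rfl fun j _ => ?_
          simp only [hT, Real.norm_eq_abs, sq_abs]
          ring
      _ ≤ _ := by gcongr
  have hDn : |(n : ℝ) * D| = n * D := by
    rcases Nat.eq_zero_or_pos n with rfl | hn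
    · simp
    · exact abs_of_nonneg (mul_nonneg (by positivity) ((abs_nonneg _).trans (hd ⟨0, hn⟩)))
  rw [h1, mul_comm, ← hDn]
  exact (abs_real_inner_le_norm _ _).trans (mul_le_mul_of_nonneg_right hT2 (norm_nonneg _))

section Product

variable {ζ : ℝ → ℝ} {ψ : Spc n → ℝ} (e : Vec N)

theorem tderiv_mul_smul (hζ : ContDiff ℝ (⊤ : ℕ∞) ζ) (z : Spc n × ℝ) :
    tderiv (fun w : Spc n × ℝ => (ζ w.2 * ψ w.1) • e) z = (deriv ζ z.2 * ψ z.1) • e := by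
  have h := (hζ.differentiable (by simp) z.2).hasDerivAt
  exact ((h.mul_const (ψ z.1)).smul_const e).deriv

theorem pderivS_mul_smul (hψ : ContDiff ℝ (⊤ : ℕ∞) ψ) (z : Spc n × ℝ) (i : Fin N) (j : Fin n) :
    pderivS j (fun w : Spc n × ℝ => ((ζ w.2 * ψ w.1) • e) i) z
      = e i * (ζ z.2 * fderiv ℝ ψ z.1 (EuclideanSpace.single j 1)) := by
  have h := (hψ.differentiable (by simp) z.1).hasFDerivAt
  have h2 := (((h.const_mul (ζ z.2)).mul_const (e i))).fderiv
  have h3 : (fun y => ((ζ z.2 * ψ y) • e) i) = fun y => ζ z.2 * ψ y * e i := by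
    ext y; simp
  simp only [pderivS, h3, h2]
  simp

theorem abs_gradPair_mul_smul_le (hψ : ContDiff ℝ (⊤ : ℕ∞) ψ) {D : ℝ}
    (hD : ∀ x, ‖fderiv ℝ ψ x‖ ≤ D) (hζ : ∀ s, ζ s ∈ Icc (0 : ℝ) 1)
    (M : Spc n × ℝ → Mat N n) (z : Spc n × ℝ) :
    |gradPair M (fun w : Spc n × ℝ => (ζ w.2 * ψ w.1) • e) z| ≤ ‖M z‖ * (‖e‖ * (n * D)) := by
  simp only [gradPair, pderivS_mul_smul e hψ]
  refine abs_sum_mul_le (M z) e _ fun j => ?_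
  rw [abs_mul, abs_of_nonneg (hζ z.2).1]
  calc _ ≤ 1 * ‖fderiv ℝ ψ z.1 (EuclideanSpace.single j 1)‖ :=
        mul_le_mul_of_nonneg_right (hζ z.2).2 (abs_nonneg _)
    _ ≤ ‖fderiv ℝ ψ z.1‖ * ‖(EuclideanSpace.single j 1 : Spc n)‖ := by
        rw [one_mul]; exact ContinuousLinearMap.le_opNorm _ _
    _ ≤ D := by simpa using hD z.1

theorem tsupport_mul_smul_subset {B : Set (Spc n)} {I : Set ℝ} (hψ : tsupport ψ ⊆ B)
    (hζ : tsupport ζ ⊆ I) :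
    tsupport (fun w : Spc n × ℝ => (ζ w.2 * ψ w.1) • e) ⊆ B ×ˢ I := by
  refine (closure_minimal (fun w hw => ?_)
    ((isClosed_tsupport ψ).prod (isClosed_tsupport ζ))).trans (prod_mono hψ hζ)
  have hw' : ζ w.2 * ψ w.1 ≠ 0 := fun h => hw (by simp [h])
  exact ⟨subset_tsupport _ (right_ne_zero_of_mul hw'), subset_tsupport _ (left_ne_zero_of_mul hw')⟩

end Product

section

variable {p ν L T : ℝ} {Ω : Set (Spc n)} {A : Spc n × ℝ → Vec N → Mat N n → Mat N n}
  {F : Spc n × ℝ → Mat N n} {u : Spc n × ℝ → Vec N} {Du : Spc n × ℝ → Mat N n}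

theorem WeakSolution.isFiniteMeasure_restrict (hu : WeakSolution p ν L T Ω A F u Du)
    {Q : Set (Spc n × ℝ)} (hQ : Q ⊆ Ω ×ˢ Ioo 0 T) : IsFiniteMeasure (volume.restrict Q) :=
  MeasureTheory.isFiniteMeasure_restrict.2 (measure_ne_top_of_subset hQ (volume_spaceTime_ne_top hu))

theorem WeakSolution.abs_setIntegral_deriv_le (hu : WeakSolution p ν L T Ω A F u Du) (hp : 2 ≤ p)
    {B : Set (Spc n)} {I : Set ℝ} (hB : MeasurableSet B) (hI : MeasurableSet I)
    (hQ : B ×ˢ I ⊆ Ω ×ˢ Ioo 0 T) {ψ : Spc n → ℝ} (hψ : ContDiff ℝ (⊤ : ℕ∞) ψ)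
    (hψc : HasCompactSupport ψ) (hψs : tsupport ψ ⊆ B) {D : ℝ} (hD : ∀ x, ‖fderiv ℝ ψ x‖ ≤ D)
    {ζ : ℝ → ℝ} (hζ : ContDiff ℝ (⊤ : ℕ∞) ζ) (hζc : HasCompactSupport ζ) (hζs : tsupport ζ ⊆ I)
    (hζ1 : ∀ s, ζ s ∈ Icc (0 : ℝ) 1) (e : Vec N) :
    |∫ z in B ×ˢ I, deriv ζ z.2 * inner ℝ (ψ z.1 • pw (p - 1) (u z)) e|
      ≤ (n * D * (L + 1) * ∫ z in B ×ˢ I, (‖Du z‖ ^ (p - 1) + ‖F z‖ ^ (p - 1))) * ‖e‖ := by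
  set φ : Spc n × ℝ → Vec N := fun w => (ζ w.2 * ψ w.1) • e with hφ
  have hφs : tsupport φ ⊆ B ×ˢ I := tsupport_mul_smul_subset e hψs hζs
  have hφc : HasCompactSupport φ :=
    (hψc.isCompact.prod hζc.isCompact).of_isClosed_subset (isClosed_tsupport _)
      (tsupport_mul_smul_subset e subset_rfl subset_rfl)
  have hφd : ContDiff ℝ (⊤ : ℕ∞) φ :=
    ((hζ.comp contDiff_snd).mul (hψ.comp contDiff_fst)).smul contDiff_const
  have hO : MeasurableSet (Ω ×ˢ Ioo (0 : ℝ) T) := hu.openΩ.measurableSet.prod measurableSet_Ioo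
  have hQm : MeasurableSet (B ×ˢ I) := hB.prod hI
  have hw := hu.weakForm φ hφd hφc (hφs.trans hQ)
  have hoff : ∀ z, z ∉ B ×ˢ I → z ∉ tsupport φ := fun z hz hz' => hz (hφs hz')
  have hgp : ∀ (M : Spc n × ℝ → Mat N n) z, z ∉ B ×ˢ I → gradPair M φ z = 0 := fun M z hz => by
    refine Finset.sum_eq_zero fun i _ => Finset.sum_eq_zero fun j _ => ?_
    rw [pderivS_eq_zero_of_notMem_tsupport, mul_zero]
    refine fun h => hoff z hz (closure_mono (fun w hw => ?_) h)
    exact fun h0 => hw (by simp [h0])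
  have htd : ∀ z, tderiv φ z = (deriv ζ z.2 * ψ z.1) • e := tderiv_mul_smul e hζ
  have hinn : ∀ z, ‖u z‖ ^ (p - 2) * (inner ℝ (u z) (tderiv φ z) : ℝ)
      = deriv ζ z.2 * inner ℝ (ψ z.1 • pw (p - 1) (u z)) e := fun z => by
    rw [htd, inner_smul_right, inner_smul_left, pw, inner_smul_left,
      show p - 1 - 1 = p - 2 by ring]
    simp only [conj_trivial]
    ring
  have hin0 : ∀ z, z ∉ B ×ˢ I → deriv ζ z.2 * inner ℝ (ψ z.1 • pw (p - 1) (u z)) e = 0 := by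
    intro z hz
    by_cases h1 : z.1 ∈ B
    · have h2 : z.2 ∉ tsupport ζ := fun h => hz ⟨h1, hζs h⟩
      rw [(notMem_tsupport_iff_eventuallyEq.1 h2).deriv_eq]
      simp
    · rw [image_eq_zero_of_notMem_tsupport fun h => h1 (hψs h)]
      simp
  simp only [hinn] at hw
  rw [setIntegral_eq_of_subset_of_forall_sdiff_eq_zero hO hQ
      (fun z hz => by rw [hin0 z hz.2, hgp _ z hz.2, sub_zero]),
    setIntegral_eq_of_subset_of_forall_sdiff_eq_zero hO hQ
      (fun z hz => by rw [hgp _ z hz.2, mul_zero])] at hw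
  set κ := volume.restrict (B ×ˢ I) with hκ
  have hac : κ ≤ volume.restrict (Ω ×ˢ Ioo 0 T) := Measure.restrict_mono hQ le_rfl
  have hfinκ : IsFiniteMeasure κ := hu.isFiniteMeasure_restrict hQ
  have hp0 : 0 < p := by linarith
  have hpow : ∀ {V : Type} [NormedAddCommGroup V] {f : Spc n × ℝ → V},
      MemLp f (ENNReal.ofReal p) (volume.restrict (Ω ×ˢ Ioo 0 T)) →
      Integrable (fun z => ‖f z‖ ^ (p - 1)) κ := fun hf =>
    MemLp.integrable_norm_rpow_of_le hp0 (hf.mono_measure hac) (by linarith) (by linarith)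
  have hgr : ∀ᵐ z ∂κ, ‖A z (u z) (Du z)‖ ≤ L * ‖Du z‖ ^ (p - 1) :=
    Eventually.mono (ae_mono hac hu.growth) fun z hz => hz _ _
  have hL : 0 ≤ L := hu.hν.le.trans hu.hνL
  have hD0 : 0 ≤ D := (norm_nonneg _).trans (hD 0)
  have hmeasg : ∀ M : Spc n × ℝ → Mat N n, AEStronglyMeasurable M κ →
      AEStronglyMeasurable (gradPair M φ) κ := fun M hM => by
    have h1 : ∀ z, gradPair M φ z = ∑ i : Fin N, ∑ j : Fin n, M z (i, j)
        * (e i * (ζ z.2 * fderiv ℝ ψ z.1 (EuclideanSpace.single j 1))) := fun z => by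
      simp only [gradPair, hφ, pderivS_mul_smul e hψ]
    rw [funext h1]
    refine Finset.aestronglyMeasurable_fun_sum _ fun i _ =>
      Finset.aestronglyMeasurable_fun_sum _ fun j _ => ?_
    refine AEStronglyMeasurable.mul
      ((EuclideanSpace.proj (i, j) : Mat N n →L[ℝ] ℝ).continuous.comp_aestronglyMeasurable hM) ?_
    refine Continuous.aestronglyMeasurable ?_
    have hc1 : Continuous (fderiv ℝ ψ) := hψ.continuous_fderiv (by simp)
    have hc2 : Continuous ζ := hζ.continuous
    fun_prop
  have hgA : Integrable (gradPair (fun w => A w (u w) (Du w)) φ) κ := by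
    refine (((hpow hu.memLp_Du).const_mul L).mul_const (‖e‖ * (n * D))).mono'
      (hmeasg _ (aestronglyMeasurable_caratheodory hu.measA (ae_mono hac hu.contA)
        hu.measu hu.measDu)) ?_
    filter_upwards [hgr] with z hz
    exact (abs_gradPair_mul_smul_le e hψ hD hζ1 _ z).trans
      (mul_le_mul_of_nonneg_right hz (by positivity))
  have hf : Integrable (fun z => deriv ζ z.2 * inner ℝ (ψ z.1 • pw (p - 1) (u z)) e) κ := by
    obtain ⟨C₁, hC₁⟩ := hζc.deriv.exists_bound_of_continuous (hζ.continuous_deriv (by simp))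
    obtain ⟨C₂, hC₂⟩ := hψc.exists_bound_of_continuous hψ.continuous
    refine ((hpow hu.memLp_u).const_mul (C₁ * C₂ * ‖e‖)).mono' ?_
      (Eventually.of_forall fun z => ?_)
    · have h1 : Measurable (deriv ζ) := measurable_deriv ζ
      have h2 : Measurable ψ := hψ.continuous.measurable
      have h3 : Measurable fun z => pw (p - 1) (u z) := (measurable_pw _).comp hu.measu
      have h4 : Measurable fun z : Spc n × ℝ => deriv ζ z.2 := h1.comp measurable_snd
      have h5 : Measurable fun z : Spc n × ℝ => ψ z.1 := h2.comp measurable_fst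
      exact (h4.mul ((h5.smul h3).inner measurable_const)).aestronglyMeasurable
    · rw [norm_mul]
      calc ‖deriv ζ z.2‖ * ‖(inner ℝ (ψ z.1 • pw (p - 1) (u z)) e : ℝ)‖
          ≤ C₁ * (C₂ * ‖u z‖ ^ (p - 1) * ‖e‖) := by
            refine mul_le_mul (hC₁ _) ((abs_real_inner_le_norm _ _).trans ?_) (norm_nonneg _)
              ((norm_nonneg _).trans (hC₁ 0))
            rw [norm_smul, norm_pw (by linarith)]
            gcongr
            exact hC₂ _
        _ = _ := by ring
  rw [integral_sub hf hgA, sub_eq_iff_eq_add] at hw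
  have hFi := hpow hu.memLp_F
  have hDi := hpow hu.memLp_Du
  rw [hw]
  have hb1 : |∫ z, ‖F z‖ ^ (p - 2) * gradPair F φ z ∂κ|
      ≤ ∫ z, ‖F z‖ ^ (p - 1) * (‖e‖ * (n * D)) ∂κ := by
    rw [← Real.norm_eq_abs]
    refine norm_integral_le_of_norm_le (hFi.mul_const _) (Eventually.of_forall fun z => ?_)
    rw [norm_mul, Real.norm_of_nonneg (by positivity), Real.norm_eq_abs]
    refine (mul_le_mul_of_nonneg_left (abs_gradPair_mul_smul_le e hψ hD hζ1 F z)
      (by positivity)).trans (le_of_eq ?_)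
    rw [← mul_assoc]
    congr 1
    rcases eq_or_ne (‖F z‖) 0 with h0 | h0
    · rw [h0, mul_zero, Real.zero_rpow (by linarith)]
    · rw [show p - 1 = p - 2 + 1 by ring, Real.rpow_add_one h0]
  have hb2 : |∫ z, gradPair (fun w => A w (u w) (Du w)) φ z ∂κ|
      ≤ ∫ z, L * ‖Du z‖ ^ (p - 1) * (‖e‖ * (n * D)) ∂κ := by
    rw [← Real.norm_eq_abs]
    refine norm_integral_le_of_norm_le ((hDi.const_mul L).mul_const _) ?_
    filter_upwards [hgr] with z hz
    exact (abs_gradPair_mul_smul_le e hψ hD hζ1 _ z).trans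
      (mul_le_mul_of_nonneg_right hz (by positivity))
  refine (abs_add_le _ _).trans ((add_le_add hb1 hb2).trans ?_)
  rw [integral_add hDi hFi, integral_mul_const, integral_mul_const, integral_const_mul]
  have h1 : 0 ≤ ∫ z, ‖F z‖ ^ (p - 1) ∂κ := integral_nonneg fun z => by positivity
  have h2 : 0 ≤ ∫ z, ‖Du z‖ ^ (p - 1) ∂κ := integral_nonneg fun z => by positivity
  have h3 : 0 ≤ ‖e‖ * (n * D) := by positivity
  have h4 := mul_nonneg (mul_nonneg hL h1) h3
  have h5 := mul_nonneg h2 h3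
  nlinarith

end

/-- Normalized Lebesgue measure on a time interval. -/
def timeProb (t₁ t₂ : ℝ) : Measure ℝ :=
  (volume (Ioo t₁ t₂))⁻¹ • volume.restrict (Ioo t₁ t₂)

/-- Normalized Lebesgue measure on a space-time cylinder. -/
def cylProb (x₀ : Spc n) (r t₁ t₂ : ℝ) : Measure (Spc n × ℝ) :=
  (ballProb x₀ r).prod (timeProb t₁ t₂)

theorem isProbabilityMeasure_timeProb {t₁ t₂ : ℝ} (ht : t₁ < t₂) :
    IsProbabilityMeasure (timeProb t₁ t₂) := by
  refine ⟨?_⟩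
  rw [timeProb, Measure.smul_apply, Measure.restrict_apply_univ, smul_eq_mul]
  exact ENNReal.inv_mul_cancel (by simpa using ht) (by simp)

theorem isProbabilityMeasure_cylProb (x₀ : Spc n) {r t₁ t₂ : ℝ} (hr : 0 < r) (ht : t₁ < t₂) :
    IsProbabilityMeasure (cylProb x₀ r t₁ t₂) := by
  have := isProbabilityMeasure_ballProb x₀ hr
  have := isProbabilityMeasure_timeProb ht
  unfold cylProb
  infer_instance

theorem cylProb_eq_smul (x₀ : Spc n) {r t₁ t₂ : ℝ} (hr : 0 < r) (ht : t₁ < t₂) :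
    cylProb x₀ r t₁ t₂ = (volume (Metric.ball x₀ r ×ˢ Ioo t₁ t₂))⁻¹
      • volume.restrict (Metric.ball x₀ r ×ˢ Ioo t₁ t₂) := by
  have := isProbabilityMeasure_ballProb x₀ hr
  have hI : (volume (Ioo t₁ t₂))⁻¹ ≠ ∞ := by simpa using ht
  have hB : (volume (Metric.ball x₀ r))⁻¹ ≠ ∞ :=
    ENNReal.inv_ne_top.2 (Metric.measure_ball_pos _ _ hr).ne'
  rw [cylProb, timeProb, ballProb, Measure.prod_smul_left, Measure.prod_smul_right,
    Measure.prod_restrict, smul_smul, ← Measure.volume_eq_prod,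
    Measure.volume_eq_prod, Measure.prod_prod,
    ENNReal.mul_inv (Or.inl (Metric.measure_ball_pos _ _ hr).ne') (Or.inr (by simpa using ht))]

theorem setAverage_eq_integral_cylProb {V : Type*} [NormedAddCommGroup V] [NormedSpace ℝ V]
    (x₀ : Spc n) {r t₁ t₂ : ℝ} (hr : 0 < r) (ht : t₁ < t₂) (f : Spc n × ℝ → V) :
    ⨍ z in Metric.ball x₀ r ×ˢ Ioo t₁ t₂, f z = ∫ z, f z ∂(cylProb x₀ r t₁ t₂) := by
  rw [cylProb_eq_smul x₀ hr ht, average, Measure.restrict_apply_univ]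

theorem setIntegral_eq_integral_cylProb (x₀ : Spc n) {r t₁ t₂ : ℝ} (hr : 0 < r) (ht : t₁ < t₂)
    (f : Spc n × ℝ → ℝ) : ∫ z in Metric.ball x₀ r ×ˢ Ioo t₁ t₂, f z
      = volume.real (Metric.ball x₀ r) * (t₂ - t₁) * ∫ z, f z ∂(cylProb x₀ r t₁ t₂) := by
  have h1 : volume.real (Metric.ball x₀ r) * (t₂ - t₁)
      = (volume (Metric.ball x₀ r ×ˢ Ioo t₁ t₂)).toReal := by
    rw [Measure.volume_eq_prod, Measure.prod_prod, ENNReal.toReal_mul, Real.volume_Ioo,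
      ENNReal.toReal_ofReal (by linarith)]
    rfl
  have h2 : 0 < volume.real (Metric.ball x₀ r) * (t₂ - t₁) :=
    mul_pos (ENNReal.toReal_pos (Metric.measure_ball_pos _ _ hr).ne' measure_ball_lt_top.ne)
      (by linarith)
  rw [cylProb_eq_smul x₀ hr ht, integral_smul_measure, ENNReal.toReal_inv, ← h1, smul_eq_mul,
    mul_inv_cancel_left₀ h2.ne']

theorem integral_timeProb {t₁ t₂ : ℝ} (ht : t₁ < t₂) (f : ℝ → ℝ) :
    ∫ t in Ioo t₁ t₂, f t = (t₂ - t₁) * ∫ t, f t ∂(timeProb t₁ t₂) := by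
  rw [timeProb, integral_smul_measure, ENNReal.toReal_inv, Real.volume_Ioo,
    ENNReal.toReal_ofReal (by linarith), smul_eq_mul, mul_inv_cancel_left₀ (by linarith)]

section

variable {p ν L T : ℝ} {Ω : Set (Spc n)} {A : Spc n × ℝ → Vec N → Mat N n → Mat N n}
  {F : Spc n × ℝ → Mat N n} {u : Spc n × ℝ → Vec N} {Du : Spc n × ℝ → Mat N n}

theorem memLp_cylProb {V : Type*} [NormedAddCommGroup V] {f : Spc n × ℝ → V} {s : ℝ≥0∞}
    {O : Set (Spc n × ℝ)} (hf : MemLp f s (volume.restrict O)) (x₀ : Spc n) {r t₁ t₂ : ℝ}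
    (hr : 0 < r) (ht : t₁ < t₂) (hQ : Metric.ball x₀ r ×ˢ Ioo t₁ t₂ ⊆ O) :
    MemLp f s (cylProb x₀ r t₁ t₂) := by
  rw [cylProb_eq_smul x₀ hr ht]
  refine (hf.mono_measure (Measure.restrict_mono hQ le_rfl)).smul_measure (ENNReal.inv_ne_top.2 ?_)
  rw [Measure.volume_eq_prod, Measure.prod_prod]
  exact mul_ne_zero (Metric.measure_ball_pos _ _ hr).ne' (by simpa using ht)

theorem WeakSolution.exists_ae_norm_sub_le (hu : WeakSolution p ν L T Ω A F u Du) (hp : 2 ≤ p)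
    {x₀ : Spc n} {r t₁ t₂ : ℝ} (hr : 0 < r) (ht : t₁ < t₂)
    (hQ : Metric.ball x₀ r ×ˢ Ioo t₁ t₂ ⊆ Ω ×ˢ Ioo 0 T) {ψ : Spc n → ℝ}
    (hψ : ContDiff ℝ (⊤ : ℕ∞) ψ) (hψs : tsupport ψ ⊆ Metric.ball x₀ r) {D : ℝ}
    (hD : ∀ x, ‖fderiv ℝ ψ x‖ ≤ D) :
    ∃ V : Vec N, ∀ᵐ t ∂(timeProb t₁ t₂),
      ‖(∫ x, ψ x • pw (p - 1) (u (x, t)) ∂(ballProb x₀ r)) - V‖ ≤ n * D * (L + 1) * (t₂ - t₁)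
        * ∫ z, (‖Du z‖ ^ (p - 1) + ‖F z‖ ^ (p - 1)) ∂(cylProb x₀ r t₁ t₂) := by
  have hPb := isProbabilityMeasure_ballProb x₀ hr
  have hPt := isProbabilityMeasure_timeProb ht
  have hPc := isProbabilityMeasure_cylProb x₀ hr ht
  have hψc : HasCompactSupport ψ := (isCompact_closedBall x₀ r).of_isClosed_subset
    (isClosed_tsupport ψ) (hψs.trans Metric.ball_subset_closedBall)
  have hp0 : 0 < p := by linarith
  obtain ⟨C, hC⟩ := hψc.exists_bound_of_continuous hψ.continuous
  have hint : Integrable (fun z : Spc n × ℝ => ψ z.1 • pw (p - 1) (u z)) (cylProb x₀ r t₁ t₂) := by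
    refine ((MemLp.integrable_norm_rpow_of_le (s := p - 1) hp0
      (memLp_cylProb hu.memLp_u x₀ hr ht hQ) (by linarith) (by linarith)).const_mul C).mono' ?_
      (Eventually.of_forall fun z => ?_)
    · exact ((hψ.continuous.measurable.comp measurable_fst).smul
        ((measurable_pw _).comp hu.measu)).aestronglyMeasurable
    · rw [norm_smul, norm_pw (by linarith)]
      exact mul_le_mul_of_nonneg_right (hC _) (by positivity)
  set U : ℝ → Vec N := fun t => ∫ x, ψ x • pw (p - 1) (u (x, t)) ∂(ballProb x₀ r) with hU
  have hUi : Integrable U (timeProb t₁ t₂) := hint.integral_prod_right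
  have hUon : IntegrableOn U (Ioo t₁ t₂) := by
    have h := hUi.smul_measure (c := volume (Ioo t₁ t₂)) (by simp)
    rwa [timeProb, smul_smul, ENNReal.mul_inv_cancel (by simpa using ht) (by simp), one_smul] at h
  have hUl : LocallyIntegrable ((Ioo t₁ t₂).indicator U) :=
    ((integrable_indicator_iff measurableSet_Ioo).2 hUon).locallyIntegrable
  have hD0 : 0 ≤ D := (norm_nonneg _).trans (hD 0)
  have hL : 0 ≤ L := hu.hν.le.trans hu.hνL
  set J := ∫ z, (‖Du z‖ ^ (p - 1) + ‖F z‖ ^ (p - 1)) ∂(cylProb x₀ r t₁ t₂) with hJ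
  have hJ0 : 0 ≤ J := integral_nonneg fun z => by positivity
  set Λ := n * D * (L + 1) * (t₂ - t₁) * J with hΛ
  have hΛ0 : 0 ≤ Λ := by
    have := sub_pos.2 ht
    positivity
  have hBpos : 0 < volume.real (Metric.ball x₀ r) :=
    ENNReal.toReal_pos (Metric.measure_ball_pos _ _ hr).ne' measure_ball_lt_top.ne
  have hweak : ∀ ζ : ℝ → ℝ, ContDiff ℝ (⊤ : ℕ∞) ζ → HasCompactSupport ζ → tsupport ζ ⊆ Ioo t₁ t₂ →
      (∀ s, ζ s ∈ Icc (0 : ℝ) 1) → ∀ e : Vec N,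
        |∫ s, deriv ζ s * inner ℝ ((Ioo t₁ t₂).indicator U s) e| ≤ Λ * ‖e‖ := by
    intro ζ hζ hζc hζs hζ1 e
    have h1 := hu.abs_setIntegral_deriv_le hp measurableSet_ball measurableSet_Ioo hQ hψ hψc hψs hD
      hζ hζc hζs hζ1 e
    obtain ⟨C₁, hC₁⟩ := hζc.deriv.exists_bound_of_continuous (hζ.continuous_deriv (by simp))
    have h2 : Integrable (fun z : Spc n × ℝ => deriv ζ z.2
        * inner ℝ (ψ z.1 • pw (p - 1) (u z)) e) (cylProb x₀ r t₁ t₂) :=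
      (hint.inner_const e).bdd_mul
        ((measurable_deriv ζ).comp measurable_snd).aestronglyMeasurable
        (Eventually.of_forall fun z => hC₁ z.2)
    rw [setIntegral_eq_integral_cylProb x₀ hr ht, setIntegral_eq_integral_cylProb x₀ hr ht, cylProb,
      integral_prod_symm _ h2] at h1
    have hslice : ∀ᵐ t ∂(timeProb t₁ t₂),
        Integrable (fun x => ψ x • pw (p - 1) (u (x, t))) (ballProb x₀ r) := hint.prod_left_ae
    have h3 : ∫ t, ∫ x, deriv ζ t * inner ℝ (ψ x • pw (p - 1) (u (x, t))) e ∂(ballProb x₀ r)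
        ∂(timeProb t₁ t₂) = ∫ t, deriv ζ t * inner ℝ (U t) e ∂(timeProb t₁ t₂) := by
      refine integral_congr_ae ?_
      filter_upwards [hslice] with t ht
      rw [integral_const_mul]
      congr 1
      simp_rw [real_inner_comm e]
      exact integral_inner ht e
    have h4 : ∫ s, deriv ζ s * inner ℝ ((Ioo t₁ t₂).indicator U s) e
        = (t₂ - t₁) * ∫ t, deriv ζ t * inner ℝ (U t) e ∂(timeProb t₁ t₂) := by
      rw [← integral_timeProb ht, ← integral_indicator measurableSet_Ioo]
      refine integral_congr_ae (Eventually.of_forall fun s => ?_)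
      by_cases hs : s ∈ Ioo t₁ t₂ <;> simp [hs]
    rw [h4]
    change |volume.real (Metric.ball x₀ r) * (t₂ - t₁)
      * ∫ t, ∫ x, deriv ζ t * inner ℝ (ψ x • pw (p - 1) (u (x, t))) e ∂(ballProb x₀ r)
        ∂(timeProb t₁ t₂)| ≤ _ at h1
    rw [h3, mul_assoc, abs_mul, abs_of_pos hBpos] at h1
    refine le_of_mul_le_mul_left (h1.trans (le_of_eq ?_)) hBpos
    rw [hΛ, hJ, cylProb]
    ring
  have hosc := ae_ae_norm_sub_le_of_weak_deriv hUl hΛ0 hweak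
  have hac : timeProb t₁ t₂ ≪ volume.restrict (Ioo t₁ t₂) := Measure.smul_absolutelyContinuous
  have hmem : ∀ᵐ t ∂(timeProb t₁ t₂), t ∈ Ioo t₁ t₂ :=
    hac.ae_le (ae_restrict_mem measurableSet_Ioo)
  have hac' : timeProb t₁ t₂ ≪ volume := hac.trans Measure.absolutelyContinuous_restrict
  obtain ⟨s, hs, hsI⟩ := (Eventually.and (hac'.ae_le hosc) hmem).exists
  refine ⟨U s, ?_⟩
  filter_upwards [hac'.ae_le hs, hmem] with t h1 h2
  simpa [hsI, h2] using h1 hsI h2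

end

theorem add_rpow_le_two_rpow_mul {x y p : ℝ} (hx : 0 ≤ x) (hy : 0 ≤ y) (hp : 0 ≤ p) :
    (x + y) ^ p ≤ 2 ^ p * (x ^ p + y ^ p) := by
  have h : ∀ {x y : ℝ}, 0 ≤ x → 0 ≤ y → x ≤ y → (x + y) ^ p ≤ 2 ^ p * (x ^ p + y ^ p) := by
    intro x y hx hy hxy
    calc (x + y) ^ p ≤ (2 * y) ^ p := Real.rpow_le_rpow (by positivity) (by linarith) hp
      _ = 2 ^ p * y ^ p := Real.mul_rpow zero_le_two hy
      _ ≤ _ := by gcongr; exact le_add_of_nonneg_left (by positivity)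
  rcases le_total x y with hxy | hxy
  · exact h hx hy hxy
  · rw [add_comm x, add_comm (x ^ p)]; exact h hy hx hxy

theorem add_add_rpow_le_three_rpow_mul {x y z p : ℝ} (hx : 0 ≤ x) (hy : 0 ≤ y) (hz : 0 ≤ z)
    (hp : 0 ≤ p) : (x + y + z) ^ p ≤ 3 ^ p * (x ^ p + y ^ p + z ^ p) := by
  set m := max (max x y) z with hm
  have hxm : x ≤ m := (le_max_left _ _).trans (le_max_left _ _)
  have hym : y ≤ m := (le_max_right _ _).trans (le_max_left _ _)
  have hzm : z ≤ m := le_max_right _ _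
  have hm0 : 0 ≤ m := hx.trans hxm
  have hxp := Real.rpow_nonneg hx p
  have hyp := Real.rpow_nonneg hy p
  have hzp := Real.rpow_nonneg hz p
  have hmp : m ^ p ≤ x ^ p + y ^ p + z ^ p := by
    rcases max_choice (max x y) z with h | h
    · rcases max_choice x y with h' | h' <;> rw [hm, h, h'] <;> linarith
    · rw [hm, h]; linarith
  calc (x + y + z) ^ p ≤ (3 * m) ^ p := Real.rpow_le_rpow (by positivity) (by linarith) hp
    _ = 3 ^ p * m ^ p := Real.mul_rpow (by norm_num) hm0
    _ ≤ _ := by gcongr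

theorem integral_rpow_le_rpow_integral {α : Type*} [MeasurableSpace α] {P : Measure α}
    [IsProbabilityMeasure P] {g : α → ℝ} (hg0 : ∀ x, 0 ≤ g x) {s p : ℝ} (hs : 0 < s) (hsp : s ≤ p)
    (hgs : Integrable (fun x => g x ^ s) P) (hgp : Integrable (fun x => g x ^ p) P) :
    ∫ x, g x ^ s ∂P ≤ (∫ x, g x ^ p ∂P) ^ (s / p) := by
  have hp : 0 < p := hs.trans_le hsp
  have hcomp : ∀ x, (g x ^ s) ^ (p / s) = g x ^ p := fun x => by
    rw [← Real.rpow_mul (hg0 x), mul_div_cancel₀ _ hs.ne']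
  have h := rpow_integral_le (P := P) (g := fun x => g x ^ s) (q := p / s)
    (fun x => Real.rpow_nonneg (hg0 x) s) ((one_le_div hs).2 hsp) hgs (by simpa only [hcomp])
  simp only [hcomp] at h
  have h0 : 0 ≤ ∫ x, g x ^ s ∂P := integral_nonneg fun x => Real.rpow_nonneg (hg0 x) s
  calc ∫ x, g x ^ s ∂P = ((∫ x, g x ^ s ∂P) ^ (p / s)) ^ (s / p) := by
        rw [← Real.rpow_mul h0, div_mul_div_cancel₀ hs.ne', div_self hp.ne', Real.rpow_one]
    _ ≤ _ := Real.rpow_le_rpow (Real.rpow_nonneg h0 _) h (by positivity)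

theorem norm_pw_sub_le_of_dist {p : ℝ} (hp : 2 ≤ p) (v w : Vec N) :
    ‖pw (p - 1) v - pw (p - 1) w‖
      ≤ p * 4 ^ p * (‖v‖ ^ (p - 2) * ‖w - v‖ + ‖w - v‖ ^ (p - 1)) := by
  have h := pw_sub_upper (by linarith : 1 ≤ p - 1) v w
  rw [show 1 + (p - 1) = p by ring, show p - 1 - 1 = p - 2 by ring, norm_sub_rev v w] at h
  set d := ‖w - v‖ with hd
  have hd0 : 0 ≤ d := norm_nonneg _
  have hw : ‖v‖ + ‖w‖ ≤ 2 * ‖v‖ + d := by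
    have := norm_le_norm_add_norm_sub' w v
    linarith
  have h1 : (‖v‖ + ‖w‖) ^ (p - 2) ≤ 4 ^ p * (‖v‖ ^ (p - 2) + d ^ (p - 2)) := by
    calc (‖v‖ + ‖w‖) ^ (p - 2) ≤ (2 * ‖v‖ + 2 * d) ^ (p - 2) :=
          Real.rpow_le_rpow (by positivity) (by linarith) (by linarith)
      _ ≤ 2 ^ (p - 2) * ((2 * ‖v‖) ^ (p - 2) + (2 * d) ^ (p - 2)) :=
          add_rpow_le_two_rpow_mul (by positivity) (by positivity) (by linarith)
      _ = 4 ^ (p - 2) * (‖v‖ ^ (p - 2) + d ^ (p - 2)) := by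
          rw [Real.mul_rpow zero_le_two (norm_nonneg v), Real.mul_rpow zero_le_two hd0,
            ← mul_add, ← mul_assoc, ← Real.mul_rpow zero_le_two zero_le_two]
          norm_num
      _ ≤ _ := by
          gcongr
          · norm_num
          · linarith
  have h2 : d ^ (p - 2) * d = d ^ (p - 1) := by
    rcases eq_or_lt_of_le hd0 with h0 | h0
    · rw [← h0, mul_zero, Real.zero_rpow (by linarith)]
    · rw [← Real.rpow_add_one h0.ne']; ring_nf
  calc _ ≤ p * (‖v‖ + ‖w‖) ^ (p - 2) * d := h
    _ ≤ p * (4 ^ p * (‖v‖ ^ (p - 2) + d ^ (p - 2))) * d := by gcongr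
    _ = _ := by rw [← h2]; ring

theorem norm_pw_sub_integral_le {α : Type*} [MeasurableSpace α] {P : Measure α}
    [IsProbabilityMeasure P] {p C : ℝ} (hp : 2 ≤ p) {f : α → Vec N}
    (hf : MemLp f (ENNReal.ofReal p) P) {ψ : α → ℝ} (hψm : AEStronglyMeasurable ψ P)
    (hψ0 : ∀ x, 0 ≤ ψ x) (hψC : ∀ x, ψ x ≤ C) (hψ1 : ∫ x, ψ x ∂P = 1) (v : Vec N) :
    ‖pw (p - 1) v - ∫ x, ψ x • pw (p - 1) (f x) ∂P‖
      ≤ C * (p * 4 ^ p) * (‖v‖ ^ (p - 2) * (∫ x, ‖f x - v‖ ^ p ∂P) ^ (1 / p)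
        + (∫ x, ‖f x - v‖ ^ p ∂P) ^ ((p - 1) / p)) := by
  have hp0 : 0 < p := by linarith
  have hfm : AEMeasurable f P := hf.1.aemeasurable
  have hd : MemLp (fun x => f x - v) (ENNReal.ofReal p) P := hf.sub (memLp_const v)
  have hdp := MemLp.integrable_norm_rpow_of_le hp0 hd hp0.le le_rfl
  have hd1 := MemLp.integrable_norm_rpow_of_le (s := 1) hp0 hd zero_le_one (by linarith)
  have hdq := MemLp.integrable_norm_rpow_of_le (s := p - 1) hp0 hd (by linarith) (by linarith)
  have hψn : ∀ x, ‖ψ x‖ ≤ C := fun x => by rw [Real.norm_of_nonneg (hψ0 x)]; exact hψC x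
  have hψi : Integrable ψ P := Integrable.of_bound hψm C (Eventually.of_forall hψn)
  have hpwi : Integrable (fun x => pw (p - 1) (f x)) P := by
    refine (MemLp.integrable_norm_rpow_of_le (s := p - 1) hp0 hf (by linarith)
      (by linarith)).mono' ((measurable_pw _).comp_aemeasurable hfm).aestronglyMeasurable
      (Eventually.of_forall fun x => (norm_pw (by linarith) _).le)
  have hi2 : Integrable (fun x => ψ x • pw (p - 1) (f x)) P :=
    hpwi.bdd_smul C hψm (Eventually.of_forall hψn)
  have hC0 : 0 ≤ C := by
    have hne : Nonempty α := P.nonempty_of_neZero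
    exact (hψ0 hne.some).trans (hψC _)
  have heq : pw (p - 1) v - ∫ x, ψ x • pw (p - 1) (f x) ∂P
      = ∫ x, ψ x • (pw (p - 1) v - pw (p - 1) (f x)) ∂P := by
    simp only [smul_sub]
    rw [integral_sub (hψi.smul_const _) hi2, integral_smul_const, hψ1, one_smul]
  rw [heq]
  have hbd : Integrable (fun x => C * (p * 4 ^ p
      * (‖v‖ ^ (p - 2) * ‖f x - v‖ ^ (1 : ℝ) + ‖f x - v‖ ^ (p - 1)))) P :=
    (((hd1.const_mul _).add hdq).const_mul _).const_mul _
  calc _ ≤ ∫ x, C * (p * 4 ^ p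
      * (‖v‖ ^ (p - 2) * ‖f x - v‖ ^ (1 : ℝ) + ‖f x - v‖ ^ (p - 1))) ∂P := by
        refine norm_integral_le_of_norm_le hbd (Eventually.of_forall fun x => ?_)
        rw [norm_smul, Real.rpow_one]
        exact mul_le_mul (hψn x) (norm_pw_sub_le_of_dist hp v (f x)) (norm_nonneg _) hC0
    _ = C * (p * 4 ^ p) * (‖v‖ ^ (p - 2) * ∫ x, ‖f x - v‖ ^ (1 : ℝ) ∂P
        + ∫ x, ‖f x - v‖ ^ (p - 1) ∂P) := by
        rw [integral_const_mul, integral_const_mul, integral_add (hd1.const_mul _) hdq,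
          integral_const_mul]
        ring
    _ ≤ _ := by
        have e1 := integral_rpow_le_rpow_integral (P := P) (fun x => norm_nonneg (f x - v))
          zero_lt_one (by linarith : 1 ≤ p) hd1 hdp
        have e2 := integral_rpow_le_rpow_integral (P := P) (fun x => norm_nonneg (f x - v))
          (by linarith : 0 < p - 1) (by linarith : p - 1 ≤ p) hdq hdp
        gcongr

theorem le_mul_of_rpow_mul_le {p C θ m R X w : ℝ} (hp : 2 ≤ p) (hθ : 0 < θ)
    (hm : 0 ≤ m) (hw : 0 ≤ w) (hR : 0 ≤ R) (hC : 0 ≤ C) (hXw : w ≤ X) (hX : θ * m ≤ X)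
    (h : X ^ (p - 2) * w ≤ C * (m ^ (p - 2) * R)) : w ≤ C * (θ ^ (p - 2))⁻¹ * R := by
  have hX0 : 0 ≤ X := hw.trans hXw
  rcases eq_or_lt_of_le (Real.rpow_nonneg hm (p - 2)) with h0 | h0
  · rw [← h0, zero_mul, mul_zero] at h
    rcases eq_or_lt_of_le hw with hw0 | hw0
    · rw [← hw0]; positivity
    · exact absurd h (not_le.2 (mul_pos (Real.rpow_pos_of_pos (hw0.trans_le hXw) _) hw0))
  · have h1 : θ ^ (p - 2) * m ^ (p - 2) ≤ X ^ (p - 2) := by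
      rw [← Real.mul_rpow hθ.le hm]
      exact Real.rpow_le_rpow (by positivity) hX (by linarith)
    have hθp : 0 < θ ^ (p - 2) := Real.rpow_pos_of_pos hθ _
    have h2 : m ^ (p - 2) * (θ ^ (p - 2) * w) ≤ m ^ (p - 2) * (C * R) := by
      calc _ = θ ^ (p - 2) * m ^ (p - 2) * w := by ring
        _ ≤ X ^ (p - 2) * w := by gcongr
        _ ≤ C * (m ^ (p - 2) * R) := h
        _ = _ := by ring
    have h3 := le_of_mul_le_mul_left h2 h0
    calc w = (θ ^ (p - 2))⁻¹ * (θ ^ (p - 2) * w) := by rw [inv_mul_cancel_left₀ hθp.ne']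
      _ ≤ (θ ^ (p - 2))⁻¹ * (C * R) := by gcongr
      _ = _ := by ring

theorem norm_sub_le_of_rpow_mul_le {p C θ m R e : ℝ} (hp : 2 ≤ p) (hθ : 0 < θ)
    (hm : 0 ≤ m) (hR : 0 ≤ R) (hC : 1 ≤ C) (he : 0 ≤ e) (v b : Vec N)
    (h : (‖v‖ + ‖b‖) ^ (p - 2) * ‖v - b‖
      ≤ C * (‖v‖ ^ (p - 2) * e + e ^ (p - 1) + m ^ (p - 2) * R)) :
    ‖v - b‖ ≤ 4 * C * e + 2 * C * (θ ^ (p - 2))⁻¹ * R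
      + (if θ * m ≤ ‖b‖ then 0 else θ * m) := by
  set w := ‖v - b‖ with hw
  set s := ‖v‖ + ‖b‖ with hs
  have hw0 : 0 ≤ w := norm_nonneg _
  have hws : w ≤ s := norm_sub_le v b
  have hs0 : 0 ≤ s := hw0.trans hws
  have hτ : 0 ≤ (if θ * m ≤ ‖b‖ then 0 else θ * m) := by split_ifs <;> positivity
  have hK : 0 ≤ 2 * C * (θ ^ (p - 2))⁻¹ * R := by positivity
  rcases le_or_gt w (4 * C * e) with h1 | h1
  · linarith
  have hes : e ≤ s := by nlinarith
  have h2 : ‖v‖ ^ (p - 2) * e + e ^ (p - 1) ≤ 2 * (s ^ (p - 2) * e) := by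
    have a1 : ‖v‖ ^ (p - 2) ≤ s ^ (p - 2) := Real.rpow_le_rpow (norm_nonneg _)
      (le_add_of_nonneg_right (norm_nonneg _)) (by linarith)
    have a2 : e ^ (p - 1) ≤ s ^ (p - 2) * e := by
      rcases eq_or_lt_of_le he with h0 | h0
      · rw [← h0, mul_zero, Real.zero_rpow (by linarith)]
      · rw [show p - 1 = p - 2 + 1 by ring, Real.rpow_add_one h0.ne']
        gcongr
    nlinarith [mul_le_mul_of_nonneg_right a1 he]
  have hsp : 0 ≤ s ^ (p - 2) := Real.rpow_nonneg hs0 _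
  have h3 : s ^ (p - 2) * w ≤ 2 * C * (m ^ (p - 2) * R) := by
    have b1 : C * (‖v‖ ^ (p - 2) * e + e ^ (p - 1)) ≤ C * (2 * (s ^ (p - 2) * e)) := by gcongr
    have b2 : s ^ (p - 2) * (4 * C * e) ≤ s ^ (p - 2) * w := by gcongr
    nlinarith
  split_ifs with hb
  · have := le_mul_of_rpow_mul_le hp hθ hm hw0 hR (by linarith : 0 ≤ 2 * C) hws
      (hb.trans (le_add_of_nonneg_left (norm_nonneg _))) h3
    have : 0 ≤ 4 * C * e := by positivity
    linarith
  · rcases le_or_gt (θ * m) w with hmw | hmw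
    · have h4 : w ^ (p - 2) * w ≤ 2 * C * (m ^ (p - 2) * R) := by
        refine le_trans ?_ h3
        gcongr
      have := le_mul_of_rpow_mul_le hp hθ hm hw0 hR (by linarith : 0 ≤ 2 * C) le_rfl hmw h4
      have : 0 ≤ 4 * C * e := by positivity
      have : 0 ≤ θ * m := by positivity
      linarith
    · have : 0 ≤ 4 * C * e := by positivity
      linarith

theorem integral_norm_rpow_le {α : Type*} [MeasurableSpace α] {P : Measure α}
    [IsProbabilityMeasure P] {p : ℝ} (hp : 0 < p) {f : α → Vec N}
    (hf : MemLp f (ENNReal.ofReal p) P) (b : Vec N) :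
    ∫ x, ‖f x‖ ^ p ∂P ≤ 2 ^ p * (∫ x, ‖f x - b‖ ^ p ∂P + ‖b‖ ^ p) := by
  have hd : MemLp (fun x => f x - b) (ENNReal.ofReal p) P := hf.sub (memLp_const b)
  have hdp := MemLp.integrable_norm_rpow_of_le hp hd hp.le le_rfl
  calc ∫ x, ‖f x‖ ^ p ∂P ≤ ∫ x, 2 ^ p * (‖f x - b‖ ^ p + ‖b‖ ^ p) ∂P := by
        refine integral_mono_of_nonneg (Eventually.of_forall fun x => by positivity)
          ((hdp.add (integrable_const _)).const_mul _) (Eventually.of_forall fun x => ?_)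
        refine le_trans (Real.rpow_le_rpow (norm_nonneg _) ?_ hp.le)
          (add_rpow_le_two_rpow_mul (norm_nonneg (f x - b)) (norm_nonneg b) hp.le)
        simpa using norm_add_le (f x - b) b
    _ = _ := by
        rw [integral_const_mul, integral_add hdp (integrable_const _)]; simp

theorem integral_norm_sub_integral_rpow_le {α : Type*} [MeasurableSpace α] {P : Measure α}
    [IsProbabilityMeasure P] {p : ℝ} (hp : 1 ≤ p) {f : α → Vec N}
    (hf : MemLp f (ENNReal.ofReal p) P) (b : Vec N) :
    ∫ x, ‖f x - ∫ y, f y ∂P‖ ^ p ∂P ≤ 2 ^ p * 2 * ∫ x, ‖f x - b‖ ^ p ∂P := by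
  have hp0 : 0 < p := by linarith
  have hd : MemLp (fun x => f x - b) (ENNReal.ofReal p) P := hf.sub (memLp_const b)
  have hdp := MemLp.integrable_norm_rpow_of_le hp0 hd hp0.le le_rfl
  have hfi : Integrable f P := hf.integrable (by simpa using hp)
  have hdi : Integrable (fun x => f x - b) P := hfi.sub (integrable_const b)
  have h1 : ‖b - ∫ y, f y ∂P‖ ^ p ≤ ∫ x, ‖f x - b‖ ^ p ∂P := by
    have h2 : ‖b - ∫ y, f y ∂P‖ ≤ ∫ x, ‖f x - b‖ ∂P := by
      rw [norm_sub_rev]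
      have : (∫ y, f y ∂P) - b = ∫ x, (f x - b) ∂P := by
        rw [integral_sub hfi (integrable_const b)]; simp
      rw [this]
      exact norm_integral_le_integral_norm _
    exact (Real.rpow_le_rpow (norm_nonneg _) h2 hp0.le).trans
      (rpow_integral_le (fun x => norm_nonneg _) hp hdi.norm hdp)
  calc ∫ x, ‖f x - ∫ y, f y ∂P‖ ^ p ∂P
      ≤ ∫ x, 2 ^ p * (‖f x - b‖ ^ p + ‖b - ∫ y, f y ∂P‖ ^ p) ∂P := by
        refine integral_mono_of_nonneg (Eventually.of_forall fun x => by positivity)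
          ((hdp.add (integrable_const _)).const_mul _) (Eventually.of_forall fun x => ?_)
        refine le_trans (Real.rpow_le_rpow (norm_nonneg _)
          (norm_sub_le_norm_sub_add_norm_sub _ b _) hp0.le) ?_
        exact add_rpow_le_two_rpow_mul (norm_nonneg _) (norm_nonneg _) hp0.le
    _ = 2 ^ p * (∫ x, ‖f x - b‖ ^ p ∂P + ‖b - ∫ y, f y ∂P‖ ^ p) := by
        rw [integral_const_mul, integral_add hdp (integrable_const _)]; simp
    _ ≤ 2 ^ p * (∫ x, ‖f x - b‖ ^ p ∂P + ∫ x, ‖f x - b‖ ^ p ∂P) := by gcongr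
    _ = _ := by ring

theorem integral_norm_sub_rpow_le_of_ae {α : Type*} [MeasurableSpace α] {P : Measure α}
    [IsProbabilityMeasure P] {p C M R : ℝ} (hp : 2 ≤ p) (hC : 1 ≤ C) (hM : 0 ≤ M) (hR : 0 ≤ R)
    {f : α → Vec N} (hf : MemLp f (ENNReal.ofReal p) P) (hMf : ∫ x, ‖f x‖ ^ p ∂P = M ^ p)
    {e : α → ℝ} (he : ∀ x, 0 ≤ e x) (hei : Integrable (fun x => e x ^ p) P) (b : Vec N)
    (h : ∀ᵐ x ∂P, (‖f x‖ + ‖b‖) ^ (p - 2) * ‖f x - b‖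
      ≤ C * (‖f x‖ ^ (p - 2) * e x + e x ^ (p - 1) + (M + R) ^ (p - 2) * R)) :
    ∫ x, ‖f x - b‖ ^ p ∂P
      ≤ (2 * 3 ^ p * ((4 * C) ^ p + (2 * C * ((1 / 24 : ℝ) ^ (p - 2))⁻¹) ^ p) + 1)
        * (∫ x, e x ^ p ∂P + R ^ p) := by
  have hp0 : 0 < p := by linarith
  set θ : ℝ := 1 / 24 with hθ
  have hθ0 : 0 < θ := by norm_num
  set m := M + R with hm
  have hm0 : 0 ≤ m := by positivity
  set β := 2 * C * (θ ^ (p - 2))⁻¹ with hβ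
  have hβ0 : 0 ≤ β := by positivity
  set τ := if θ * m ≤ ‖b‖ then 0 else θ * m with hτ
  have hτ0 : 0 ≤ τ := by rw [hτ]; split_ifs <;> positivity
  have hd : MemLp (fun x => f x - b) (ENNReal.ofReal p) P := hf.sub (memLp_const b)
  have hdp := MemLp.integrable_norm_rpow_of_le hp0 hd hp0.le le_rfl
  set W := ∫ x, ‖f x - b‖ ^ p ∂P with hW
  set E := ∫ x, e x ^ p ∂P with hE
  have hW0 : 0 ≤ W := integral_nonneg fun x => by positivity
  have hE0 : 0 ≤ E := integral_nonneg fun x => Real.rpow_nonneg (he x) p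
  have hRp : 0 ≤ R ^ p := Real.rpow_nonneg hR p
  have h1 : W ≤ 3 ^ p * ((4 * C) ^ p * E + (β * R) ^ p + τ ^ p) := by
    calc W ≤ ∫ x, 3 ^ p * ((4 * C) ^ p * e x ^ p + (β * R) ^ p + τ ^ p) ∂P := by
          refine integral_mono_ae hdp ((((hei.const_mul _).add (integrable_const _)).add
            (integrable_const _)).const_mul _) ?_
          filter_upwards [h] with x hx
          have h2 := norm_sub_le_of_rpow_mul_le hp hθ0 hm0 hR hC (he x) (f x) b hx
          refine (Real.rpow_le_rpow (norm_nonneg _) h2 hp0.le).trans ?_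
          have hex := he x
          rw [← Real.mul_rpow (by positivity) hex]
          exact add_add_rpow_le_three_rpow_mul (by positivity) (by positivity) hτ0 hp0.le
      _ = _ := by
          have hi : Integrable (fun x => (4 * C) ^ p * e x ^ p + (β * R) ^ p) P :=
            (hei.const_mul _).add (integrable_const _)
          rw [integral_const_mul, integral_add hi (integrable_const _),
            integral_add (hei.const_mul _) (integrable_const _), integral_const_mul]
          simp [← hE]
  rw [Real.mul_rpow hβ0 hR] at h1
  have hαp : 0 ≤ (4 * C) ^ p := by positivity
  have hβp : 0 ≤ β ^ p := by positivity
  have h3p : 0 ≤ (3 : ℝ) ^ p := by positivity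
  have hτp : 3 ^ p * τ ^ p ≤ (W + R ^ p) / 2 := by
    by_cases hb : θ * m ≤ ‖b‖
    · rw [hτ, if_pos hb, Real.zero_rpow hp0.ne']
      linarith
    · have hb' : ‖b‖ ≤ θ * m := (not_le.1 hb).le
      rw [hτ, if_neg hb]
      have hMW : M ^ p ≤ 2 ^ p * (W + ‖b‖ ^ p) := by
        rw [← hMf]
        exact integral_norm_rpow_le hp0 hf b
      have hmp : m ^ p ≤ 2 ^ p * (M ^ p + R ^ p) := add_rpow_le_two_rpow_mul hM hR hp0.le
      have h24 : (2 : ℝ) ^ p * 2 ^ p = 4 ^ p := by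
        rw [← Real.mul_rpow zero_le_two zero_le_two]; norm_num
      have hbm : 4 ^ p * ‖b‖ ^ p ≤ (1 / 2) * m ^ p := by
        calc 4 ^ p * ‖b‖ ^ p ≤ 4 ^ p * (θ * m) ^ p := by gcongr
          _ = (4 * θ) ^ p * m ^ p := by
            rw [Real.mul_rpow hθ0.le hm0, Real.mul_rpow (by norm_num) hθ0.le]; ring
          _ ≤ (1 / 2) * m ^ p := by
            gcongr
            calc (4 * θ) ^ p ≤ (4 * θ) ^ (1 : ℝ) :=
                  Real.rpow_le_rpow_of_exponent_ge (by norm_num [hθ]) (by norm_num [hθ])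
                    (by linarith)
              _ ≤ 1 / 2 := by rw [Real.rpow_one]; norm_num [hθ]
      have h2p : (1 : ℝ) ≤ 2 ^ p := Real.one_le_rpow one_le_two hp0.le
      have hm4 : m ^ p ≤ 2 * (4 ^ p * (W + R ^ p)) := by
        have c1 : 2 ^ p * M ^ p ≤ 4 ^ p * W + 4 ^ p * ‖b‖ ^ p := by
          rw [← h24]
          nlinarith [mul_le_mul_of_nonneg_left hMW (by positivity : (0 : ℝ) ≤ 2 ^ p)]
        have c2 : 2 ^ p * R ^ p ≤ 4 ^ p * R ^ p := by
          rw [← h24]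
          nlinarith [mul_nonneg (by linarith : (0 : ℝ) ≤ 2 ^ p) hRp,
            mul_le_mul_of_nonneg_right h2p (mul_nonneg (by linarith : (0 : ℝ) ≤ 2 ^ p) hRp)]
        linarith
      calc 3 ^ p * (θ * m) ^ p = (3 * θ) ^ p * m ^ p := by
            rw [Real.mul_rpow hθ0.le hm0, Real.mul_rpow (by norm_num) hθ0.le]; ring
        _ ≤ (3 * θ) ^ p * (2 * (4 ^ p * (W + R ^ p))) := by gcongr
        _ = (3 * θ * 4) ^ p * 2 * (W + R ^ p) := by
            rw [Real.mul_rpow (x := 3 * θ) (y := 4) (by positivity) (by norm_num)]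
            generalize (3 * θ) ^ p = k
            ring
        _ ≤ (1 / 4) * 2 * (W + R ^ p) := by
            gcongr
            calc (3 * θ * 4) ^ p ≤ (3 * θ * 4) ^ (2 : ℝ) :=
                  Real.rpow_le_rpow_of_exponent_ge (by norm_num [hθ]) (by norm_num [hθ])
                    (by linarith)
              _ ≤ 1 / 4 := by norm_num [hθ]
        _ = _ := by ring
  have h5 : 0 ≤ 3 ^ p * (4 * C) ^ p := by positivity
  have h6 : 0 ≤ 3 ^ p * β ^ p := by positivity
  nlinarith [mul_nonneg h5 hRp, mul_nonneg h6 hE0]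

/-- Spatial mean oscillation of order `p` of `u(·, t)` around the value `u(x, t)`. -/
def sliceOsc (p : ℝ) (u : Spc n × ℝ → Vec N) (x₀ : Spc n) (r : ℝ) (z : Spc n × ℝ) : ℝ :=
  ∫ x, ‖u (x, z.2) - u z‖ ^ p ∂(ballProb x₀ r)

theorem sliceOsc_nonneg (p : ℝ) (u : Spc n × ℝ → Vec N) (x₀ : Spc n) (r : ℝ) (z : Spc n × ℝ) :
    0 ≤ sliceOsc p u x₀ r z :=
  integral_nonneg fun x => by positivity

theorem measurable_sliceOsc {p : ℝ} {u : Spc n × ℝ → Vec N} (hu : Measurable u) (x₀ : Spc n)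
    {r : ℝ} (hr : 0 < r) : Measurable (sliceOsc p u x₀ r) := by
  have := isProbabilityMeasure_ballProb x₀ hr
  have h : Measurable fun w : (Spc n × ℝ) × Spc n => ‖u (w.2, w.1.2) - u w.1‖ ^ p := by
    have h1 : Measurable fun w : (Spc n × ℝ) × Spc n => u (w.2, w.1.2) := hu.comp (by fun_prop)
    have h2 : Measurable fun w : (Spc n × ℝ) × Spc n => u w.1 := hu.comp (by fun_prop)
    exact (h1.sub h2).norm.pow_const p
  exact (h.stronglyMeasurable.integral_prod_right' (ν := ballProb x₀ r)).measurable

theorem ae_timeProb_mem (t₁ t₂ : ℝ) : ∀ᵐ t ∂(timeProb t₁ t₂), t ∈ Ioo t₁ t₂ :=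
  Measure.ae_smul_measure (ae_restrict_mem measurableSet_Ioo) _

theorem ae_cylProb_of_ae_timeProb (x₀ : Spc n) {r t₁ t₂ : ℝ} (hr : 0 < r) (ht : t₁ < t₂)
    {s : ℝ → Prop} (hs : ∀ᵐ t ∂(timeProb t₁ t₂), s t) : ∀ᵐ z ∂(cylProb x₀ r t₁ t₂), s z.2 := by
  have := isProbabilityMeasure_ballProb x₀ hr
  have := isProbabilityMeasure_timeProb ht
  exact (Measure.quasiMeasurePreserving_snd (μ := ballProb x₀ r)).ae hs

section

variable {p ν L T : ℝ} {Ω : Set (Spc n)} {A : Spc n × ℝ → Vec N → Mat N n → Mat N n}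
  {F : Spc n × ℝ → Mat N n} {u : Spc n × ℝ → Vec N} {Du : Spc n × ℝ → Mat N n}

theorem WeakSolution.memLp_slice (hu : WeakSolution p ν L T Ω A F u Du) {x₀ : Spc n}
    {r t₁ t₂ : ℝ} (hr : 0 < r) (hQ : Metric.ball x₀ r ×ˢ Ioo t₁ t₂ ⊆ Ω ×ˢ Ioo 0 T) {t : ℝ}
    (ht : t ∈ Ioo t₁ t₂) : MemLp (fun x => u (x, t)) (ENNReal.ofReal p) (ballProb x₀ r) := by
  have h0 : t ∈ Ioo 0 T := (hQ (mk_mem_prod (Metric.mem_ball_self hr) ht)).2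
  have hB : Metric.ball x₀ r ⊆ Ω := fun x hx => (hQ (mk_mem_prod hx ht)).1
  exact ((hu.sliceLp t ⟨h0.1.le, h0.2.le⟩).mono_measure
    (Measure.restrict_mono hB le_rfl)).smul_measure
    (ENNReal.inv_ne_top.2 (Metric.measure_ball_pos _ _ hr).ne')

theorem WeakSolution.ofReal_sliceOsc (hu : WeakSolution p ν L T Ω A F u Du) (hp : 0 < p)
    {x₀ : Spc n} {r t₁ t₂ : ℝ} (hr : 0 < r)
    (hQ : Metric.ball x₀ r ×ˢ Ioo t₁ t₂ ⊆ Ω ×ˢ Ioo 0 T) {z : Spc n × ℝ} (hz : z.2 ∈ Ioo t₁ t₂) :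
    ENNReal.ofReal (sliceOsc p u x₀ r z)
      = (volume (Metric.ball x₀ r))⁻¹ * ∫⁻ y in Metric.ball x₀ r, ‖u z - u (y, z.2)‖ₑ ^ p := by
  have := isProbabilityMeasure_ballProb x₀ hr
  have hd := (hu.memLp_slice hr hQ hz).sub (memLp_const (u z))
  have h := lintegral_enorm_rpow_eq_ofReal hp.le
    (MemLp.integrable_norm_rpow_of_le hp hd hp.le le_rfl)
  simp only [Pi.sub_apply, lintegral_ballProb] at h
  rw [sliceOsc, ← h]
  simp only [enorm_sub_rev]

end

theorem WeakSolution.exists_integral_sliceOsc_le (m : ℕ) (hm : 2 ≤ m) {p q : ℝ}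
    (hp2 : 2 ≤ p) (hq : 1 ≤ q) (hqp : q ≤ p) (hβ : (p - q) / 2 ≤ 1 / (m : ℝ) * q) :
    ∃ C : ℝ, 0 < C ∧ ∀ {n N : ℕ}, n ≤ m → ∀ {ν L T : ℝ} {Ω : Set (Spc n)}
      {A : Spc n × ℝ → Vec N → Mat N n → Mat N n} {F : Spc n × ℝ → Mat N n}
      {u : Spc n × ℝ → Vec N} {Du : Spc n × ℝ → Mat N n}, WeakSolution p ν L T Ω A F u Du →
      ∀ (x₀ : Spc n) {r t₁ t₂ Y : ℝ} (a : Vec N), 0 < r → t₁ < t₂ → 0 ≤ Y →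
      Metric.ball x₀ r ×ˢ Ioo t₁ t₂ ⊆ Ω ×ˢ Ioo 0 T →
      (∀ s ∈ Ioo t₁ t₂, ∫ x, ‖u (x, s) - a‖ ^ (2 : ℝ) ∂(ballProb x₀ r) ≤ Y) →
      Integrable (sliceOsc p u x₀ r) (cylProb x₀ r t₁ t₂) ∧
        ∫ z, sliceOsc p u x₀ r z ∂(cylProb x₀ r t₁ t₂)
          ≤ C * r ^ q * Y ^ ((p - q) / 2) * ∫ z, ‖Du z‖ ^ q ∂(cylProb x₀ r t₁ t₂) := by
  obtain ⟨C, hC, h⟩ := WeakSolution.exists_lintegral_osc_le m hm hq hqp hβ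
  refine ⟨C, hC, ?_⟩
  intro n N hnm ν L T Ω A F u Du hu x₀ r t₁ t₂ Y a hr ht hY hQ hYs
  have hPb := isProbabilityMeasure_ballProb x₀ hr
  have hPt := isProbabilityMeasure_timeProb ht
  have hPc := isProbabilityMeasure_cylProb x₀ hr ht
  have hp0 : 0 < p := by linarith
  set B := Metric.ball x₀ r with hB
  have hB0 : volume B ≠ 0 := (Metric.measure_ball_pos _ _ hr).ne'
  have hBt : volume B ≠ ∞ := measure_ball_lt_top.ne
  have hI0 : volume (Ioo t₁ t₂) ≠ 0 := by simpa using ht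
  have hIt : volume (Ioo t₁ t₂) ≠ ∞ := by simp
  have hY2 : ∀ s ∈ Ioo t₁ t₂, ∫⁻ x in B, ‖u (x, s) - a‖ₑ ^ (2 : ℝ)
      ≤ volume B * ENNReal.ofReal Y := fun s hs => by
    have hd := (hu.memLp_slice hr hQ hs).sub (memLp_const a)
    have h1 := lintegral_enorm_rpow_eq_ofReal zero_le_two
      (MemLp.integrable_norm_rpow_of_le hp0 hd zero_le_two hp2)
    simp only [Pi.sub_apply, lintegral_ballProb] at h1
    rw [← ENNReal.inv_mul_le_iff hB0 hBt, h1]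
    exact ENNReal.ofReal_le_ofReal (hYs s hs)
  have h1 := h hnm hu x₀ a hr hY hQ hY2
  set c := C * r ^ q * Y ^ ((p - q) / 2) with hc
  have hc0 : 0 ≤ c := by positivity
  have hmeas := measurable_sliceOsc (p := p) hu.measu x₀ hr
  have hDu := MemLp.integrable_norm_rpow_of_le hp0 (memLp_cylProb hu.memLp_Du x₀ hr ht hQ)
    (by linarith : 0 ≤ q) hqp
  have h2 : ∫⁻ z, ENNReal.ofReal (sliceOsc p u x₀ r z) ∂(cylProb x₀ r t₁ t₂)
      ≤ ENNReal.ofReal (c * ∫ z, ‖Du z‖ ^ q ∂(cylProb x₀ r t₁ t₂)) := by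
    rw [ENNReal.ofReal_mul hc0, ← lintegral_enorm_rpow_eq_ofReal (by linarith) hDu]
    nth_rewrite 1 [cylProb]
    rw [lintegral_prod_symm _ hmeas.ennreal_ofReal.aemeasurable]
    calc _ = ∫⁻ t, (volume B)⁻¹ * ((volume B)⁻¹ * ∫⁻ x in B, ∫⁻ y in B,
            ‖u (x, t) - u (y, t)‖ₑ ^ p) ∂(timeProb t₁ t₂) := by
          refine lintegral_congr_ae ?_
          filter_upwards [ae_timeProb_mem t₁ t₂] with t hts
          rw [← lintegral_const_mul' _ _ (ENNReal.inv_ne_top.2 hB0), ← lintegral_ballProb]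
          exact lintegral_congr fun x => hu.ofReal_sliceOsc hp0 hr hQ (z := (x, t)) hts
      _ = (volume (Ioo t₁ t₂))⁻¹ * ((volume B)⁻¹ * ((volume B)⁻¹ * ∫⁻ t in Ioo t₁ t₂,
            ∫⁻ x in B, ∫⁻ y in B, ‖u (x, t) - u (y, t)‖ₑ ^ p)) := by
          rw [lintegral_const_mul' _ _ (ENNReal.inv_ne_top.2 hB0),
            lintegral_const_mul' _ _ (ENNReal.inv_ne_top.2 hB0), timeProb,
            lintegral_smul_measure, smul_eq_mul]
          ring
      _ ≤ (volume (Ioo t₁ t₂))⁻¹ * ((volume B)⁻¹ * ((volume B)⁻¹ * (ENNReal.ofReal c * volume B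
            * ∫⁻ z in B ×ˢ Ioo t₁ t₂, ‖Du z‖ₑ ^ q))) := by gcongr
      _ = (volume (Ioo t₁ t₂))⁻¹ * ((volume B)⁻¹ * ((volume B)⁻¹ * volume B * (ENNReal.ofReal c
            * ∫⁻ z in B ×ˢ Ioo t₁ t₂, ‖Du z‖ₑ ^ q))) := by ring
      _ = _ := by
          rw [ENNReal.inv_mul_cancel hB0 hBt, one_mul, cylProb_eq_smul x₀ hr ht,
            lintegral_smul_measure, smul_eq_mul, Measure.volume_eq_prod, Measure.prod_prod,
            ENNReal.mul_inv (Or.inl hB0) (Or.inr hI0)]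
          ring
  have hint : Integrable (sliceOsc p u x₀ r) (cylProb x₀ r t₁ t₂) := by
    refine ⟨hmeas.aestronglyMeasurable, ?_⟩
    rw [hasFiniteIntegral_iff_ofReal (Eventually.of_forall fun z => sliceOsc_nonneg _ _ _ _ _)]
    exact h2.trans_lt ENNReal.ofReal_lt_top
  refine ⟨hint, ?_⟩
  rw [← ofReal_integral_eq_lintegral_ofReal hint
    (Eventually.of_forall fun z => sliceOsc_nonneg _ _ _ _ _)] at h2
  exact (ENNReal.ofReal_le_ofReal_iff
    (mul_nonneg hc0 (integral_nonneg fun z => by positivity))).1 h2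

set_option maxHeartbeats 800000 in
theorem WeakSolution.exists_integral_norm_sub_integral_le (n : ℕ) {p q L Λ : ℝ} (hp : 2 ≤ p)
    (hqp' : p - 1 ≤ q) (hqp : q ≤ p) (hβ : (p - q) / 2 ≤ 1 / ((max n 2 : ℕ) : ℝ) * q)
    (hΛ : 0 ≤ Λ) :
    ∃ C : ℝ, 0 < C ∧ ∀ {N : ℕ} {ν T : ℝ} {Ω : Set (Spc n)}
      {A : Spc n × ℝ → Vec N → Mat N n → Mat N n} {F : Spc n × ℝ → Mat N n}
      {u : Spc n × ℝ → Vec N} {Du : Spc n × ℝ → Mat N n}, WeakSolution p ν L T Ω A F u Du →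
      ∀ (x₀ : Spc n) {r t₁ t₂ Y M G : ℝ} (a : Vec N), 0 < r → t₁ < t₂ → 0 ≤ Y → 0 ≤ M → 0 ≤ G →
      Metric.ball x₀ r ×ˢ Ioo t₁ t₂ ⊆ Ω ×ˢ Ioo 0 T →
      (∀ s ∈ Ioo t₁ t₂, ∫ x, ‖u (x, s) - a‖ ^ (2 : ℝ) ∂(ballProb x₀ r) ≤ Y) →
      ∫ z, ‖u z‖ ^ p ∂(cylProb x₀ r t₁ t₂) = M ^ p →
      ∫ z, (‖Du z‖ ^ q + ‖F z‖ ^ q) ∂(cylProb x₀ r t₁ t₂) = G ^ q →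
      (t₂ - t₁) * G ^ (p - 1) ≤ Λ * r * ((M + r * G) ^ (p - 2) * (r * G)) →
      ∫ z, ‖u z - ∫ w, u w ∂(cylProb x₀ r t₁ t₂)‖ ^ p ∂(cylProb x₀ r t₁ t₂)
        ≤ C * (r ^ q * Y ^ ((p - q) / 2) * G ^ q + (r * G) ^ p) := by
  have hp0 : 0 < p := by linarith
  have hq1 : 1 ≤ q := by linarith
  obtain ⟨C₁, hC₁, hosc⟩ := WeakSolution.exists_integral_sliceOsc_le (max n 2)
    (le_max_right _ _) hp hq1 hqp hβ
  obtain ⟨C₂, hC₂, hcut⟩ := exists_ball_cutoff n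
  set C₃ : ℝ := 2 ^ (p - 1) * (C₂ * (p * 4 ^ p) + n * C₂ * (|L| + 1) * 2 * Λ) + 1 with hC₃
  have hC₃1 : 1 ≤ C₃ := by
    have : 0 ≤ 2 ^ (p - 1) * (C₂ * (p * 4 ^ p) + n * C₂ * (|L| + 1) * 2 * Λ) := by positivity
    linarith
  set C₄ : ℝ := 2 * 3 ^ p * ((4 * C₃) ^ p + (2 * C₃ * ((1 / 24 : ℝ) ^ (p - 2))⁻¹) ^ p) + 1 with hC₄
  have hC₄0 : 0 < C₄ := by positivity
  refine ⟨2 ^ p * 2 * C₄ * (C₁ + 1), by positivity, ?_⟩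
  intro N ν T Ω A F u Du hu x₀ r t₁ t₂ Y M G a hr ht hY hM hG hQ hYs hMu hGq hΛG
  have hPb := isProbabilityMeasure_ballProb x₀ hr
  have hPt := isProbabilityMeasure_timeProb ht
  have hPc := isProbabilityMeasure_cylProb x₀ hr ht
  have hL : 0 < L := hu.hν.trans_le hu.hνL
  obtain ⟨hoi, hoE⟩ := hosc (le_max_left _ _) hu x₀ a hr ht hY hQ hYs
  obtain ⟨ψ, hψ, hψs, hψ0, hψC, hψ1, hψD⟩ := hcut x₀ hr
  obtain ⟨V, hV⟩ := hu.exists_ae_norm_sub_le hp hr ht hQ hψ hψs hψD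
  set P := cylProb x₀ r t₁ t₂ with hP
  have hDuL := memLp_cylProb hu.memLp_Du x₀ hr ht hQ
  have hFL := memLp_cylProb hu.memLp_F x₀ hr ht hQ
  have huL := memLp_cylProb hu.memLp_u x₀ hr ht hQ
  have hDuq := MemLp.integrable_norm_rpow_of_le hp0 hDuL (by linarith : 0 ≤ q) hqp
  have hFq := MemLp.integrable_norm_rpow_of_le hp0 hFL (by linarith : 0 ≤ q) hqp
  have hDu1 := MemLp.integrable_norm_rpow_of_le hp0 hDuL (by linarith : 0 ≤ p - 1) (by linarith)
  have hF1 := MemLp.integrable_norm_rpow_of_le hp0 hFL (by linarith : 0 ≤ p - 1) (by linarith)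
  rw [integral_add hDuq hFq] at hGq
  have hD0 : 0 ≤ ∫ z, ‖Du z‖ ^ q ∂P := integral_nonneg fun z => by positivity
  have hF0 : 0 ≤ ∫ z, ‖F z‖ ^ q ∂P := integral_nonneg fun z => by positivity
  have hGpow : (G ^ q) ^ ((p - 1) / q) = G ^ (p - 1) := by
    rw [← Real.rpow_mul hG, mul_div_cancel₀ _ (by linarith : q ≠ 0)]
  have hp1 : 0 < p - 1 := by linarith
  have hsum : ∫ z, (‖Du z‖ ^ (p - 1) + ‖F z‖ ^ (p - 1)) ∂P ≤ 2 * G ^ (p - 1) := by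
    rw [integral_add hDu1 hF1]
    have e1 := integral_rpow_le_rpow_integral (P := P) (fun z => norm_nonneg (Du z)) hp1 hqp'
      hDu1 hDuq
    have e2 := integral_rpow_le_rpow_integral (P := P) (fun z => norm_nonneg (F z)) hp1 hqp'
      hF1 hFq
    have e3 : (∫ z, ‖Du z‖ ^ q ∂P) ^ ((p - 1) / q) ≤ G ^ (p - 1) := by
      rw [← hGpow]; exact Real.rpow_le_rpow hD0 (by linarith) (by positivity)
    have e4 : (∫ z, ‖F z‖ ^ q ∂P) ^ ((p - 1) / q) ≤ G ^ (p - 1) := by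
      rw [← hGpow]; exact Real.rpow_le_rpow hF0 (by linarith) (by positivity)
    linarith
  set R := r * G with hR
  have hR0 : 0 ≤ R := by positivity
  have hglue : n * (C₂ / r) * (L + 1) * (t₂ - t₁) * ∫ z, (‖Du z‖ ^ (p - 1) + ‖F z‖ ^ (p - 1)) ∂P
      ≤ n * C₂ * (|L| + 1) * 2 * Λ * ((M + R) ^ (p - 2) * R) := by
    have ht' : 0 ≤ t₂ - t₁ := by linarith
    calc _ ≤ n * (C₂ / r) * (L + 1) * (t₂ - t₁) * (2 * G ^ (p - 1)) := by gcongr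
      _ = n * (C₂ / r) * (L + 1) * 2 * ((t₂ - t₁) * G ^ (p - 1)) := by ring
      _ ≤ n * (C₂ / r) * (L + 1) * 2 * (Λ * r * ((M + R) ^ (p - 2) * R)) := by gcongr
      _ = _ := by rw [abs_of_pos hL]; field_simp
  set b : Vec N := pw (p - 1)⁻¹ V with hb
  have hbV : pw (p - 1) b = V := pw_pw_inv hp1 V
  have he0 : ∀ z, 0 ≤ sliceOsc p u x₀ r z ^ (1 / p) := fun z =>
    Real.rpow_nonneg (sliceOsc_nonneg _ _ _ _ _) _
  have hep : ∀ z, (sliceOsc p u x₀ r z ^ (1 / p)) ^ p = sliceOsc p u x₀ r z := fun z => by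
    rw [← Real.rpow_mul (sliceOsc_nonneg _ _ _ _ _), one_div_mul_cancel hp0.ne', Real.rpow_one]
  have hep1 : ∀ z, (sliceOsc p u x₀ r z ^ (1 / p)) ^ (p - 1)
      = sliceOsc p u x₀ r z ^ ((p - 1) / p) := fun z => by
    rw [← Real.rpow_mul (sliceOsc_nonneg _ _ _ _ _), one_div_mul_eq_div]
  have hae : ∀ᵐ z ∂P, (‖u z‖ + ‖b‖) ^ (p - 2) * ‖u z - b‖
      ≤ C₃ * (‖u z‖ ^ (p - 2) * sliceOsc p u x₀ r z ^ (1 / p)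
        + (sliceOsc p u x₀ r z ^ (1 / p)) ^ (p - 1) + (M + R) ^ (p - 2) * R) := by
    filter_upwards [ae_cylProb_of_ae_timeProb x₀ hr ht hV,
      ae_cylProb_of_ae_timeProb x₀ hr ht (ae_timeProb_mem t₁ t₂)] with z hz hzt
    have h1 := pw_sub_lower (by linarith : 1 ≤ p - 1) (u z) b
    rw [hbV, show p - 1 - 1 = p - 2 by ring] at h1
    have h2 := norm_pw_sub_integral_le hp (hu.memLp_slice hr hQ hzt)
      hψ.continuous.aestronglyMeasurable hψ0 hψC hψ1 (u z)
    have h3 := norm_sub_le_norm_sub_add_norm_sub (pw (p - 1) (u z))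
      (∫ x, ψ x • pw (p - 1) (u (x, z.2)) ∂(ballProb x₀ r)) V
    rw [hep1]
    change _ ≤ C₂ * (p * 4 ^ p) * (‖u z‖ ^ (p - 2) * sliceOsc p u x₀ r z ^ (1 / p)
      + sliceOsc p u x₀ r z ^ ((p - 1) / p)) at h2
    set S₁ := ‖u z‖ ^ (p - 2) * sliceOsc p u x₀ r z ^ (1 / p)
      + sliceOsc p u x₀ r z ^ ((p - 1) / p) with hS₁
    have hS₁0 : 0 ≤ S₁ := by
      have := sliceOsc_nonneg p u x₀ r z
      positivity
    have hS₂0 : 0 ≤ (M + R) ^ (p - 2) * R := by positivity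
    set S₂ := (M + R) ^ (p - 2) * R with hS₂
    set k₁ := C₂ * (p * 4 ^ p) with hk₁
    set k₂ := n * C₂ * (|L| + 1) * 2 * Λ with hk₂
    have hk₁0 : 0 ≤ k₁ := by positivity
    have hk₂0 : 0 ≤ k₂ := by positivity
    calc _ ≤ 2 ^ (p - 1) * ‖pw (p - 1) (u z) - V‖ := h1
      _ ≤ 2 ^ (p - 1) * (k₁ * S₁ + k₂ * S₂) := by
          gcongr
          linarith [hz.trans hglue]
      _ ≤ 2 ^ (p - 1) * ((k₁ + k₂) * (S₁ + S₂)) := by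
          gcongr
          nlinarith [mul_nonneg hk₁0 hS₂0, mul_nonneg hk₂0 hS₁0]
      _ ≤ C₃ * (S₁ + S₂) := by
          rw [hC₃, ← mul_assoc, add_mul _ (1 : ℝ)]
          linarith
  have hfin := integral_norm_sub_rpow_le_of_ae hp hC₃1 hM hR0 huL hMu he0 (by simpa only [hep])
    b hae
  simp only [hep] at hfin
  have hRp : 0 ≤ R ^ p := by positivity
  set Z := r ^ q * Y ^ ((p - q) / 2) * G ^ q with hZ
  have hZ0 : 0 ≤ Z := by positivity
  have hE : ∫ z, sliceOsc p u x₀ r z ∂P ≤ C₁ * Z := by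
    refine hoE.trans ?_
    calc _ ≤ C₁ * r ^ q * Y ^ ((p - q) / 2) * G ^ q := by gcongr; linarith
      _ = _ := by rw [hZ]; ring
  calc _ ≤ 2 ^ p * 2 * ∫ z, ‖u z - b‖ ^ p ∂P :=
        integral_norm_sub_integral_rpow_le (by linarith) huL b
    _ ≤ 2 ^ p * 2 * (C₄ * (C₁ * Z + R ^ p)) := by
        gcongr
        exact hfin.trans (by gcongr)
    _ ≤ 2 ^ p * 2 * (C₄ * ((C₁ + 1) * (Z + R ^ p))) := by
        gcongr
        nlinarith [mul_nonneg hC₁.le hRp]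
    _ = _ := by ring

theorem norm_pw_sub_sq_le {p : ℝ} (hp : 0 < p) (v a : Vec N) :
    ‖pw (p / 2) v - pw (p / 2) a‖ ^ 2 ≤ 2 * (‖v‖ ^ p + ‖a‖ ^ p) := by
  have h := norm_sub_le (pw (p / 2) v) (pw (p / 2) a)
  have h2 : ∀ w : Vec N, ‖w‖ ^ p = (‖w‖ ^ (p / 2)) ^ 2 := fun w => by
    rw [← Real.rpow_two, ← Real.rpow_mul (norm_nonneg w), div_mul_cancel₀ _ two_ne_zero]
  rw [norm_pw (by positivity), norm_pw (by positivity)] at h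
  rw [h2, h2]
  nlinarith [norm_nonneg (pw (p / 2) v - pw (p / 2) a), sq_nonneg (‖v‖ ^ (p / 2) - ‖a‖ ^ (p / 2)),
    pow_le_pow_left₀ (norm_nonneg _) h 2]

theorem rpow_mul_norm_sub_sq_le {p : ℝ} (hp : 2 ≤ p) (v a : Vec N) :
    (‖v‖ + ‖a‖) ^ (p - 2) * ‖v - a‖ ^ (2 : ℝ) ≤ 2 ^ p * ‖pw (p / 2) v - pw (p / 2) a‖ ^ 2 := by
  have h := pow_le_pow_left₀ (by positivity) (pw_sub_lower (by linarith : 1 ≤ p / 2) v a) 2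
  rw [mul_pow, mul_pow, ← Real.rpow_two, ← Real.rpow_two, ← Real.rpow_two,
    ← Real.rpow_mul (by positivity), ← Real.rpow_mul (by positivity)] at h
  rw [show (p / 2 - 1) * 2 = p - 2 by ring, show p / 2 * 2 = p by ring] at h
  simpa only [Real.rpow_two] using h

section

variable {α : Type*} [MeasurableSpace α] {P : Measure α} [IsProbabilityMeasure P] {p : ℝ}
  {f : α → Vec N}

theorem MemLp.integrable_norm_pw_sub_sq (hp : 2 ≤ p) (hf : MemLp f (ENNReal.ofReal p) P)
    (a : Vec N) : Integrable (fun x => ‖pw (p / 2) (f x) - pw (p / 2) a‖ ^ 2) P := by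
  have hp0 : 0 < p := by linarith
  have hfp := MemLp.integrable_norm_rpow_of_le hp0 hf hp0.le le_rfl
  refine ((hfp.add (integrable_const (‖a‖ ^ p))).const_mul 2).mono' ?_
    (Eventually.of_forall fun x => ?_)
  · exact ((((measurable_pw (p / 2)).comp_aemeasurable hf.1.aemeasurable).sub_const _).norm.pow_const
      2).aestronglyMeasurable
  · rw [Real.norm_of_nonneg (by positivity)]
    exact norm_pw_sub_sq_le hp0 _ _

theorem rpow_mul_integral_norm_sub_sq_le (hp : 2 ≤ p) (hf : MemLp f (ENNReal.ofReal p) P)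
    (a : Vec N) : ‖a‖ ^ (p - 2) * ∫ x, ‖f x - a‖ ^ (2 : ℝ) ∂P
      ≤ 2 ^ p * ∫ x, ‖pw (p / 2) (f x) - pw (p / 2) a‖ ^ 2 ∂P := by
  rw [← integral_const_mul, ← integral_const_mul]
  refine integral_mono_of_nonneg (Eventually.of_forall fun x => by positivity)
    ((MemLp.integrable_norm_pw_sub_sq hp hf a).const_mul _) (Eventually.of_forall fun x => ?_)
  refine le_trans ?_ (rpow_mul_norm_sub_sq_le hp (f x) a)
  have : 0 ≤ p - 2 := by linarith
  dsimp only
  gcongr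
  simp

theorem integral_norm_sub_rpow_le_integral_norm_pw_sub_sq (hp : 2 ≤ p)
    (hf : MemLp f (ENNReal.ofReal p) P) (a : Vec N) : ∫ x, ‖f x - a‖ ^ p ∂P
      ≤ 2 ^ p * ∫ x, ‖pw (p / 2) (f x) - pw (p / 2) a‖ ^ 2 ∂P := by
  rw [← integral_const_mul]
  refine integral_mono_of_nonneg (Eventually.of_forall fun x => by positivity)
    ((MemLp.integrable_norm_pw_sub_sq hp hf a).const_mul _) (Eventually.of_forall fun x => ?_)
  refine le_trans ?_ (rpow_mul_norm_sub_sq_le hp (f x) a)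
  have h0 : 0 ≤ p - 2 := by linarith
  dsimp only
  calc ‖f x - a‖ ^ p = ‖f x - a‖ ^ (p - 2) * ‖f x - a‖ ^ (2 : ℝ) := by
        rw [← Real.rpow_add_of_nonneg (norm_nonneg _) h0 zero_le_two]; ring_nf
    _ ≤ _ := by
        gcongr
        exact norm_sub_le _ _

end

theorem le_biSup_of_forall_le {I : Set ℝ} {f : ℝ → ℝ} {C : ℝ} (hC : ∀ t ∈ I, f t ≤ C) {t : ℝ}
    (ht : t ∈ I) : f t ≤ ⨆ s ∈ I, f s := by
  have hb : BddAbove (range fun s => ⨆ _ : s ∈ I, f s) := by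
    refine ⟨max C 0, ?_⟩
    rintro _ ⟨s, rfl⟩
    by_cases hs : s ∈ I
    · simpa [hs] using Or.inl (hC s hs)
    · simp [hs]
  exact le_ciSup_of_le hb t (by simp [ht])

section

variable {p ν L T : ℝ} {Ω : Set (Spc n)} {A : Spc n × ℝ → Vec N → Mat N n → Mat N n}
  {F : Spc n × ℝ → Mat N n} {u : Spc n × ℝ → Vec N} {Du : Spc n × ℝ → Mat N n}

theorem WeakSolution.exists_slice_integral_le (hu : WeakSolution p ν L T Ω A F u Du) (hp : 0 < p) :
    ∃ C, ∀ t ∈ Icc (0 : ℝ) T, ∫ x in Ω, ‖u (x, t)‖ ^ p ≤ C := by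
  have hfin : IsFiniteMeasure (volume.restrict Ω) :=
    ⟨by simpa using hu.bddΩ.measure_lt_top⟩
  suffices h : ∃ C, ∀ t ∈ Icc (0 : ℝ) T, t ∈ Icc (0 : ℝ) T → ∫ x in Ω, ‖u (x, t)‖ ^ p ≤ C by
    obtain ⟨C, hC⟩ := h
    exact ⟨C, fun t ht => hC t ht ht⟩
  refine isCompact_Icc.induction_on
    (p := fun s => ∃ C, ∀ t ∈ s, t ∈ Icc (0 : ℝ) T → ∫ x in Ω, ‖u (x, t)‖ ^ p ≤ C) ?_ ?_ ?_ ?_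
  · exact ⟨0, by simp⟩
  · rintro s t hst ⟨C, hC⟩
    exact ⟨C, fun x hx => hC x (hst hx)⟩
  · rintro s t ⟨C, hC⟩ ⟨C', hC'⟩
    refine ⟨max C C', fun x hx hxI => ?_⟩
    rcases hx with hx | hx
    · exact (hC x hx hxI).trans (le_max_left _ _)
    · exact (hC' x hx hxI).trans (le_max_right _ _)
  · intro t₀ ht₀
    refine ⟨{t | ∫ x in Ω, ‖u (x, t) - u (x, t₀)‖ ^ p < 1},
      (hu.timeCont t₀ ht₀).eventually (gt_mem_nhds zero_lt_one),
      2 ^ p * (1 + ∫ x in Ω, ‖u (x, t₀)‖ ^ p), fun t ht htI => ?_⟩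
    have h1 := MemLp.integrable_norm_rpow_of_le hp
      ((hu.sliceLp t htI).sub (hu.sliceLp t₀ ht₀)) hp.le le_rfl
    have h2 := MemLp.integrable_norm_rpow_of_le hp (hu.sliceLp t₀ ht₀) hp.le le_rfl
    calc ∫ x in Ω, ‖u (x, t)‖ ^ p
        ≤ ∫ x in Ω, 2 ^ p * (‖u (x, t) - u (x, t₀)‖ ^ p + ‖u (x, t₀)‖ ^ p) := by
          refine integral_mono_of_nonneg (Eventually.of_forall fun x => by positivity)
            ((h1.add h2).const_mul _) (Eventually.of_forall fun x => ?_)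
          refine le_trans (Real.rpow_le_rpow (norm_nonneg _) ?_ hp.le)
            (add_rpow_le_two_rpow_mul (norm_nonneg (u (x, t) - u (x, t₀)))
              (norm_nonneg (u (x, t₀))) hp.le)
          simpa using norm_add_le (u (x, t) - u (x, t₀)) (u (x, t₀))
      _ = 2 ^ p * ((∫ x in Ω, ‖u (x, t) - u (x, t₀)‖ ^ p) + ∫ x in Ω, ‖u (x, t₀)‖ ^ p) := by
          rw [integral_const_mul]
          congr 1
          exact integral_add h1 h2
      _ ≤ _ := by
          have : ∫ x in Ω, ‖u (x, t) - u (x, t₀)‖ ^ p ≤ 1 := le_of_lt ht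
          gcongr

theorem setAverage_ball_eq_integral_ballProb (x₀ : Spc n) (r : ℝ) (f : Spc n → ℝ) :
    ⨍ x in Metric.ball x₀ r, f x = ∫ x, f x ∂(ballProb x₀ r) := by
  rw [ballProb, average, Measure.restrict_apply_univ]

theorem WeakSolution.slice_integral_le_biSup (hu : WeakSolution p ν L T Ω A F u Du) (hp : 2 ≤ p)
    {x₀ : Spc n} {r t₁ t₂ κ : ℝ} (hr : 0 < r) (hκ : 0 < κ)
    (hQ : Metric.ball x₀ r ×ˢ Ioo t₁ t₂ ⊆ Ω ×ˢ Ioo 0 T) (a : Vec N) {t : ℝ} (ht : t ∈ Ioo t₁ t₂) :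
    ∫ x, ‖pw (p / 2) (u (x, t)) - pw (p / 2) a‖ ^ 2 ∂(ballProb x₀ r)
      ≤ κ * ⨆ s ∈ Ioo t₁ t₂, ⨍ x in Metric.ball x₀ r,
        ‖pw (p / 2) (u (x, s)) - pw (p / 2) a‖ ^ 2 / κ := by
  have hPb := isProbabilityMeasure_ballProb x₀ hr
  have hp0 : 0 < p := by linarith
  obtain ⟨C, hC⟩ := hu.exists_slice_integral_le hp0
  simp only [setAverage_ball_eq_integral_ballProb, integral_div]
  rw [← div_le_iff₀' hκ]
  refine le_biSup_of_forall_le (f := fun s => (∫ x, ‖pw (p / 2) (u (x, s)) - pw (p / 2) a‖ ^ 2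
    ∂(ballProb x₀ r)) / κ) (C := 2 * ((volume.real (Metric.ball x₀ r))⁻¹ * C + ‖a‖ ^ p) / κ)
    (fun s hs => ?_) ht
  have hs0 : s ∈ Ioo 0 T := (hQ (mk_mem_prod (Metric.mem_ball_self hr) hs)).2
  have hB : Metric.ball x₀ r ⊆ Ω := fun x hx => (hQ (mk_mem_prod hx hs)).1
  have hfin : IsFiniteMeasure (volume.restrict Ω) :=
    ⟨by simpa using hu.bddΩ.measure_lt_top⟩
  have hsI : s ∈ Icc 0 T := ⟨hs0.1.le, hs0.2.le⟩
  have hslice := hu.memLp_slice hr hQ hs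
  have h1 := MemLp.integrable_norm_rpow_of_le hp0 hslice hp0.le le_rfl
  have h2 : ∫ x, ‖u (x, s)‖ ^ p ∂(ballProb x₀ r) ≤ (volume.real (Metric.ball x₀ r))⁻¹ * C := by
    rw [ballProb, integral_smul_measure, ENNReal.toReal_inv, smul_eq_mul]
    refine mul_le_mul_of_nonneg_left ?_ (by positivity)
    exact (setIntegral_mono_set (MemLp.integrable_norm_rpow_of_le hp0 (hu.sliceLp s hsI) hp0.le
      le_rfl) (Eventually.of_forall fun x => by positivity) hB.eventuallyLE).trans (hC s hsI)
  gcongr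
  calc _ ≤ ∫ x, 2 * (‖u (x, s)‖ ^ p + ‖a‖ ^ p) ∂(ballProb x₀ r) :=
        integral_mono (MemLp.integrable_norm_pw_sub_sq hp hslice a)
          ((h1.add (integrable_const _)).const_mul _) fun x => norm_pw_sub_sq_le hp0 _ _
    _ = 2 * (∫ x, ‖u (x, s)‖ ^ p ∂(ballProb x₀ r) + ‖a‖ ^ p) := by
        rw [integral_const_mul, integral_add h1 (integrable_const _)]; simp
    _ ≤ _ := by gcongr

end

theorem rpow_mul_le_of_le_mul_add {p k M R m A X T y : ℝ} (hp : 2 ≤ p) (hk : 0 ≤ k) (hM : 0 ≤ M)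
    (hR : 0 ≤ R) (hm : 0 ≤ m) (hA : 0 ≤ A) (hX : 0 ≤ X) (hy : 0 ≤ y) (hmk : m ≤ k * (M + R))
    (hMX : M ^ p ≤ 2 ^ p * (X + A ^ p)) (hRX : R ^ p ≤ X) (hXT : X ≤ T)
    (hAy : A ^ (p - 2) * y ≤ T) (hyT : y ^ (p / 2) ≤ T) :
    m ^ (p - 2) * y ≤ (5 * k) ^ (p - 2) * T := by
  have hp0 : 0 < p := by linarith
  have hT : 0 ≤ T := hX.trans hXT
  have hp2 : 0 ≤ p - 2 := by linarith
  set x := X ^ (1 / p) with hx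
  have hx0 : 0 ≤ x := by positivity
  have hxp : x ^ p = X := by
    rw [hx, ← Real.rpow_mul hX, one_div_mul_cancel hp0.ne', Real.rpow_one]
  have hRx : R ≤ x := by
    rw [← Real.rpow_le_rpow_iff hR hx0 hp0, hxp]; exact hRX
  have hmax : ∀ w, 0 ≤ w → x ≤ w → A ≤ w → M ≤ 4 * w := fun w hw hxw hAw => by
    rw [← Real.rpow_le_rpow_iff hM (by positivity) hp0]
    have h2p : (2 : ℝ) ≤ 2 ^ p := by
      simpa using Real.rpow_le_rpow_of_exponent_le one_le_two (by linarith : (1 : ℝ) ≤ p)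
    calc M ^ p ≤ 2 ^ p * (x ^ p + A ^ p) := by rw [hxp]; exact hMX
      _ ≤ 2 ^ p * (w ^ p + w ^ p) := by gcongr
      _ = 2 ^ p * (2 * w ^ p) := by ring
      _ ≤ 2 ^ p * (2 ^ p * w ^ p) := by gcongr
      _ = (4 * w) ^ p := by
        rw [← Real.mul_rpow zero_le_two hw, ← Real.mul_rpow zero_le_two (by positivity)]
        ring_nf
  have key : ∀ w, 0 ≤ w → x ≤ w → A ≤ w → w ^ (p - 2) * y ≤ T →
      m ^ (p - 2) * y ≤ (5 * k) ^ (p - 2) * T := fun w hw hxw hAw hwT => by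
    have h1 : m ≤ 5 * k * w := hmk.trans (by
      have := mul_le_mul_of_nonneg_left (by linarith [hmax w hw hxw hAw] : M + R ≤ 5 * w) hk
      linarith)
    calc m ^ (p - 2) * y ≤ (5 * k * w) ^ (p - 2) * y := by gcongr
      _ = (5 * k) ^ (p - 2) * (w ^ (p - 2) * y) := by
        rw [Real.mul_rpow (by positivity) hw]; ring
      _ ≤ _ := by gcongr
  rcases le_total x A with h | h
  · exact key A hA h le_rfl hAy
  · refine key x hx0 le_rfl h ?_
    rcases eq_or_lt_of_le hT with hT0 | hT0
    · have hy0 : y = 0 := by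
        have : y ^ (p / 2) = 0 := le_antisymm (by linarith) (by positivity)
        exact (Real.rpow_eq_zero hy (by positivity)).1 this
      rw [hy0, mul_zero]; exact hT
    · have hyT' : y ≤ T ^ (2 / p) := by
        calc y = (y ^ (p / 2)) ^ (2 / p) := by
              rw [← Real.rpow_mul hy, div_mul_div_cancel₀ two_ne_zero, div_self hp0.ne',
                Real.rpow_one]
          _ ≤ _ := by gcongr
      calc x ^ (p - 2) * y ≤ (T ^ (1 / p)) ^ (p - 2) * T ^ (2 / p) := by
            gcongr
            exact Real.rpow_le_rpow hX hXT (by positivity)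
      _ = T := by
        rw [← Real.rpow_mul hT, ← Real.rpow_add hT0]
        convert Real.rpow_one T using 2
        field_simp
        ring

theorem div_le_of_le_rpow_mul {p q C C' r G S ε X : ℝ} (hq : p - 2 < q) (hqp : q ≤ p)
    (hC : 0 < C) (hC' : 0 < C') (hr : 0 < r) (hG : 0 < G) (hS : 0 ≤ S) (hε : 0 < ε) (hε1 : ε ≤ 1)
    (hX : X ≤ C * (r ^ q * (C' * r ^ (2 : ℝ) * S * G ^ (2 - p)) ^ ((p - q) / 2) * G ^ q
      + (r * G) ^ p)) :
    X / r ^ p ≤ ε * S + (C + (C * C' ^ ((p - q) / 2)) ^ (2 / (2 + q - p)))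
      / ε ^ ((p - q) / (2 + q - p)) * G ^ p := by
  set β := (p - q) / 2 with hβ
  have hβ0 : 0 ≤ β := by rw [hβ]; linarith
  have hβ1 : 0 < 1 - β := by rw [hβ]; linarith
  have hd : 2 + q - p = 2 * (1 - β) := by rw [hβ]; ring
  have hd' : (p - q) / (2 + q - p) = β / (1 - β) := by
    rw [hd, hβ]; field_simp
  have hd'' : 2 / (2 + q - p) = 1 / (1 - β) := by rw [hd]; field_simp
  rw [hd', hd'']
  set g := G ^ p with hg
  have hg0 : 0 ≤ g := by positivity
  set D := C * C' ^ β with hD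
  have hD0 : 0 < D := by positivity
  set δ := ε ^ (β / (1 - β)) with hδ
  have hδ0 : 0 < δ := by positivity
  have hδ1 : δ ≤ 1 := Real.rpow_le_one hε.le hε1 (by positivity)
  have e1 : r ^ q * (C' * r ^ (2 : ℝ) * S * G ^ (2 - p)) ^ β * G ^ q
      = r ^ p * (C' ^ β * (S ^ β * g ^ (1 - β))) := by
    have e2 : r ^ q * (r ^ (2 : ℝ)) ^ β = r ^ p := by
      rw [← Real.rpow_mul hr.le, ← Real.rpow_add hr]; congr 1; rw [hβ]; ring
    have e3 : (G ^ (2 - p)) ^ β * G ^ q = g ^ (1 - β) := by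
      rw [hg, ← Real.rpow_mul hG.le, ← Real.rpow_add hG, ← Real.rpow_mul hG.le]
      congr 1; rw [hβ]; ring
    rw [Real.mul_rpow (by positivity) (by positivity), Real.mul_rpow (by positivity) hS,
      Real.mul_rpow hC'.le (by positivity), ← e2, ← e3]
    ring
  have e4 : D * (S ^ β * g ^ (1 - β)) ≤ ε * S + D ^ (1 / (1 - β)) / δ * g := by
    have h1 := Real.geom_mean_le_arith_mean2_weighted hβ0 hβ1.le (by positivity : 0 ≤ ε * S)
      (by positivity : 0 ≤ D ^ (1 / (1 - β)) / δ * g) (by ring)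
    have h2 : (ε * S) ^ β * (D ^ (1 / (1 - β)) / δ * g) ^ (1 - β)
        = D * (S ^ β * g ^ (1 - β)) := by
      rw [Real.mul_rpow hε.le hS, Real.mul_rpow (by positivity) hg0,
        Real.div_rpow (by positivity) hδ0.le, ← Real.rpow_mul hD0.le, one_div_mul_cancel hβ1.ne',
        Real.rpow_one, hδ, ← Real.rpow_mul hε.le, div_mul_cancel₀ _ hβ1.ne']
      field_simp
    rw [h2] at h1
    refine h1.trans ?_
    have h3 : 0 ≤ ε * S := by positivity
    have h4 : 0 ≤ D ^ (1 / (1 - β)) / δ * g := by positivity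
    nlinarith [mul_nonneg hβ1.le h3, mul_nonneg hβ0 h4]
  have e5 : C * g ≤ C / δ * g := by
    gcongr
    exact le_div_self hC.le hδ0 hδ1
  rw [div_le_iff₀ (by positivity)]
  calc X ≤ C * (r ^ p * (C' ^ β * (S ^ β * g ^ (1 - β))) + r ^ p * g) := by
        rw [← e1, hg, ← Real.mul_rpow hr.le hG.le]; exact hX
    _ = (D * (S ^ β * g ^ (1 - β)) + C * g) * r ^ p := by rw [hD]; ring
    _ ≤ (ε * S + D ^ (1 / (1 - β)) / δ * g + C / δ * g) * r ^ p := by gcongr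
    _ = _ := by ring

section

variable {p ν L T : ℝ} {Ω : Set (Spc n)} {A : Spc n × ℝ → Vec N → Mat N n → Mat N n}
  {F : Spc n × ℝ → Mat N n} {u : Spc n × ℝ → Vec N} {Du : Spc n × ℝ → Mat N n}

theorem parCyl_eq_of_two_le {p : ℝ} (hp : 2 ≤ p) (μ ρ : ℝ) (z₀ : Spc n × ℝ) :
    parCyl p μ ρ z₀
      = Metric.ball z₀.1 (μ ^ ((2 - p) / p) * ρ) ×ˢ Ioo (z₀.2 - ρ ^ p) (z₀.2 + ρ ^ p) := by
  rw [parCyl, if_neg (not_lt.2 hp)]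

theorem rpow_mul_rpow_eq_radius_rpow {p μ ρ : ℝ} (hp : 0 < p) (hμ : 0 < μ) (hρ : 0 < ρ) :
    (μ ^ ((2 - p) / p) * ρ) ^ p = μ ^ (2 - p) * ρ ^ p := by
  rw [Real.mul_rpow (by positivity) hρ.le, ← Real.rpow_mul hμ.le, div_mul_cancel₀ _ hp.ne']

/-- The super-intrinsic coupling bounds the scaled gradient mean by the size of the solution. -/
theorem WeakSolution.mul_le_of_superIntrinsic (hu : WeakSolution p ν L T Ω A F u Du) (hp : 2 ≤ p)
    {q K μ ρ : ℝ} (hq : 1 ≤ q) (hqp : q ≤ p) (hK : 1 ≤ K) {z₀ : Spc n × ℝ} (hρ : 0 < ρ)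
    (hμ : 0 < μ) (hQ : parCyl p μ ρ z₀ ⊆ Ω ×ˢ Ioo 0 T) (hsup : SuperIntrinsic p K μ ρ z₀ u Du F)
    {r M G : ℝ} (hr : r = μ ^ ((2 - p) / p) * ρ) (hM : 0 ≤ M) (hG : 0 ≤ G)
    (hMu : ∫ z, ‖u z‖ ^ p ∂(cylProb z₀.1 r (z₀.2 - ρ ^ p) (z₀.2 + ρ ^ p)) = M ^ p)
    (hGq : ∫ z, (‖Du z‖ ^ q + ‖F z‖ ^ q) ∂(cylProb z₀.1 r (z₀.2 - ρ ^ p) (z₀.2 + ρ ^ p)) = G ^ q) :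
    μ * (r * G) ≤ 2 * K * (M + r * G) := by
  have hp0 : 0 < p := by linarith
  have hr0 : 0 < r := by rw [hr]; positivity
  have hρp : 0 < ρ ^ p := by positivity
  have ht : z₀.2 - ρ ^ p < z₀.2 + ρ ^ p := by linarith
  have hPc := isProbabilityMeasure_cylProb z₀.1 hr0 ht
  have hrp : r ^ p = μ ^ (2 - p) * ρ ^ p := by rw [hr, rpow_mul_rpow_eq_radius_rpow hp0 hμ hρ]
  have hKp : K ≤ K ^ p := by
    simpa using Real.rpow_le_rpow_of_exponent_le hK (by linarith : (1 : ℝ) ≤ p)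
  have hRG : 0 ≤ r * G := by positivity
  rw [SuperIntrinsic, parCyl_eq_of_two_le hp, max_eq_left hp, ← hrp, ← hr,
    setAverage_eq_integral_cylProb _ hr0 ht, setAverage_eq_integral_cylProb _ hr0 ht,
    integral_div, hMu] at hsup
  rw [parCyl_eq_of_two_le hp, ← hr] at hQ
  rcases hsup with hsup | hsup
  · have hDuL := memLp_cylProb hu.memLp_Du z₀.1 hr0 ht hQ
    have hFL := memLp_cylProb hu.memLp_F z₀.1 hr0 ht hQ
    have hq0 : 0 < q := by linarith
    have hDuq := MemLp.integrable_norm_rpow_of_le hp0 hDuL hq0.le hqp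
    have hFq := MemLp.integrable_norm_rpow_of_le hp0 hFL hq0.le hqp
    have hDup := MemLp.integrable_norm_rpow_of_le hp0 hDuL hp0.le le_rfl
    have hFp := MemLp.integrable_norm_rpow_of_le hp0 hFL hp0.le le_rfl
    set P := cylProb z₀.1 r (z₀.2 - ρ ^ p) (z₀.2 + ρ ^ p) with hP
    rw [integral_add hDup hFp] at hsup
    rw [integral_add hDuq hFq] at hGq
    have hD0 : 0 ≤ ∫ z, ‖Du z‖ ^ p ∂P := integral_nonneg fun z => by positivity
    have hF0 : 0 ≤ ∫ z, ‖F z‖ ^ p ∂P := integral_nonneg fun z => by positivity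
    set H := ∫ z, ‖Du z‖ ^ p ∂P + ∫ z, ‖F z‖ ^ p ∂P with hH
    have hH0 : 0 ≤ H := by positivity
    have e1 := integral_rpow_le_rpow_integral (P := P) (fun z => norm_nonneg (Du z)) hq0 hqp
      hDuq hDup
    have e2 := integral_rpow_le_rpow_integral (P := P) (fun z => norm_nonneg (F z)) hq0 hqp
      hFq hFp
    have e3 : (∫ z, ‖Du z‖ ^ p ∂P) ^ (q / p) ≤ H ^ (q / p) :=
      Real.rpow_le_rpow hD0 (by linarith) (by positivity)
    have e4 : (∫ z, ‖F z‖ ^ p ∂P) ^ (q / p) ≤ H ^ (q / p) :=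
      Real.rpow_le_rpow hF0 (by linarith) (by positivity)
    have h2q : (2 : ℝ) ≤ 2 ^ q := by
      simpa using Real.rpow_le_rpow_of_exponent_le one_le_two hq
    have e5 : G ≤ 2 * H ^ (1 / p) := by
      rw [← Real.rpow_le_rpow_iff hG (by positivity) hq0, Real.mul_rpow zero_le_two (by positivity),
        ← Real.rpow_mul hH0, one_div_mul_eq_div]
      nlinarith [Real.rpow_nonneg hH0 (q / p)]
    have e6 : (μ * (r * G)) ^ p ≤ (2 * K * M) ^ p := by
      have e7 : G ^ p ≤ 2 ^ p * H := by
        calc G ^ p ≤ (2 * H ^ (1 / p)) ^ p := by gcongr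
          _ = _ := by
            rw [Real.mul_rpow zero_le_two (by positivity), ← Real.rpow_mul hH0,
              one_div_mul_cancel hp0.ne', Real.rpow_one]
      calc (μ * (r * G)) ^ p = μ ^ p * (r ^ p * G ^ p) := by
            rw [Real.mul_rpow hμ.le hRG, Real.mul_rpow hr0.le hG]
        _ ≤ μ ^ p * (r ^ p * (2 ^ p * H)) := by gcongr
        _ = 2 ^ p * r ^ p * (μ ^ p * H) := by ring
        _ ≤ 2 ^ p * r ^ p * (K * (M ^ p / r ^ p)) := by gcongr
        _ = 2 ^ p * K * M ^ p := by field_simp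
        _ ≤ 2 ^ p * K ^ p * M ^ p := by gcongr
        _ = _ := by
          rw [Real.mul_rpow (by positivity) hM, Real.mul_rpow zero_le_two (by linarith)]
    have e8 := (Real.rpow_le_rpow_iff (by positivity) (by positivity) hp0).1 e6
    nlinarith [mul_nonneg (by linarith : 0 ≤ K) hRG]
  · have hμK : μ ≤ K :=
      (Real.rpow_le_rpow_iff hμ.le (by linarith) hp0).1 (hsup.trans hKp)
    nlinarith [mul_le_mul_of_nonneg_right hμK hRG, mul_nonneg (by linarith : 0 ≤ K) hM,
      mul_nonneg (by linarith : 0 ≤ K) hRG]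

theorem WeakSolution.integral_norm_sub_rpow_le_of_slices (hu : WeakSolution p ν L T Ω A F u Du)
    (hp : 2 ≤ p) {x₀ : Spc n} {r t₁ t₂ Z : ℝ} (hr : 0 < r) (ht : t₁ < t₂)
    (hQ : Metric.ball x₀ r ×ˢ Ioo t₁ t₂ ⊆ Ω ×ˢ Ioo 0 T) (a : Vec N)
    (hZ : ∀ t ∈ Ioo t₁ t₂, ∫ x, ‖u (x, t) - a‖ ^ p ∂(ballProb x₀ r) ≤ Z) :
    ∫ z, ‖u z - a‖ ^ p ∂(cylProb x₀ r t₁ t₂) ≤ Z := by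
  have hp0 : 0 < p := by linarith
  have hPb := isProbabilityMeasure_ballProb x₀ hr
  have hPt := isProbabilityMeasure_timeProb ht
  have hPc := isProbabilityMeasure_cylProb x₀ hr ht
  have hd : MemLp (fun z => u z - a) (ENNReal.ofReal p) (cylProb x₀ r t₁ t₂) :=
    (memLp_cylProb hu.memLp_u x₀ hr ht hQ).sub (memLp_const a)
  have hi := MemLp.integrable_norm_rpow_of_le hp0 hd hp0.le le_rfl
  rw [cylProb] at hi ⊢
  rw [integral_prod_symm _ hi]
  calc _ ≤ ∫ _, Z ∂(timeProb t₁ t₂) := by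
        refine integral_mono_of_nonneg
          (Eventually.of_forall fun t => integral_nonneg fun x => by positivity)
          (integrable_const _) ?_
        filter_upwards [ae_timeProb_mem t₁ t₂] with t hts
        exact hZ t hts
    _ = Z := by simp

end

set_option maxHeartbeats 1000000 in
/-- Sobolev–Poincaré inequality, superquadratic case: let `p ≥ 2` and `u` a weak solution. On
any cylinder `Q_ρ^{(μ)}(z₀) ⊆ Ω_T` which is both `μ`-sub-intrinsic and `μ`-super-intrinsic
with constant `K`, for any `ε ∈ (0, 1]`, with `q = max{np/(n+2), p−1}` and `c = c(n, p, L, K)`: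
`⨍⨍ |u − (u)|^p/(μ^{2−p}ρ^p)
  ≤ ε sup_t ⨍_{B_ρ^{(μ)}} |u^⟨p/2⟩(t) − ((u))^⟨p/2⟩|²/ρ^p
    + (c/ε^{(p−q)/(2+q−p)}) (⨍⨍ (|Du|^q + |F|^q))^{p/q}`. -/
theorem sobolev_poincare_superquadratic (n : ℕ) (p L K : ℝ) (hp : 2 ≤ p) (hK : 1 ≤ K) :
    ∃ c > 0, ∀ (N : ℕ) (ν T : ℝ) (Ω : Set (Spc n))
      (A : Spc n × ℝ → Vec N → Mat N n → Mat N n) (F : Spc n × ℝ → Mat N n)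
      (u : Spc n × ℝ → Vec N) (Du : Spc n × ℝ → Mat N n),
      WeakSolution p ν L T Ω A F u Du →
      ∀ (z₀ : Spc n × ℝ) (ρ μ : ℝ), 0 < ρ → 0 < μ →
        parCyl p μ ρ z₀ ⊆ Ω ×ˢ Ioo 0 T →
        SubIntrinsic p K μ ρ z₀ u Du F →
        SuperIntrinsic p K μ ρ z₀ u Du F →
        ∀ ε ∈ Ioc (0 : ℝ) 1,
          ⨍ z in parCyl p μ ρ z₀,
              ‖u z - ⨍ w in parCyl p μ ρ z₀, u w‖ ^ p / (μ ^ (2 - p) * ρ ^ p)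
            ≤ ε * (⨆ t ∈ Ioo (z₀.2 - ρ ^ p) (z₀.2 + ρ ^ p),
                    ⨍ x in Metric.ball z₀.1 (μ ^ ((2 - p) / p) * ρ),
                      ‖pw (p / 2) (u (x, t))
                          - pw (p / 2) (⨍ w in parCyl p μ ρ z₀, u w)‖ ^ 2 / ρ ^ p)
              + c / ε ^ ((p - max ((n : ℝ) * p / ((n : ℝ) + 2)) (p - 1))
                    / (2 + max ((n : ℝ) * p / ((n : ℝ) + 2)) (p - 1) - p))
                * (⨍ z in parCyl p μ ρ z₀,
                    (‖Du z‖ ^ (max ((n : ℝ) * p / ((n : ℝ) + 2)) (p - 1))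
                      + ‖F z‖ ^ (max ((n : ℝ) * p / ((n : ℝ) + 2)) (p - 1))))
                  ^ (p / max ((n : ℝ) * p / ((n : ℝ) + 2)) (p - 1)) := by
  have hp0 : 0 < p := by linarith
  set q := max ((n : ℝ) * p / ((n : ℝ) + 2)) (p - 1) with hq
  have hqp' : p - 1 ≤ q := le_max_right _ _
  have hqn : (n : ℝ) * p / ((n : ℝ) + 2) ≤ q := le_max_left _ _
  have hqp : q ≤ p := by
    refine max_le ?_ (by linarith)
    rw [div_le_iff₀ (by positivity)]
    nlinarith
  have hq1 : 1 ≤ q := by linarith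
  have hq0 : 0 < q := by linarith
  have hβ : (p - q) / 2 ≤ 1 / ((max n 2 : ℕ) : ℝ) * q := by
    rcases le_total n 2 with h | h
    · rw [max_eq_right h]
      push_cast
      linarith
    · rw [max_eq_left h]
      have hn0 : (0 : ℝ) < n := by exact_mod_cast (by omega : 0 < n)
      rw [div_le_iff₀ (by positivity)] at hqn
      rw [one_div_mul_eq_div, div_le_div_iff₀ two_pos hn0]
      linarith
  have hK0 : 0 < K := by linarith
  obtain ⟨C, hC, hmain⟩ := WeakSolution.exists_integral_norm_sub_integral_le n (p := p) (q := q)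
    (L := L) (Λ := 2 * (2 * K) ^ (p - 2)) hp hqp' hqp hβ (by positivity)
  set C' : ℝ := (5 * (2 * K)) ^ (p - 2) * 2 ^ p with hC'
  have hC'0 : 0 < C' := by positivity
  refine ⟨C + (C * C' ^ ((p - q) / 2)) ^ (2 / (2 + q - p)) + 1, by positivity, ?_⟩
  intro N ν T Ω A F u Du hu z₀ ρ μ hρ hμ hQ _ hsup ε hε
  have hrp := rpow_mul_rpow_eq_radius_rpow hp0 hμ hρ
  have hsup' := fun {M G : ℝ} => hu.mul_le_of_superIntrinsic (M := M) (G := G) hp hq1 hqp hK hρ hμ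
    hQ hsup rfl
  rw [parCyl_eq_of_two_le hp] at hQ ⊢
  have hr : 0 < μ ^ ((2 - p) / p) * ρ := by positivity
  set r := μ ^ ((2 - p) / p) * ρ with hr_def
  have hρp : 0 < ρ ^ p := by positivity
  have ht : z₀.2 - ρ ^ p < z₀.2 + ρ ^ p := by linarith
  set t₁ := z₀.2 - ρ ^ p with ht₁
  set t₂ := z₀.2 + ρ ^ p with ht₂
  have hPb := isProbabilityMeasure_ballProb z₀.1 hr
  have hPt := isProbabilityMeasure_timeProb ht
  have hPc := isProbabilityMeasure_cylProb z₀.1 hr ht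
  simp only [setAverage_eq_integral_cylProb z₀.1 hr ht]
  rw [← hrp, integral_div]
  have huL := memLp_cylProb hu.memLp_u z₀.1 hr ht hQ
  set P := cylProb z₀.1 r t₁ t₂ with hP
  set a := ∫ w, u w ∂P with ha
  set S := ⨆ t ∈ Ioo t₁ t₂, ⨍ x in Metric.ball z₀.1 r,
    ‖pw (p / 2) (u (x, t)) - pw (p / 2) a‖ ^ 2 / ρ ^ p with hS
  have hsl : ∀ t ∈ Ioo t₁ t₂,
      ∫ x, ‖pw (p / 2) (u (x, t)) - pw (p / 2) a‖ ^ 2 ∂(ballProb z₀.1 r) ≤ ρ ^ p * S :=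
    fun t hts => hu.slice_integral_le_biSup hp hr hρp hQ a hts
  have hS0 : 0 ≤ S := by
    have h1 := hsl z₀.2 ⟨by linarith, by linarith⟩
    have h2 : 0 ≤ ∫ x, ‖pw (p / 2) (u (x, z₀.2)) - pw (p / 2) a‖ ^ 2 ∂(ballProb z₀.1 r) :=
      integral_nonneg fun x => by positivity
    exact nonneg_of_mul_nonneg_right (h2.trans h1) hρp
  set Z := 2 ^ p * (ρ ^ p * S) with hZ
  have hZ0 : 0 ≤ Z := by positivity
  have hslp : ∀ t ∈ Ioo t₁ t₂, ∫ x, ‖u (x, t) - a‖ ^ p ∂(ballProb z₀.1 r) ≤ Z := fun t hts =>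
    (integral_norm_sub_rpow_le_integral_norm_pw_sub_sq hp (hu.memLp_slice hr hQ hts) a).trans
      (mul_le_mul_of_nonneg_left (hsl t hts) (by positivity))
  have hXZ := hu.integral_norm_sub_rpow_le_of_slices hp hr ht hQ a hslp
  have hXM := integral_norm_rpow_le hp0 huL a
  have hX0 : 0 ≤ ∫ z, ‖u z - a‖ ^ p ∂P := integral_nonneg fun z => by positivity
  have hB0 : 0 ≤ ∫ z, (‖Du z‖ ^ q + ‖F z‖ ^ q) ∂P := integral_nonneg fun z => by positivity
  have hU0 : 0 ≤ ∫ z, ‖u z‖ ^ p ∂P := integral_nonneg fun z => by positivity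
  obtain ⟨G, hG0, hGq⟩ : ∃ G, 0 ≤ G ∧ ∫ z, (‖Du z‖ ^ q + ‖F z‖ ^ q) ∂P = G ^ q :=
    ⟨_, Real.rpow_nonneg hB0 (1 / q), by
      rw [← Real.rpow_mul hB0, one_div_mul_cancel hq0.ne', Real.rpow_one]⟩
  obtain ⟨M, hM0, hMp⟩ : ∃ M, 0 ≤ M ∧ ∫ z, ‖u z‖ ^ p ∂P = M ^ p :=
    ⟨_, Real.rpow_nonneg hU0 (1 / p), by
      rw [← Real.rpow_mul hU0, one_div_mul_cancel hp0.ne', Real.rpow_one]⟩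
  have hmk := hsup' hM0 hG0 hMp hGq
  have hmain' := fun {Y : ℝ} (hY0 : 0 ≤ Y) hY => hmain hu z₀.1 (Y := Y) a hr ht hY0 hM0 hG0 hQ hY
    hMp hGq
  rw [hMp] at hXM
  rw [hGq, ← Real.rpow_mul hG0, mul_div_cancel₀ _ hq0.ne']
  set X := ∫ z, ‖u z - a‖ ^ p ∂P with hX
  have hp2 : 0 ≤ p - 2 := by linarith
  have hRG : 0 ≤ r * G := by positivity
  have hρr : ρ ^ p = μ ^ (p - 2) * r ^ p := by
    rw [hrp, ← mul_assoc, ← Real.rpow_add hμ]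
    simp
  have hr2 : r ^ p = r ^ (p - 2) * r ^ (2 : ℝ) := by
    rw [← Real.rpow_add hr, sub_add_cancel]
  have hΛG : (t₂ - t₁) * G ^ (p - 1)
      ≤ 2 * (2 * K) ^ (p - 2) * r * ((M + r * G) ^ (p - 2) * (r * G)) := by
    have h1 : G ^ (p - 1) = G ^ (p - 2) * G := by
      rw [← Real.rpow_add_one' hG0 (by linarith)]
      ring_nf
    calc (t₂ - t₁) * G ^ (p - 1) = 2 * ρ ^ p * (G ^ (p - 2) * G) := by rw [h1, ht₁, ht₂]; ring
      _ = 2 * r * ((μ * (r * G)) ^ (p - 2) * (r * G)) := by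
        rw [hρr, hr2, Real.mul_rpow hμ.le hRG, Real.mul_rpow hr.le hG0, Real.rpow_two]
        ring
      _ ≤ 2 * r * ((2 * K * (M + r * G)) ^ (p - 2) * (r * G)) := by gcongr
      _ = _ := by rw [Real.mul_rpow (by positivity) (by positivity)]; ring
  have hδ0 : 0 < ε ^ ((p - q) / (2 + q - p)) := Real.rpow_pos_of_pos hε.1 _
  have hδ1 : ε ^ ((p - q) / (2 + q - p)) ≤ 1 :=
    Real.rpow_le_one hε.1.le hε.2 (div_nonneg (by linarith) (by linarith))
  have hεS : 0 ≤ ε * S := mul_nonneg hε.1.le hS0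
  by_cases hcase : X ≤ (r * G) ^ p
  · have h1 : X / r ^ p ≤ G ^ p := by
      rw [div_le_iff₀ (by positivity), mul_comm, ← Real.mul_rpow hr.le hG0]
      exact hcase
    have h2 : 1 ≤ (C + (C * C' ^ ((p - q) / 2)) ^ (2 / (2 + q - p)) + 1)
        / ε ^ ((p - q) / (2 + q - p)) := by
      rw [one_le_div hδ0]
      exact hδ1.trans (le_add_of_nonneg_left (by positivity))
    nlinarith [mul_le_mul_of_nonneg_right h2 (Real.rpow_nonneg hG0 p)]
  have hXR : (r * G) ^ p ≤ X := (not_le.1 hcase).le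
  have hy0 : ∀ t, 0 ≤ ∫ x, ‖u (x, t) - a‖ ^ (2 : ℝ) ∂(ballProb z₀.1 r) := fun t =>
    integral_nonneg fun x => by positivity
  have hyZ : ∀ t ∈ Ioo t₁ t₂,
      ∫ x, ‖u (x, t) - a‖ ^ (2 : ℝ) ∂(ballProb z₀.1 r) ≤ Z ^ (2 / p) := fun t hts => by
    have hd : MemLp (fun x => u (x, t) - a) (ENNReal.ofReal p) (ballProb z₀.1 r) :=
      (hu.memLp_slice hr hQ hts).sub (memLp_const a)
    refine (integral_rpow_le_rpow_integral (fun x => norm_nonneg _) two_pos hp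
      (MemLp.integrable_norm_rpow_of_le hp0 hd zero_le_two hp)
      (MemLp.integrable_norm_rpow_of_le hp0 hd hp0.le le_rfl)).trans ?_
    exact Real.rpow_le_rpow (integral_nonneg fun x => by positivity) (hslp t hts) (by positivity)
  rcases eq_or_lt_of_le hG0 with hG | hG
  · have h1 := hmain' (Real.rpow_nonneg hZ0 (2 / p)) hyZ hΛG
    rw [← hG, mul_zero, Real.zero_rpow hq0.ne', Real.zero_rpow hp0.ne', mul_zero, add_zero,
      mul_zero] at h1
    rw [← hG, mul_zero, Real.zero_rpow hp0.ne'] at hcase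
    exact absurd h1 hcase
  · have hYs : ∀ t ∈ Ioo t₁ t₂, ∫ x, ‖u (x, t) - a‖ ^ (2 : ℝ) ∂(ballProb z₀.1 r)
        ≤ C' * r ^ (2 : ℝ) * S * G ^ (2 - p) := fun t hts => by
      have h1 := (rpow_mul_integral_norm_sub_sq_le hp (hu.memLp_slice hr hQ hts) a).trans
        (mul_le_mul_of_nonneg_left (hsl t hts) (by positivity))
      have h2 : (∫ x, ‖u (x, t) - a‖ ^ (2 : ℝ) ∂(ballProb z₀.1 r)) ^ (p / 2) ≤ Z := by
        refine (Real.rpow_le_rpow (hy0 t) (hyZ t hts) (by positivity)).trans_eq ?_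
        rw [← Real.rpow_mul hZ0, div_mul_div_cancel₀ hp0.ne', div_self two_ne_zero, Real.rpow_one]
      have h3 := rpow_mul_le_of_le_mul_add hp (by positivity) hM0 hRG (by positivity)
        (norm_nonneg a) hX0 (hy0 t) hmk hXM hXR hXZ h1 h2
      have hk : 0 < (μ * (r * G)) ^ (p - 2) := by positivity
      refine le_of_mul_le_mul_left (h3.trans_eq ?_) hk
      have h4 : G ^ (p - 2) * G ^ (2 - p) = 1 := by
        rw [← Real.rpow_add hG]; simp
      rw [hZ, hρr, hr2, Real.mul_rpow hμ.le hRG, Real.mul_rpow hr.le hG0, hC']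
      linear_combination (-(5 * (2 * K)) ^ (p - 2) * 2 ^ p * μ ^ (p - 2) * r ^ (p - 2)
        * r ^ (2 : ℝ) * S) * h4
    have h1 := div_le_of_le_rpow_mul (by linarith : p - 2 < q) hqp hC hC'0 hr hG hS0 hε.1 hε.2
      (hmain' (by positivity) hYs hΛG)
    refine h1.trans ?_
    gcongr _ + ?_ / _ * _
    exact le_add_of_nonneg_right zero_le_one
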